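/- arXiv:0911.5284 — 3 statements merged into one kernel-verified Lean document; each statement's English description precedes it below -/
import Mathlib

section
/- The cyclotomic BMW algebra B_n^k(R) is spanned over R by the elements α_{i₁,j₁,n−1}^{s₁}⋯α_{i_m,j_m,n−2m+1}^{s_m}·χ·(α_{g_m,h_m,n−2m}^{t_m})*⋯(α_{g₁,h₁,n−2}^{t₁})*, where m ranges over 0, 1, …, ⌊n/2⌋, i₁ > i₂ > ⋯ > i_m, g₁ > g₂ > ⋯ > g_m, and for each f = 1, …, m one has 1 ≤ i_f ≤ j_f ≤ n−2f+1, 1 ≤ g_f ≤ h_f ≤ n−2f+1, s_f, t_f ∈ P, and χ ∈ Ã_{n−2m}. Equivalently, B_n^k(R) = Σ_{m=0}^{⌊n/2⌋} V_{n,m}·Ã_{n−2m}·V̄_{n,m}*. -/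
/-!
Cyclotomic BMW algebra `B_n^k(R)`, presented as the quotient of the free `R`-algebra on
generators `Y, Y⁻¹, Xᵢ, Xᵢ⁻¹ (1 ≤ i ≤ n-1), eᵢ (1 ≤ i ≤ n-1)` by the defining relations.
Generators with out-of-range indices are identified with `1` (resp. `0` for the `eᵢ`),
so that the quotient is exactly the cyclotomic BMW algebra.
-/

inductive BMWGen : Type
  | Y : BMWGen
  | Yinv : BMWGen
  | X : ℕ → BMWGen
  | Xinv : ℕ → BMWGen
  | E : ℕ → BMWGen

namespace CBMW

/-- The parameters of a cyclotomic BMW algebra: `n`, `k`, units `q, λ, q₀` and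
families `qc` (the `qᵢ`, with `qc 0 = q₀`) and `A` (the `Aᵢ`). -/
structure Params (R : Type) [CommRing R] where
  n : ℕ
  k : ℕ
  q : Rˣ
  lam : Rˣ
  q0 : Rˣ
  qc : ℕ → R
  A : ℕ → R

variable {R : Type} [CommRing R]

abbrev F (R : Type) [CommRing R] := FreeAlgebra R BMWGen

def fY : F R := FreeAlgebra.ι R BMWGen.Y
def fYi : F R := FreeAlgebra.ι R BMWGen.Yinv
def fX (i : ℕ) : F R := FreeAlgebra.ι R (BMWGen.X i)
def fXi (i : ℕ) : F R := FreeAlgebra.ι R (BMWGen.Xinv i)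
def fE (i : ℕ) : F R := FreeAlgebra.ι R (BMWGen.E i)

/-- `δ = q - q⁻¹`. -/
def Params.delta (P : Params R) : R := (P.q : R) - ((P.q⁻¹ : Rˣ) : R)

/-- `λ⁻¹` as an element of `R`. -/
def Params.laminv (P : Params R) : R := ((P.lam⁻¹ : Rˣ) : R)

/-- The defining relations of the cyclotomic BMW algebra. -/
inductive Rel (P : Params R) : F R → F R → Prop
  | X_inv_right {i : ℕ} (h1 : 1 ≤ i) (h2 : i ≤ P.n - 1) : Rel P (fX i * fXi i) 1
  | X_inv_left {i : ℕ} (h1 : 1 ≤ i) (h2 : i ≤ P.n - 1) : Rel P (fXi i * fX i) 1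
  | Y_inv_right : Rel P (fY * fYi) 1
  | Y_inv_left : Rel P (fYi * fY) 1
  | X_invalid {i : ℕ} (h : i = 0 ∨ P.n - 1 < i) : Rel P (fX i) 1
  | Xi_invalid {i : ℕ} (h : i = 0 ∨ P.n - 1 < i) : Rel P (fXi i) 1
  | E_invalid {i : ℕ} (h : i = 0 ∨ P.n - 1 < i) : Rel P (fE i) 0
  | skein {i : ℕ} (h1 : 1 ≤ i) (h2 : i ≤ P.n - 1) :
      Rel P (fX i - fXi i) (P.delta • ((1 : F R) - fE i))
  | XX_far {i j : ℕ} (h1 : 1 ≤ i) (h2 : i ≤ P.n - 1) (h3 : 1 ≤ j) (h4 : j ≤ P.n - 1)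
      (h : i + 2 ≤ j ∨ j + 2 ≤ i) : Rel P (fX i * fX j) (fX j * fX i)
  | braid {i : ℕ} (h1 : 1 ≤ i) (h2 : i + 1 ≤ P.n - 1) :
      Rel P (fX i * fX (i+1) * fX i) (fX (i+1) * fX i * fX (i+1))
  | XE_far {i j : ℕ} (h1 : 1 ≤ i) (h2 : i ≤ P.n - 1) (h3 : 1 ≤ j) (h4 : j ≤ P.n - 1)
      (h : i + 2 ≤ j ∨ j + 2 ≤ i) : Rel P (fX i * fE j) (fE j * fX i)
  | EE_far {i j : ℕ} (h1 : 1 ≤ i) (h2 : i ≤ P.n - 1) (h3 : 1 ≤ j) (h4 : j ≤ P.n - 1)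
      (h : i + 2 ≤ j ∨ j + 2 ≤ i) : Rel P (fE i * fE j) (fE j * fE i)
  | untwist_right {i : ℕ} (h1 : 1 ≤ i) (h2 : i ≤ P.n - 1) :
      Rel P (fX i * fE i) ((P.lam : R) • fE i)
  | untwist_left {i : ℕ} (h1 : 1 ≤ i) (h2 : i ≤ P.n - 1) :
      Rel P (fE i * fX i) ((P.lam : R) • fE i)
  | XXE {i j : ℕ} (h1 : 1 ≤ i) (h2 : i ≤ P.n - 1) (h3 : 1 ≤ j) (h4 : j ≤ P.n - 1)
      (h : j = i + 1 ∨ i = j + 1) : Rel P (fX i * fX j * fE i) (fE j * fE i)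
  | EXX {i j : ℕ} (h1 : 1 ≤ i) (h2 : i ≤ P.n - 1) (h3 : 1 ≤ j) (h4 : j ≤ P.n - 1)
      (h : j = i + 1 ∨ i = j + 1) : Rel P (fE j * fE i) (fE j * fX i * fX j)
  | EEE_up {i : ℕ} (h1 : 1 ≤ i) (h2 : i + 1 ≤ P.n - 1) :
      Rel P (fE i * fE (i+1) * fE i) (fE i)
  | EEE_down {i : ℕ} (h1 : 1 ≤ i) (h2 : i + 1 ≤ P.n - 1) :
      Rel P (fE (i+1) * fE i * fE (i+1)) (fE (i+1))
  | E_sq {i : ℕ} (h1 : 1 ≤ i) (h2 : i ≤ P.n - 1) : Rel P (fE i * fE i) (P.A 0 • fE i)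
  | cyclo : Rel P (fY ^ P.k) (∑ i ∈ Finset.range P.k, P.qc i • fY ^ i)
  | braidB (h : 2 ≤ P.n) :
      Rel P (fX 1 * fY * fX 1 * fY) (fY * fX 1 * fY * fX 1)
  | YX_comm {i : ℕ} (h1 : 2 ≤ i) (h2 : i ≤ P.n - 1) : Rel P (fY * fX i) (fX i * fY)
  | YE_comm {i : ℕ} (h1 : 2 ≤ i) (h2 : i ≤ P.n - 1) : Rel P (fY * fE i) (fE i * fY)
  | YXYE (h : 2 ≤ P.n) : Rel P (fY * fX 1 * fY * fE 1) (P.laminv • fE 1)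
  | EYXY (h : 2 ≤ P.n) : Rel P (fE 1 * (fY * fX 1 * fY)) (P.laminv • fE 1)
  | EYE {m : ℕ} (h : 2 ≤ P.n) (hm : m ≤ P.k - 1) :
      Rel P (fE 1 * fY ^ m * fE 1) (P.A m • fE 1)

/-- The cyclotomic BMW algebra `B_n^k(R)`. -/
abbrev Alg (P : Params R) := RingQuot (Rel P)

def pr (P : Params R) : F R →ₐ[R] Alg P := RingQuot.mkAlgHom R (Rel P)

/-- The generator `Y`. -/
def Yg (P : Params R) : Alg P := pr P fY
/-- The generator `Y⁻¹`. -/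
def Ygi (P : Params R) : Alg P := pr P fYi
/-- The generator `Xᵢ`. -/
def Xg (P : Params R) (i : ℕ) : Alg P := pr P (fX i)
/-- The generator `Xᵢ⁻¹`. -/
def Xgi (P : Params R) (i : ℕ) : Alg P := pr P (fXi i)
/-- The generator `eᵢ`. -/
def Eg (P : Params R) (i : ℕ) : Alg P := pr P (fE i)

/-- `X₁ X₂ ⋯ X_m`. -/
def upX (P : Params R) : ℕ → Alg P
  | 0 => 1
  | m + 1 => upX P m * Xg P (m + 1)

/-- `X_m ⋯ X₂ X₁`. -/
def downX (P : Params R) : ℕ → Alg P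
  | 0 => 1
  | m + 1 => Xg P (m + 1) * downX P m

/-- `X₁⁻¹ X₂⁻¹ ⋯ X_m⁻¹`. -/
def upXi (P : Params R) : ℕ → Alg P
  | 0 => 1
  | m + 1 => upXi P m * Xgi P (m + 1)

/-- `X_m⁻¹ ⋯ X₂⁻¹ X₁⁻¹`. -/
def downXi (P : Params R) : ℕ → Alg P
  | 0 => 1
  | m + 1 => Xgi P (m + 1) * downXi P m

/-- `Yᵢ' = X_{i-1} ⋯ X₁ Y X₁ ⋯ X_{i-1}`. -/
def Yp (P : Params R) (i : ℕ) : Alg P := downX P (i - 1) * Yg P * upX P (i - 1)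

/-- `(Yᵢ')⁻¹ = X_{i-1}⁻¹ ⋯ X₁⁻¹ Y⁻¹ X₁⁻¹ ⋯ X_{i-1}⁻¹`. -/
def YpInv (P : Params R) (i : ℕ) : Alg P := downXi P (i - 1) * Ygi P * upXi P (i - 1)

/-- `(Yᵢ')^p` for an integer exponent `p`. -/
def Ypow (P : Params R) (i : ℕ) (p : ℤ) : Alg P :=
  if 0 ≤ p then Yp P i ^ p.toNat else YpInv P i ^ (-p).toNat

/-- `Y^{s 1} (Y₂')^{s 2} ⋯ (Y_m')^{s m}`. -/
def YpowProd (P : Params R) (s : ℕ → ℤ) : ℕ → Alg P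
  | 0 => 1
  | m + 1 => YpowProd P s m * Ypow P (m + 1) (s (m + 1))

/-- The subalgebra `B_l` generated by `Y^{±1}, X₁^{±1}, …, X_{l-1}^{±1}, e₁, …, e_{l-1}`. -/
def Bsub (P : Params R) (l : ℕ) : Subalgebra R (Alg P) :=
  Algebra.adjoin R
    ({Yg P, Ygi P} ∪
      {x | ∃ i, 1 ≤ i ∧ i + 1 ≤ l ∧ (x = Xg P i ∨ x = Xgi P i ∨ x = Eg P i)})

/-- `α_{ijl}^p = (Yᵢ')^p Xᵢ ⋯ X_{j-1} e_j ⋯ e_l`. -/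
def alpha (P : Params R) (i j l : ℕ) (p : ℤ) : Alg P :=
  Ypow P i p * ((List.range' i (j - i)).map fun t => Xg P t).prod *
    ((List.range' j (l + 1 - j)).map fun t => Eg P t).prod

/-- The set `P = {⌊k/2⌋ - (k-1), …, ⌊k/2⌋}` of `k` consecutive integers. -/
def Pset (k : ℕ) : Set ℤ := {p | (↑(k / 2) : ℤ) - ((k : ℤ) - 1) ≤ p ∧ p ≤ (↑(k / 2) : ℤ)}

/-- `α_{i₁,j₁,l-1}^{s₁} ⋯ α_{i_m,j_m,l-2m+1}^{s_m}`. -/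
def alphaChain (P : Params R) (l : ℕ) (ii jj : ℕ → ℕ) (ss : ℕ → ℤ) : ℕ → Alg P
  | 0 => 1
  | m + 1 => alphaChain P l ii jj ss m *
      alpha P (ii (m + 1)) (jj (m + 1)) (l + 1 - 2 * (m + 1)) (ss (m + 1))

/-- `α_{i₁,j₁,l-2}^{s₁} ⋯ α_{i_m,j_m,l-2m}^{s_m}`. -/
def alphaChainBar (P : Params R) (l : ℕ) (ii jj : ℕ → ℕ) (ss : ℕ → ℤ) : ℕ → Alg P
  | 0 => 1
  | m + 1 => alphaChainBar P l ii jj ss m *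
      alpha P (ii (m + 1)) (jj (m + 1)) (l - 2 * (m + 1)) (ss (m + 1))

/-- `E_{l,m} = e_{l-1} e_{l-3} ⋯ e_{l-2m+1}`. -/
def Echain (P : Params R) (l : ℕ) : ℕ → Alg P
  | 0 => 1
  | m + 1 => Echain P l m * Eg P (l + 1 - 2 * (m + 1))

/-- The set `V_{l,m}^g`. -/
def Vg (P : Params R) (l m : ℕ) : Set (Alg P) :=
  {x | ∃ ii jj : ℕ → ℕ, ∃ ss : ℕ → ℤ,
    (∀ t, 1 ≤ t → t ≤ m →
      1 ≤ ii t ∧ ii t ≤ jj t ∧ jj t ≤ l + 1 - 2 * t ∧ ss t ∈ Pset P.k) ∧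
    x = alphaChain P l ii jj ss m}

/-- The set `V_{l,m}`. -/
def V (P : Params R) (l m : ℕ) : Set (Alg P) :=
  {x | ∃ ii jj : ℕ → ℕ, ∃ ss : ℕ → ℤ,
    (∀ t, 1 ≤ t → t ≤ m →
      1 ≤ ii t ∧ ii t ≤ jj t ∧ jj t ≤ l + 1 - 2 * t ∧ ss t ∈ Pset P.k) ∧
    (∀ t, 1 ≤ t → t + 1 ≤ m → ii (t + 1) < ii t) ∧
    x = alphaChain P l ii jj ss m}

/-- The set `V̄_{l,m}`. -/
def Vbar (P : Params R) (l m : ℕ) : Set (Alg P) :=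
  {x | ∃ ii jj : ℕ → ℕ, ∃ ss : ℕ → ℤ,
    (∀ t, 1 ≤ t → t ≤ m →
      1 ≤ ii t ∧ ii t ≤ jj t ∧ jj t ≤ l + 1 - 2 * t ∧ ss t ∈ Pset P.k) ∧
    (∀ t, 1 ≤ t → t + 1 ≤ m → ii (t + 1) < ii t) ∧
    x = alphaChainBar P l ii jj ss m}

end CBMW

section Twist

variable {R A : Type*} [CommRing R] [Ring A] [Algebra R A]

theorem mul_mul_mem_of_mem_span {S : Set A} {N : Submodule R A} {x : A} (a b : A)
    (hx : x ∈ Submodule.span R S) (h : ∀ s ∈ S, a * s * b ∈ N) : a * x * b ∈ N := by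
  induction hx using Submodule.span_induction with
  | mem s hs => exact h s hs
  | zero => simp
  | add u v _ _ hu hv => rw [mul_add, add_mul]; exact N.add_mem hu hv
  | smul r u _ hu =>
    rw [mul_smul_comm, smul_mul_assoc]; exact N.smul_mem r hu

/-- The exponents strictly preceding `p` on the way from `0`. -/
def Below (p r : ℤ) : Prop := (0 ≤ r ∧ r < p) ∨ (p ≤ r ∧ r < 0)

/-- The shifted variant of `Below` attached to the inverse generator. -/
def BelowInv (p r : ℤ) : Prop := (1 ≤ r ∧ r ≤ p - 1) ∨ (p ≤ r ∧ r ≤ 0)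

/-- The span of the elements `y ^ r z ^ (p - r)` and `y ^ r e z ^ (p - r)` with `Q r`. -/
def twistSpan (R : Type*) {A : Type*} [CommRing R] [Ring A] [Algebra R A]
    (y z : Aˣ) (e : A) (Q : ℤ → Prop) (p : ℤ) : Submodule R A :=
  Submodule.span R {x | ∃ r, Q r ∧
    (x = ↑(y ^ r) * ↑(z ^ (p - r)) ∨ x = ↑(y ^ r) * e * ↑(z ^ (p - r)))}

variable {δ : R} {X y z : Aˣ} {e : A}

theorem twistSpan_one {Q : ℤ → Prop} {p r : ℤ} (h : Q r) :
    (↑(y ^ r) * ↑(z ^ (p - r)) : A) ∈ twistSpan R y z e Q p :=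
  Submodule.subset_span ⟨r, h, Or.inl rfl⟩

theorem twistSpan_e {Q : ℤ → Prop} {p r : ℤ} (h : Q r) :
    (↑(y ^ r) * e * ↑(z ^ (p - r)) : A) ∈ twistSpan R y z e Q p :=
  Submodule.subset_span ⟨r, h, Or.inr rfl⟩

theorem zpow_mul_twistSpan {Q Q' : ℤ → Prop} {p : ℤ} (d : ℤ) (hQ : ∀ r, Q r → Q' (r + d))
    {x : A} (hx : x ∈ twistSpan R y z e Q p) :
    ↑(y ^ d) * x ∈ twistSpan R y z e Q' (p + d) := by
  have := mul_mul_mem_of_mem_span (N := twistSpan R y z e Q' (p + d)) (↑(y ^ d)) 1 hx ?_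
  · simpa using this
  rintro s ⟨r, hr, rfl | rfl⟩
  · have := twistSpan_one (R := R) (y := y) (z := z) (e := e) (p := p + d) (hQ r hr)
    rw [add_sub_add_right_eq_sub, add_comm r d, zpow_add, Units.val_mul] at this
    simpa [mul_assoc] using this
  · have := twistSpan_e (R := R) (y := y) (z := z) (e := e) (p := p + d) (hQ r hr)
    rw [add_sub_add_right_eq_sub, add_comm r d, zpow_add, Units.val_mul] at this
    simpa [mul_assoc] using this

theorem twistSpan_mono {Q Q' : ℤ → Prop} {p : ℤ} (hQ : ∀ r, Q r → Q' r) :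
    twistSpan R y z e Q p ≤ twistSpan R y z e Q' p :=
  Submodule.span_mono fun _ ⟨r, hr, h⟩ => ⟨r, hQ r hr, h⟩

theorem inv_eq_of_skein (hs : (X : A) - ↑X⁻¹ = δ • (1 - e)) :
    (↑X⁻¹ : A) = X - δ • 1 + δ • e := by
  rw [smul_sub] at hs
  rw [sub_add, ← hs]; abel

theorem mul_eq_inv_mul (hz : (z : A) = X * y * X) : (y * X : A) = ↑X⁻¹ * z := by
  rw [hz]; simp [mul_assoc]

theorem inv_mul_eq_mul_inv (hz : (z : A) = X * y * X) :
    (↑y⁻¹ * ↑X⁻¹ : A) = X * ↑z⁻¹ := by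
  have : z = X * y * X := Units.ext (by simpa using hz)
  rw [this]; simp [mul_assoc]

theorem zpow_mul_sub_mem (hz : (z : A) = X * y * X)
    (hs : (X : A) - ↑X⁻¹ = δ • (1 - e)) (p : ℤ) :
    (↑(y ^ p) * X - X * ↑(z ^ p) : A) ∈ twistSpan R y z e (Below p) p := by
  have hi := inv_eq_of_skein hs
  induction p using Int.induction_on with
  | zero => simp
  | succ i ih =>
    have h1 := zpow_mul_twistSpan (Q' := Below (i + 1)) 1 (fun r hr => by
      rcases hr with ⟨h, h'⟩ | ⟨h, h'⟩ <;> [left; right] <;> omega) ih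
    have h2 : (0 : ℤ) ≤ 0 ∧ (0 : ℤ) < i + 1 := by omega
    have h3 := twistSpan_one (R := R) (y := y) (z := z) (e := e) (p := i + 1)
      (Q := Below (i + 1)) (Or.inl h2)
    have h4 := twistSpan_e (R := R) (y := y) (z := z) (e := e) (p := i + 1)
      (Q := Below (i + 1)) (Or.inl h2)
    convert add_mem (sub_mem h1 (Submodule.smul_mem _ δ h3)) (Submodule.smul_mem _ δ h4) using 1
    have h5 : (y * (X * ↑(z ^ (i : ℤ))) : A) =
        X * ↑(z ^ ((i : ℤ) + 1)) - δ • ↑(z ^ ((i : ℤ) + 1)) + δ • (e * ↑(z ^ ((i : ℤ) + 1))) := by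
      rw [← mul_assoc, mul_eq_inv_mul hz, hi, add_comm (i : ℤ) 1, zpow_add, zpow_one]
      simp only [Units.val_mul, add_mul, sub_mul, smul_mul_assoc, one_mul, mul_assoc]
    simp only [zpow_one, mul_sub, h5, zpow_zero, Units.val_one, one_mul, sub_zero]
    rw [add_comm (i : ℤ) 1, zpow_add y, zpow_one, Units.val_mul, mul_assoc]
    abel
  | pred i ih =>
    have h1 := zpow_mul_twistSpan (Q' := Below (-i - 1)) (-1) (fun r hr => by
      rcases hr with ⟨h, h'⟩ | ⟨h, h'⟩ <;> [left; right] <;> omega) ih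
    have h2 : (-i - 1 : ℤ) ≤ -1 ∧ (-1 : ℤ) < 0 := by omega
    have h3 := twistSpan_one (R := R) (y := y) (z := z) (e := e) (p := -i - 1)
      (Q := Below (-i - 1)) (Or.inr h2)
    have h4 := twistSpan_e (R := R) (y := y) (z := z) (e := e) (p := -i - 1)
      (Q := Below (-i - 1)) (Or.inr h2)
    rw [← sub_eq_add_neg] at h1
    convert sub_mem (add_mem h1 (Submodule.smul_mem _ δ h3)) (Submodule.smul_mem _ δ h4) using 1
    have h5 : (↑y⁻¹ * (X * ↑(z ^ (-i : ℤ))) : A) =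
        X * ↑(z ^ ((-i : ℤ) - 1)) + δ • (↑y⁻¹ * ↑(z ^ (-i : ℤ)))
          - δ • (↑y⁻¹ * e * ↑(z ^ (-i : ℤ))) := by
      have h6 : (X : A) = ↑X⁻¹ + δ • 1 - δ • e := by rw [hi]; abel
      have h7 : (X * ↑(z ^ ((-i : ℤ) - 1)) : A) = ↑y⁻¹ * ↑X⁻¹ * ↑(z ^ (-i : ℤ)) := by
        rw [inv_mul_eq_mul_inv hz, sub_eq_neg_add, zpow_add, zpow_neg_one, Units.val_mul, mul_assoc]
      rw [h7]
      conv_lhs => rw [h6]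
      simp only [add_mul, sub_mul, smul_mul_assoc, one_mul, mul_assoc, mul_add, mul_sub,
        mul_smul_comm]
    simp only [zpow_neg_one, mul_sub, h5, sub_neg_eq_add, sub_add_cancel]
    rw [sub_eq_neg_add (-i : ℤ) 1, zpow_add y, zpow_neg_one, Units.val_mul, mul_assoc]
    abel

theorem zpow_mul_sub_inv_mem (hz : (z : A) = X * y * X)
    (hs : (X : A) - ↑X⁻¹ = δ • (1 - e)) (p : ℤ) :
    (↑(y ^ p) * X - ↑X⁻¹ * ↑(z ^ p) : A) ∈ twistSpan R y z e (BelowInv p) p := by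
  rcases lt_or_ge 0 p with hp | hp
  · have h1 := zpow_mul_twistSpan (Q' := BelowInv p) 1 (fun r hr => by
      rcases hr with ⟨h, h'⟩ | ⟨h, h'⟩ <;> [left; right] <;> omega)
      (zpow_mul_sub_mem hz hs (p - 1))
    rw [sub_add_cancel] at h1
    convert h1 using 1
    have h2 : (↑(y ^ p) : A) = y * ↑(y ^ (p - 1)) := by
      rw [← Units.val_mul, ← zpow_one_add, add_sub_cancel]
    have h3 : (↑(z ^ p) : A) = z * ↑(z ^ (p - 1)) := by
      rw [← Units.val_mul, ← zpow_one_add, add_sub_cancel]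
    rw [h2, h3, mul_sub, zpow_one, mul_assoc, ← mul_assoc _ (z : A), ← mul_eq_inv_mul hz]
    simp only [mul_assoc]
  · have h1 := twistSpan_mono (Q' := BelowInv p) (fun r hr => by
      rcases hr with ⟨h, h'⟩ | ⟨h, h'⟩ <;> [left; right] <;> omega)
      (zpow_mul_sub_mem hz hs p)
    have h0 : p ≤ 0 ∧ (0 : ℤ) ≤ 0 := by omega
    have h3 := twistSpan_one (R := R) (y := y) (z := z) (e := e) (p := p)
      (Q := BelowInv p) (Or.inr h0)
    have h4 := twistSpan_e (R := R) (y := y) (z := z) (e := e) (p := p)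
      (Q := BelowInv p) (Or.inr h0)
    convert sub_mem (add_mem h1 (Submodule.smul_mem _ δ h3)) (Submodule.smul_mem _ δ h4) using 1
    rw [inv_eq_of_skein hs]
    simp only [add_mul, sub_mul, smul_mul_assoc, one_mul, zpow_zero, Units.val_one, sub_zero]
    abel

/-- The mirror image of `twistSpan`. -/
def twistSpanR (R : Type*) {A : Type*} [CommRing R] [Ring A] [Algebra R A]
    (y z : Aˣ) (e : A) (Q : ℤ → Prop) (p : ℤ) : Submodule R A :=
  Submodule.span R {x | ∃ r, Q r ∧
    (x = ↑(z ^ (p - r)) * ↑(y ^ r) ∨ x = ↑(z ^ (p - r)) * e * ↑(y ^ r))}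

theorem mul_zpow_sub_mem (hz : (z : A) = X * y * X)
    (hs : (X : A) - ↑X⁻¹ = δ • (1 - e)) (p : ℤ) :
    (X * ↑(y ^ p) - ↑(z ^ p) * X : A) ∈ twistSpanR R y z e (Below p) p := by
  have key := zpow_mul_sub_mem (R := R) (A := Aᵐᵒᵖ) (δ := δ)
    (X := Units.opEquiv.symm (MulOpposite.op X))
    (y := Units.opEquiv.symm (MulOpposite.op y)) (z := Units.opEquiv.symm (MulOpposite.op z))
    (e := MulOpposite.op e) (by simp [hz, mul_assoc]) (by
      rw [← map_inv, ← MulOpposite.op_inv]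
      simp only [Units.coe_opEquiv_symm, MulOpposite.unop_op]
      rw [← MulOpposite.op_one, ← MulOpposite.op_sub, ← MulOpposite.op_sub, hs,
        MulOpposite.op_smul]) p
  have key2 := Submodule.mem_map_of_mem
    (f := ((MulOpposite.opLinearEquiv R : A ≃ₗ[R] Aᵐᵒᵖ).symm : Aᵐᵒᵖ →ₗ[R] A)) key
  rw [twistSpan, Submodule.map_span] at key2
  simp only [← map_zpow, ← MulOpposite.op_zpow, Units.coe_opEquiv_symm, MulOpposite.unop_op] at key2
  refine Submodule.span_mono ?_ (by simpa using key2)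
  rintro _ ⟨_, ⟨r, hr, rfl | rfl⟩, rfl⟩
  · exact ⟨r, hr, Or.inl (by simp)⟩
  · exact ⟨r, hr, Or.inr (by simp [mul_assoc])⟩

end Twist

/-- Elements of an algebra satisfying the defining relations of the cyclotomic BMW algebra
on `N + 1` strands. -/
structure Model (R A : Type*) [CommRing R] [Ring A] [Algebra R A] where
  N : ℕ
  k : ℕ
  δ : R
  lam : Rˣ
  X : ℕ → Aˣ
  e : ℕ → A
  Y : Aˣ
  q0 : Rˣ
  q : ℕ → R
  c : ℕ → R
  one_le_k : 1 ≤ k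
  q_zero : q 0 = q0
  skein : ∀ i, 1 ≤ i → i ≤ N → (X i : A) - ↑(X i)⁻¹ = δ • (1 - e i)
  XX_far : ∀ i j, i + 2 ≤ j → X i * X j = X j * X i
  Xe_far : ∀ i j, i + 2 ≤ j ∨ j + 2 ≤ i → Commute (X i : A) (e j)
  ee_far : ∀ i j, i + 2 ≤ j → Commute (e i) (e j)
  braid : ∀ i, 1 ≤ i → i + 1 ≤ N → X i * X (i + 1) * X i = X (i + 1) * X i * X (i + 1)
  Xe : ∀ i, 1 ≤ i → i ≤ N → X i * e i = (lam : R) • e i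
  eX : ∀ i, 1 ≤ i → i ≤ N → e i * X i = (lam : R) • e i
  XXe : ∀ i j, 1 ≤ i → i ≤ N → 1 ≤ j → j ≤ N → (j = i + 1 ∨ i = j + 1) →
    X i * X j * e i = e j * e i
  eXX : ∀ i j, 1 ≤ i → i ≤ N → 1 ≤ j → j ≤ N → (j = i + 1 ∨ i = j + 1) →
    e j * X i * X j = e j * e i
  eee : ∀ i j, 1 ≤ i → i ≤ N → 1 ≤ j → j ≤ N → (j = i + 1 ∨ i = j + 1) →
    e i * e j * e i = e i
  cyclo : (Y : A) ^ k = ∑ i ∈ Finset.range k, q i • (Y : A) ^ i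
  braidB : 1 ≤ N → X 1 * Y * X 1 * Y = Y * X 1 * Y * X 1
  YX_comm : ∀ i, 2 ≤ i → Y * X i = X i * Y
  Ye_comm : ∀ i, 2 ≤ i → Commute (Y : A) (e i)
  YXYe : 1 ≤ N → Y * X 1 * Y * e 1 = (↑lam⁻¹ : R) • e 1
  eYXY : 1 ≤ N → e 1 * Y * X 1 * Y = (↑lam⁻¹ : R) • e 1
  eYe : ∀ m, 1 ≤ N → m < k → e 1 * (Y : A) ^ m * e 1 = c m • e 1

namespace Model

variable {R A : Type*} [CommRing R] [Ring A] [Algebra R A] (M : Model R A)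

/-- The indices `i`, `j` are in range and differ by one. -/
def Adj (i j : ℕ) : Prop :=
  1 ≤ i ∧ i ≤ M.N ∧ 1 ≤ j ∧ j ≤ M.N ∧ (j = i + 1 ∨ i = j + 1)

variable {M}

theorem Adj.symm {i j : ℕ} (h : M.Adj i j) : M.Adj j i := by
  unfold Adj at *; omega

theorem adj_succ {i : ℕ} (h1 : 1 ≤ i) (h2 : i + 1 ≤ M.N) : M.Adj i (i + 1) := by
  unfold Adj at *; omega

theorem adj_pred {i : ℕ} (h1 : 1 ≤ i) (h2 : i + 1 ≤ M.N) : M.Adj (i + 1) i := by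
  unfold Adj at *; omega

variable (M)

theorem Xinv (i : ℕ) (h1 : 1 ≤ i) (h2 : i ≤ M.N) :
    (↑(M.X i)⁻¹ : A) = M.X i - M.δ • 1 + M.δ • M.e i :=
  inv_eq_of_skein (M.skein i h1 h2)

theorem commute_XX {i j : ℕ} (h : i + 2 ≤ j ∨ j + 2 ≤ i) : Commute (M.X i) (M.X j) := by
  rcases h with h | h
  · exact M.XX_far i j h
  · exact (M.XX_far j i h).symm

theorem commute_ee {i j : ℕ} (h : i + 2 ≤ j ∨ j + 2 ≤ i) : Commute (M.e i) (M.e j) := by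
  rcases h with h | h
  · exact M.ee_far i j h
  · exact (M.ee_far j i h).symm

theorem XX_e {i j : ℕ} (h : M.Adj i j) : (M.X i * M.X j * M.e i : A) = M.e j * M.e i :=
  M.XXe i j h.1 h.2.1 h.2.2.1 h.2.2.2.1 h.2.2.2.2

theorem e_XX {i j : ℕ} (h : M.Adj i j) : (M.e j * M.X i * M.X j : A) = M.e j * M.e i :=
  M.eXX i j h.1 h.2.1 h.2.2.1 h.2.2.2.1 h.2.2.2.2

theorem e_e_e {i j : ℕ} (h : M.Adj i j) : (M.e i * M.e j * M.e i : A) = M.e i :=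
  M.eee i j h.1 h.2.1 h.2.2.1 h.2.2.2.1 h.2.2.2.2

theorem X_e {i j : ℕ} (h : M.Adj i j) : (M.X j * M.e i : A) = ↑(M.X i)⁻¹ * M.e j * M.e i := by
  rw [mul_assoc, ← M.XX_e h, mul_assoc, Units.inv_mul_cancel_left]

theorem e_X {i j : ℕ} (h : M.Adj i j) : (M.e i * M.X j : A) = M.e i * M.e j * ↑(M.X i)⁻¹ := by
  rw [← M.e_XX h.symm, mul_assoc _ (M.X i : A), Units.mul_inv, mul_one]

theorem e_Xinv {i j : ℕ} (h : M.Adj i j) :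
    (M.e i * ↑(M.X j)⁻¹ : A) = M.e i * M.e j * M.X i := by
  rw [Units.mul_inv_eq_iff_eq_mul, mul_assoc (M.e i), mul_assoc (M.e i), M.e_XX h, ← mul_assoc,
    M.e_e_e h]

theorem Xinv_e {i j : ℕ} (h : M.Adj i j) :
    (↑(M.X j)⁻¹ * M.e i : A) = M.X i * M.e j * M.e i := by
  rw [Units.inv_mul_eq_iff_eq_mul, ← mul_assoc, ← mul_assoc, M.XX_e h.symm, M.e_e_e h]

theorem X_e_X {i j : ℕ} (h : M.Adj i j) :
    (M.X i * M.e j * M.X i : A) = ↑(M.X j)⁻¹ * M.e i * ↑(M.X j)⁻¹ := by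
  rw [Units.eq_mul_inv_iff_mul_eq, Units.eq_inv_mul_iff_mul_eq]
  conv_rhs => rw [← M.e_e_e h, ← M.XX_e h.symm, mul_assoc _ (M.e j), ← M.e_XX h]
  simp only [mul_assoc]

theorem Xinv_e_self {i : ℕ} (h1 : 1 ≤ i) (h2 : i ≤ M.N) :
    (↑(M.X i)⁻¹ * M.e i : A) = (↑M.lam⁻¹ : R) • M.e i := by
  rw [Units.inv_mul_eq_iff_eq_mul, mul_smul_comm, M.Xe i h1 h2, smul_smul]; simp

theorem e_Xinv_self {i : ℕ} (h1 : 1 ≤ i) (h2 : i ≤ M.N) :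
    (M.e i * ↑(M.X i)⁻¹ : A) = (↑M.lam⁻¹ : R) • M.e i := by
  rw [Units.mul_inv_eq_iff_eq_mul, smul_mul_assoc, M.eX i h1 h2, smul_smul]; simp

theorem e_X_e {i j : ℕ} (h : M.Adj i j) :
    (M.e i * M.X j * M.e i : A) = (↑M.lam⁻¹ : R) • M.e i := by
  rw [M.e_X h, mul_assoc, M.Xinv_e_self h.1 h.2.1, mul_smul_comm, M.e_e_e h]

theorem X_mul_X {i : ℕ} (h1 : 1 ≤ i) (h2 : i ≤ M.N) :
    (M.X i * M.X i : A) = 1 + M.δ • (M.X i : A) - (M.δ * M.lam) • M.e i := by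
  have h := congrArg (fun t : A => M.X i * t) (M.skein i h1 h2)
  simp only [mul_sub, Units.mul_inv, mul_smul_comm, mul_one, M.Xe i h1 h2, smul_sub, smul_smul] at h
  rw [add_sub_assoc, ← h]; abel

/-- `x` is the braid or the tangle generator at position `a`. -/
def IsGen (a : ℕ) (x : A) : Prop := x = M.X a ∨ x = M.e a

variable {M}

theorem IsGen.commute_X {a : ℕ} {x : A} (h : M.IsGen a x) {i : ℕ} (hi : i + 2 ≤ a ∨ a + 2 ≤ i) :
    Commute x (M.X i) := by
  rcases h with rfl | rfl
  · have := M.commute_XX (i := a) (j := i) (by omega)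
    exact congrArg Units.val this
  · exact (M.Xe_far i a hi).symm

theorem IsGen.commute_e {a : ℕ} {x : A} (h : M.IsGen a x) {i : ℕ} (hi : i + 2 ≤ a ∨ a + 2 ≤ i) :
    Commute x (M.e i) := by
  rcases h with rfl | rfl
  · exact M.Xe_far a i (by omega)
  · exact M.commute_ee (by omega)

theorem IsGen.commute_Y {a : ℕ} {x : A} (h : M.IsGen a x) (ha : 2 ≤ a) : Commute x (M.Y) := by
  rcases h with rfl | rfl
  · exact (congrArg Units.val (M.YX_comm a ha)).symm
  · exact (M.Ye_comm a ha).symm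

variable (M)

/-- The Jucys–Murphy type elements `Y'_i`. -/
def y : ℕ → Aˣ
  | 0 => M.Y
  | 1 => M.Y
  | i + 2 => M.X (i + 1) * y (i + 1) * M.X (i + 1)

theorem y_one : M.y 1 = M.Y := by rw [y]

theorem y_succ {i : ℕ} (h : 1 ≤ i) : M.y (i + 1) = M.X i * M.y i * M.X i := by
  obtain ⟨j, rfl⟩ := Nat.exists_eq_add_of_le' h
  rw [y]

theorem coe_y_succ {i : ℕ} (h : 1 ≤ i) :
    (M.y (i + 1) : A) = M.X i * M.y i * M.X i := by
  rw [M.y_succ h]; simp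

variable {M}

theorem IsGen.commute_y_lt {a : ℕ} {x : A} (h : M.IsGen a x) {i : ℕ} (h1 : 1 ≤ i)
    (hi : i + 1 ≤ a) : Commute x (M.y i) := by
  induction i, h1 using Nat.le_induction with
  | base => rw [M.y_one]; exact h.commute_Y hi
  | succ i h1 ih =>
    rw [M.coe_y_succ h1]
    have := h.commute_X (i := i) (by omega)
    exact (this.mul_right (ih (by omega))).mul_right this

theorem XX_slide {i j : ℕ} (h : M.Adj i j) :
    (M.X i * M.X j * M.X i : A) = M.X j * M.X i * M.X j := by
  rcases h with ⟨h1, h2, h3, h4, rfl | rfl⟩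
  · exact congrArg Units.val (M.braid i h1 h4)
  · exact (congrArg Units.val (M.braid j h3 h2)).symm

theorem slide_right {i j : ℕ} (h : M.Adj i j) {x x' : A}
    (hx : (x = M.X i ∧ x' = M.X j) ∨ (x = M.e i ∧ x' = M.e j)) :
    x * (M.X j * M.X i) = M.X j * M.X i * x' := by
  rcases hx with ⟨rfl, rfl⟩ | ⟨rfl, rfl⟩
  · rw [← mul_assoc, XX_slide h]
  · rw [← mul_assoc, M.e_XX h.symm, M.XX_e h.symm]

theorem IsGen.commute_y_gt {a : ℕ} {x : A} (h : M.IsGen a x) (h1 : 1 ≤ a) {i : ℕ}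
    (hi : a + 2 ≤ i) (hN : i ≤ M.N + 1) : Commute x (M.y i) := by
  induction i, hi using Nat.le_induction with
  | base =>
    have hadj : M.Adj a (a + 1) := adj_succ h1 (by omega)
    obtain ⟨x', hx', hxx⟩ : ∃ x', M.IsGen (a + 1) x' ∧
        ((x = M.X a ∧ x' = M.X (a + 1)) ∨ (x = M.e a ∧ x' = M.e (a + 1))) := by
      rcases h with h | h
      · exact ⟨_, Or.inl rfl, Or.inl ⟨h, rfl⟩⟩
      · exact ⟨_, Or.inr rfl, Or.inr ⟨h, rfl⟩⟩
    have e1 := slide_right hadj hxx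
    have e2 := slide_right hadj.symm (hxx.imp And.symm And.symm)
    have e3 : x' * M.y a = M.y a * x' := hx'.commute_y_lt h1 le_rfl
    have e4 : (M.y (a + 2) : A) = M.X (a + 1) * M.X a * M.y a * (M.X a * M.X (a + 1)) := by
      rw [M.coe_y_succ (by omega), M.coe_y_succ h1]; simp only [mul_assoc]
    change x * M.y (a + 2) = M.y (a + 2) * x
    rw [e4]
    calc x * (M.X (a + 1) * M.X a * M.y a * (M.X a * M.X (a + 1)))
        = x * (M.X (a + 1) * M.X a) * M.y a * (M.X a * M.X (a + 1)) := by
          simp only [mul_assoc]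
      _ = M.X (a + 1) * M.X a * (x' * M.y a) * (M.X a * M.X (a + 1)) := by
          rw [e1, mul_assoc _ x']
      _ = M.X (a + 1) * M.X a * M.y a * (x' * (M.X a * M.X (a + 1))) := by
          rw [e3]; simp only [mul_assoc]
      _ = _ := by rw [e2]; simp only [mul_assoc]
  | succ i hi ih =>
    rw [M.coe_y_succ (by omega)]
    have := h.commute_X (i := i) (by omega)
    exact (this.mul_right (ih (by omega))).mul_right this

theorem commute_Y_y {i : ℕ} (h1 : 1 ≤ i) (hN : i ≤ M.N + 1) : Commute M.Y (M.y i) := by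
  rcases h1.eq_or_lt with rfl | h1
  · rw [M.y_one]
  induction i, h1 using Nat.le_induction with
  | base =>
    rw [M.y_succ le_rfl, M.y_one]
    have := M.braidB (by omega)
    change _ = _
    rw [this]; simp only [mul_assoc]
  | succ i hi ih =>
    rw [M.y_succ (by omega)]
    have : Commute M.Y (M.X i) := M.YX_comm i hi
    exact (this.mul_right (ih (by omega) (by omega))).mul_right this

variable (M)

/-- The subalgebra generated by the generators on the first `l` strands. -/
def sub (l : ℕ) : Subalgebra R A :=
  Algebra.adjoin R ({x | 1 ≤ l ∧ (x = M.Y ∨ x = ↑M.Y⁻¹)} ∪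
    {x | ∃ i, 1 ≤ i ∧ i + 1 ≤ l ∧ (x = M.X i ∨ x = ↑(M.X i)⁻¹ ∨ x = M.e i)})

theorem sub_mono {l l' : ℕ} (h : l ≤ l') : M.sub l ≤ M.sub l' := by
  refine Algebra.adjoin_mono (Set.union_subset_union ?_ ?_)
  · rintro x ⟨h1, h2⟩; exact ⟨h1.trans h, h2⟩
  · rintro x ⟨i, h1, h2, h3⟩; exact ⟨i, h1, h2.trans h, h3⟩

theorem Y_mem_sub {l : ℕ} (h : 1 ≤ l) : (M.Y : A) ∈ M.sub l :=
  Algebra.subset_adjoin (Or.inl ⟨h, Or.inl rfl⟩)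

theorem Yinv_mem_sub {l : ℕ} (h : 1 ≤ l) : (↑M.Y⁻¹ : A) ∈ M.sub l :=
  Algebra.subset_adjoin (Or.inl ⟨h, Or.inr rfl⟩)

theorem X_mem_sub {l i : ℕ} (h1 : 1 ≤ i) (h2 : i + 1 ≤ l) : (M.X i : A) ∈ M.sub l :=
  Algebra.subset_adjoin (Or.inr ⟨i, h1, h2, Or.inl rfl⟩)

theorem Xinv_mem_sub {l i : ℕ} (h1 : 1 ≤ i) (h2 : i + 1 ≤ l) : (↑(M.X i)⁻¹ : A) ∈ M.sub l :=
  Algebra.subset_adjoin (Or.inr ⟨i, h1, h2, Or.inr (Or.inl rfl)⟩)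

theorem e_mem_sub {l i : ℕ} (h1 : 1 ≤ i) (h2 : i + 1 ≤ l) : M.e i ∈ M.sub l :=
  Algebra.subset_adjoin (Or.inr ⟨i, h1, h2, Or.inr (Or.inr rfl)⟩)

theorem units_zpow_mem {S : Subalgebra R A} {u : Aˣ} (h : (u : A) ∈ S) (h' : (↑u⁻¹ : A) ∈ S)
    (p : ℤ) : (↑(u ^ p) : A) ∈ S := by
  induction p using Int.induction_on with
  | zero => simp [S.one_mem]
  | succ i ih => rw [zpow_add_one, Units.val_mul]; exact S.mul_mem ih h
  | pred i ih => rw [zpow_sub_one, Units.val_mul]; exact S.mul_mem ih h'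

theorem y_mem_sub_aux {l i : ℕ} (h1 : 1 ≤ i) (h2 : i ≤ l) :
    (M.y i : A) ∈ M.sub l ∧ (↑(M.y i)⁻¹ : A) ∈ M.sub l := by
  induction i, h1 using Nat.le_induction with
  | base => rw [M.y_one]; exact ⟨M.Y_mem_sub h2, M.Yinv_mem_sub h2⟩
  | succ i h1 ih =>
    obtain ⟨ha, hb⟩ := ih (by omega)
    have hX := M.X_mem_sub h1 h2
    have hX' := M.Xinv_mem_sub h1 h2
    rw [M.y_succ h1]
    simp only [mul_inv_rev, Units.val_mul]
    exact ⟨mul_mem (mul_mem hX ha) hX, mul_mem hX' (mul_mem hb hX')⟩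

theorem y_zpow_mem_sub {l i : ℕ} (h1 : 1 ≤ i) (h2 : i ≤ l) (p : ℤ) :
    (↑(M.y i ^ p) : A) ∈ M.sub l :=
  units_zpow_mem (M.y_mem_sub_aux h1 h2).1 (M.y_mem_sub_aux h1 h2).2 p

theorem sub_induction {l : ℕ} {P : A → Prop} (hY : 1 ≤ l → P M.Y) (hYi : 1 ≤ l → P ↑M.Y⁻¹)
    (hX : ∀ i, 1 ≤ i → i + 1 ≤ l → P (M.X i)) (hXi : ∀ i, 1 ≤ i → i + 1 ≤ l → P ↑(M.X i)⁻¹)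
    (he : ∀ i, 1 ≤ i → i + 1 ≤ l → P (M.e i)) (halg : ∀ r : R, P (algebraMap R A r))
    (hadd : ∀ a b, P a → P b → P (a + b)) (hmul : ∀ a b, P a → P b → P (a * b))
    {x : A} (hx : x ∈ M.sub l) : P x := by
  induction hx using Algebra.adjoin_induction with
  | mem x hx =>
    rcases hx with ⟨h, rfl | rfl⟩ | ⟨i, h1, h2, rfl | rfl | rfl⟩
    exacts [hY h, hYi h, hX i h1 h2, hXi i h1 h2, he i h1 h2]
  | algebraMap r => exact halg r
  | add a b _ _ ha hb => exact hadd a b ha hb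
  | mul a b _ _ ha hb => exact hmul a b ha hb

/-- Anything commuting with the generators on `l` strands commutes with `M.sub l`. -/
theorem commute_of_mem_sub {l : ℕ} {u : A} (hY : 1 ≤ l → Commute u M.Y)
    (hg : ∀ a x, 1 ≤ a → a + 1 ≤ l → M.IsGen a x → Commute u x) {x : A} (hx : x ∈ M.sub l) :
    Commute u x := by
  refine M.sub_induction (P := Commute u) hY (fun h => (hY h).units_inv_right)
    (fun i h1 h2 => hg i _ h1 h2 (Or.inl rfl))
    (fun i h1 h2 => (hg i _ h1 h2 (Or.inl rfl)).units_inv_right)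
    (fun i h1 h2 => hg i _ h1 h2 (Or.inr rfl)) (fun r => Algebra.commute_algebraMap_right r u)
    (fun a b ha hb => ha.add_right hb) (fun a b ha hb => ha.mul_right hb) hx

theorem IsGen.commute_sub {a : ℕ} {x : A} (h : M.IsGen a x) {l : ℕ} (hl : l + 1 ≤ a) {b : A}
    (hb : b ∈ M.sub l) : Commute x b :=
  M.commute_of_mem_sub (fun _ => h.commute_Y (by omega)) (fun i z h1 h2 hz => by
    rcases hz with rfl | rfl
    · exact h.commute_X (by omega)
    · exact h.commute_e (by omega)) hb

theorem y_commute_sub {i : ℕ} (hN : i ≤ M.N + 1) {l : ℕ} (hl : l + 1 ≤ i) {b : A}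
    (hb : b ∈ M.sub l) : Commute (M.y i : A) b :=
  M.commute_of_mem_sub (fun h => (congrArg Units.val (commute_Y_y (by omega) hN)).symm)
    (fun a z h1 h2 hz => (hz.commute_y_gt h1 (by omega) hN).symm) hb

theorem y_zpow_commute_sub {i : ℕ} (hN : i ≤ M.N + 1) {l : ℕ} (hl : l + 1 ≤ i) (p : ℤ) {b : A}
    (hb : b ∈ M.sub l) : Commute (↑(M.y i ^ p) : A) b :=
  ((M.y_commute_sub hN hl hb).symm.units_zpow_right p).symm

theorem y_commute_y {i j : ℕ} (h1 : 1 ≤ i) (hi : i ≤ M.N + 1) (hj1 : 1 ≤ j) (hj : j ≤ M.N + 1) :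
    Commute (M.y i) (M.y j) := by
  have key : ∀ {i j : ℕ}, 1 ≤ i → i < j → j ≤ M.N + 1 → Commute (M.y i) (M.y j) :=
    fun h1 h2 h3 => Units.ext
      ((M.y_commute_sub h3 (Nat.succ_le_of_lt h2) (M.y_mem_sub_aux h1 le_rfl).1).symm)
  rcases lt_trichotomy i j with h | rfl | h
  exacts [key h1 h hj, Commute.refl _, (key hj1 h hi).symm]

theorem y_X_y_e {i : ℕ} (h1 : 1 ≤ i) (h2 : i ≤ M.N) :
    (M.y i * M.X i * M.y i * M.e i : A) = (↑M.lam⁻¹ : R) • M.e i := by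
  induction i, h1 using Nat.le_induction with
  | base => rw [M.y_one]; exact M.YXYe h2
  | succ b h1 ih =>
    have hadj : M.Adj b (b + 1) := adj_succ h1 h2
    have c : (M.X (b + 1) * M.y b : A) = M.y b * M.X (b + 1) :=
      IsGen.commute_y_lt (Or.inl rfl) h1 le_rfl
    calc (M.y (b + 1) * M.X (b + 1) * M.y (b + 1) * M.e (b + 1) : A)
        = M.X b * M.y b * (M.X b * M.X (b + 1) * M.X b) * M.y b * (M.X b * M.e (b + 1)) := by
          rw [M.coe_y_succ h1]; simp only [mul_assoc]
      _ = M.X b * (M.y b * M.X (b + 1)) * M.X b * (M.X (b + 1) * M.y b) *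
            (M.X b * M.e (b + 1)) := by
          rw [XX_slide hadj]; simp only [mul_assoc]
      _ = M.X b * M.X (b + 1) * (M.y b * M.X b * M.y b * (M.X (b + 1) * M.X b * M.e (b + 1))) := by
          rw [← c, c]; simp only [mul_assoc]
          simp only [← mul_assoc, c]
      _ = _ := by
          rw [M.XX_e hadj.symm, ← mul_assoc _ (M.e b), ih (by omega), smul_mul_assoc,
            mul_smul_comm, ← mul_assoc, M.XX_e hadj, M.e_e_e hadj.symm]

theorem e_y_X_y {i : ℕ} (h1 : 1 ≤ i) (h2 : i ≤ M.N) :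
    (M.e i * M.y i * M.X i * M.y i : A) = (↑M.lam⁻¹ : R) • M.e i := by
  induction i, h1 using Nat.le_induction with
  | base => rw [M.y_one]; exact M.eYXY h2
  | succ b h1 ih =>
    have hadj : M.Adj b (b + 1) := adj_succ h1 h2
    have c : (M.X (b + 1) * M.y b : A) = M.y b * M.X (b + 1) :=
      IsGen.commute_y_lt (Or.inl rfl) h1 le_rfl
    calc (M.e (b + 1) * M.y (b + 1) * M.X (b + 1) * M.y (b + 1) : A)
        = M.e (b + 1) * M.X b * M.y b * (M.X b * M.X (b + 1) * M.X b) * M.y b * M.X b := by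
          rw [M.coe_y_succ h1]; simp only [mul_assoc]
      _ = M.e (b + 1) * M.X b * (M.y b * M.X (b + 1)) * M.X b * (M.X (b + 1) * M.y b) *
            M.X b := by
          rw [XX_slide hadj]; simp only [mul_assoc]
      _ = (M.e (b + 1) * M.X b * M.X (b + 1)) * (M.y b * M.X b * M.y b) *
            (M.X (b + 1) * M.X b) := by
          rw [← c, c]; simp only [mul_assoc]
          simp only [← mul_assoc, c]
      _ = M.e (b + 1) * (M.e b * M.y b * M.X b * M.y b) * (M.X (b + 1) * M.X b) := by
          rw [M.e_XX hadj]; simp only [mul_assoc]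
      _ = _ := by
          rw [ih (by omega), mul_smul_comm, smul_mul_assoc, mul_assoc, ← mul_assoc (M.e b),
            M.e_XX hadj.symm, ← mul_assoc, M.e_e_e hadj.symm]

theorem zpow_mul_eq_self {u : Aˣ} {x : A} (h : u * x = x) (p : ℤ) : ↑(u ^ p) * x = x := by
  have h' : ↑u⁻¹ * x = x := by rw [Units.inv_mul_eq_iff_eq_mul, h]
  induction p using Int.induction_on with
  | zero => simp
  | succ i ih => rw [zpow_add_one, Units.val_mul, mul_assoc, h, ih]
  | pred i ih => rw [zpow_sub_one, Units.val_mul, mul_assoc, h', ih]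

theorem mul_zpow_eq_self {u : Aˣ} {x : A} (h : x * u = x) (p : ℤ) : x * ↑(u ^ p) = x := by
  have h' : x * ↑u⁻¹ = x := by rw [Units.mul_inv_eq_iff_eq_mul, h]
  induction p using Int.induction_on with
  | zero => simp
  | succ i ih => rw [zpow_add_one, Units.val_mul, ← mul_assoc, ih, h]
  | pred i ih => rw [zpow_sub_one, Units.val_mul, ← mul_assoc, ih, h']

theorem y_succ_zpow_e {i : ℕ} (h1 : 1 ≤ i) (h2 : i ≤ M.N) (p : ℤ) :
    (↑(M.y (i + 1) ^ p) * M.e i : A) = ↑(M.y i ^ (-p)) * M.e i := by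
  have h : ((M.y i * M.y (i + 1) : Aˣ) : A) * M.e i = M.e i := by
    rw [Units.val_mul, M.coe_y_succ h1, mul_assoc, mul_assoc, M.Xe i h1 h2]
    have := M.y_X_y_e h1 h2
    simp only [mul_assoc] at this
    simp only [mul_smul_comm, mul_assoc, this, smul_smul]
    simp
  have hc := M.y_commute_y h1 (by omega) (by omega : 1 ≤ i + 1) (by omega)
  have := zpow_mul_eq_self h p
  rw [hc.mul_zpow, Units.val_mul, mul_assoc] at this
  rw [zpow_neg, Units.eq_inv_mul_iff_mul_eq, this]

theorem e_y_succ_zpow {i : ℕ} (h1 : 1 ≤ i) (h2 : i ≤ M.N) (p : ℤ) :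
    (M.e i * ↑(M.y (i + 1) ^ p) : A) = M.e i * ↑(M.y i ^ (-p)) := by
  have hc := M.y_commute_y h1 (by omega) (by omega : 1 ≤ i + 1) (by omega)
  have h : M.e i * ((M.y i * M.y (i + 1) : Aˣ) : A) = M.e i := by
    rw [hc.eq, Units.val_mul, M.coe_y_succ h1, ← mul_assoc, ← mul_assoc, ← mul_assoc, M.eX i h1 h2]
    simp only [smul_mul_assoc, M.e_y_X_y h1 h2, smul_smul]
    simp
  have := mul_zpow_eq_self h p
  rw [hc.eq, hc.symm.mul_zpow, Units.val_mul, ← mul_assoc] at this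
  rw [zpow_neg, Units.eq_mul_inv_iff_mul_eq, this]

end Model

theorem zpow_mem_span_window {R A : Type*} [CommRing R] [Ring A] [Algebra R A] {Y : Aˣ} {k : ℕ}
    (hk : 1 ≤ k) {q : ℕ → R} {q0 : Rˣ} (hq : q 0 = q0)
    (h : (Y : A) ^ k = ∑ i ∈ Finset.range k, q i • (Y : A) ^ i) (a p : ℤ) :
    (↑(Y ^ p) : A) ∈ Submodule.span R {x : A | ∃ r, a ≤ r ∧ r < a + k ∧ x = ↑(Y ^ r)} := by
  set W : ℤ → Submodule R A := fun a => Submodule.span R {x | ∃ r, a ≤ r ∧ r < a + k ∧ x = ↑(Y ^ r)}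
  have hk0 : (1 : ℤ) ≤ k := by exact_mod_cast hk
  have hmem : ∀ {a r : ℤ}, a ≤ r → r < a + k → (↑(Y ^ r) : A) ∈ W a := fun h1 h2 =>
    Submodule.subset_span ⟨_, h1, h2, rfl⟩
  have hrel : ∀ a : ℤ, (↑(Y ^ (a + k)) : A) = ∑ i ∈ Finset.range k, q i • (↑(Y ^ (a + i)) : A) := by
    intro a
    simp only [zpow_add, Units.val_mul, zpow_natCast, Units.val_pow_eq_pow_val, h, Finset.mul_sum,
      mul_smul_comm]
  have hle : ∀ a, W (a + 1) ≤ W a := by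
    intro a
    refine Submodule.span_le.2 ?_
    rintro _ ⟨r, h1, h2, rfl⟩
    by_cases hr : r < a + k
    · exact hmem (by omega) hr
    · obtain rfl : r = a + k := by omega
      rw [hrel a]
      refine Submodule.sum_mem _ fun i hi => Submodule.smul_mem _ _ (hmem (by omega) ?_)
      have := Finset.mem_range.1 hi
      omega
  have hge : ∀ a, W a ≤ W (a + 1) := by
    intro a
    refine Submodule.span_le.2 ?_
    rintro _ ⟨r, h1, h2, rfl⟩
    by_cases hr : a + 1 ≤ r
    · exact hmem hr (by omega)
    · obtain rfl : r = a := by omega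
      have h3 := hrel r
      obtain ⟨k, rfl⟩ := Nat.exists_eq_add_of_le' hk
      rw [Finset.sum_range_succ', hq] at h3
      have h4 : (↑(Y ^ r) : A) = (↑q0⁻¹ : R) • ((↑(Y ^ (r + ((k + 1 : ℕ) : ℤ))) : A) -
          ∑ i ∈ Finset.range k, q (i + 1) • (↑(Y ^ (r + ((i + 1 : ℕ) : ℤ))) : A)) := by
        rw [h3, add_sub_cancel_left, smul_smul]
        simp
      rw [h4]
      refine Submodule.smul_mem _ _ (Submodule.sub_mem _ (hmem (by push_cast; omega)
        (by push_cast; omega)) (Submodule.sum_mem _ fun i hi => Submodule.smul_mem _ _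
          (hmem (by push_cast; omega) ?_)))
      have := Finset.mem_range.1 hi
      push_cast; omega
  have hall : ∀ a, W a = W 0 := by
    intro a
    induction a using Int.induction_on with
    | zero => rfl
    | succ i ih => rw [← ih]; exact le_antisymm (hle _) (hge _)
    | pred i ih =>
      rw [← ih]
      have h1 := hle (-i - 1)
      have h2 := hge (-i - 1)
      rw [sub_add_cancel] at h1 h2
      exact le_antisymm h2 h1
  change _ ∈ W a
  rw [hall a, ← hall p]
  exact hmem le_rfl (by omega)

namespace Model

variable {R A : Type*} [CommRing R] [Ring A] [Algebra R A] (M : Model R A)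

/-- The module `e_i B_{i-1}`. -/
def eSub (i : ℕ) : Submodule R A :=
  (Subalgebra.toSubmodule (M.sub (i - 1))).map (LinearMap.mulLeft R (M.e i))

variable {M}

theorem mem_eSub {i : ℕ} {x : A} : x ∈ M.eSub i ↔ ∃ b ∈ M.sub (i - 1), M.e i * b = x := by
  simp [eSub]

theorem e_commute_sub {i l : ℕ} (hl : l + 1 ≤ i) {b : A} (hb : b ∈ M.sub l) :
    Commute (M.e i) b :=
  IsGen.commute_sub M (Or.inr rfl) hl hb

theorem X_commute_sub {i l : ℕ} (hl : l + 1 ≤ i) {b : A} (hb : b ∈ M.sub l) :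
    Commute (M.X i : A) b :=
  IsGen.commute_sub M (Or.inl rfl) hl hb

theorem eSub_mul {i : ℕ} {x b : A} (hx : x ∈ M.eSub i) (hb : b ∈ M.sub (i - 1)) :
    x * b ∈ M.eSub i := by
  obtain ⟨c, hc, rfl⟩ := mem_eSub.1 hx
  exact mem_eSub.2 ⟨c * b, mul_mem hc hb, by rw [mul_assoc]⟩

theorem mul_eSub {i : ℕ} (h1 : 1 ≤ i) {x b : A} (hx : x ∈ M.eSub i) (hb : b ∈ M.sub (i - 1)) :
    b * x ∈ M.eSub i := by
  obtain ⟨c, hc, rfl⟩ := mem_eSub.1 hx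
  refine mem_eSub.2 ⟨b * c, mul_mem hb hc, ?_⟩
  rw [← mul_assoc, (e_commute_sub (by omega) hb).eq, mul_assoc]

theorem e_mem_eSub (i : ℕ) : M.e i ∈ M.eSub i :=
  mem_eSub.2 ⟨1, one_mem _, mul_one _⟩

theorem e_Y_e_mem (h : 1 ≤ M.N) (p : ℤ) : M.e 1 * ↑(M.Y ^ p) * M.e 1 ∈ M.eSub 1 := by
  refine mul_mul_mem_of_mem_span _ _ (zpow_mem_span_window M.one_le_k M.q_zero M.cyclo 0 p) ?_
  rintro _ ⟨r, h1, h2, rfl⟩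
  lift r to ℕ using h1
  rw [zpow_natCast, Units.val_pow_eq_pow_val, M.eYe r h (by omega)]
  exact Submodule.smul_mem _ _ (e_mem_eSub 1)

theorem e_commute_y_zpow {b : ℕ} (h1 : 1 ≤ b) (p : ℤ) :
    Commute (M.e (b + 1)) (↑(M.y b ^ p) : A) :=
  e_commute_sub le_rfl (M.y_zpow_mem_sub h1 le_rfl p)

theorem X_commute_y_zpow {b : ℕ} (h1 : 1 ≤ b) (p : ℤ) :
    Commute (M.X (b + 1) : A) (↑(M.y b ^ p) : A) :=
  X_commute_sub le_rfl (M.y_zpow_mem_sub h1 le_rfl p)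

theorem y_zpow_mul_sub_mem {b : ℕ} (h1 : 1 ≤ b) (h2 : b ≤ M.N) (p : ℤ) :
    (↑(M.y b ^ p) * M.X b - M.X b * ↑(M.y (b + 1) ^ p) : A) ∈
      twistSpan R (M.y b) (M.y (b + 1)) (M.e b) (Below p) p :=
  zpow_mul_sub_mem (M.coe_y_succ h1) (M.skein b h1 h2) p

theorem y_zpow_mul_sub_inv_mem {b : ℕ} (h1 : 1 ≤ b) (h2 : b ≤ M.N) (p : ℤ) :
    (↑(M.y b ^ p) * M.X b - ↑(M.X b)⁻¹ * ↑(M.y (b + 1) ^ p) : A) ∈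
      twistSpan R (M.y b) (M.y (b + 1)) (M.e b) (BelowInv p) p :=
  zpow_mul_sub_inv_mem (M.coe_y_succ h1) (M.skein b h1 h2) p

theorem y_zpow_commute {i j : ℕ} (h1 : 1 ≤ i) (hi : i ≤ M.N + 1) (hj1 : 1 ≤ j)
    (hj : j ≤ M.N + 1) (p q : ℤ) : Commute (↑(M.y i ^ p) : A) (↑(M.y j ^ q) : A) :=
  congrArg Units.val ((M.y_commute_y h1 hi hj1 hj).zpow_zpow p q)

theorem e_e_y_succ_e {b : ℕ} (h1 : 1 ≤ b) (h2 : b + 1 ≤ M.N) (p : ℤ) :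
    M.e (b + 1) * M.e b * ↑(M.y (b + 1) ^ p) * M.e (b + 1) =
      M.e (b + 1) * ↑(M.y b ^ (-p)) := by
  rw [mul_assoc (M.e (b + 1)) (M.e b), M.e_y_succ_zpow h1 (by omega), mul_assoc, mul_assoc,
    ← (e_commute_y_zpow h1 (-p)).eq, ← mul_assoc, ← mul_assoc, M.e_e_e (adj_pred h1 h2)]

theorem e_y_e_mul {b : ℕ} {s : ℤ} (hE : M.e b * ↑(M.y b ^ s) * M.e b ∈ M.eSub b) :
    ∃ c ∈ M.sub (b - 1), M.e b * ↑(M.y b ^ s) * M.e b = M.e b * c := by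
  obtain ⟨c, hc, h⟩ := mem_eSub.1 hE
  exact ⟨c, hc, h.symm⟩

theorem e_e_y_e_mul {b : ℕ} (h1 : 1 ≤ b) {s : ℤ}
    (hE : M.e b * ↑(M.y b ^ s) * M.e b ∈ M.eSub b) {x : A}
    (hx : M.e (b + 1) * M.e b * x ∈ M.eSub (b + 1)) :
    M.e (b + 1) * M.e b * ↑(M.y b ^ s) * M.e b * x ∈ M.eSub (b + 1) := by
  obtain ⟨c, hc, h⟩ := e_y_e_mul hE
  have h3 : M.e (b + 1) * M.e b * ↑(M.y b ^ s) * M.e b * x =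
      c * (M.e (b + 1) * M.e b * x) := by
    rw [mul_assoc (M.e (b + 1)), mul_assoc (M.e (b + 1)), h, (e_commute_sub (by omega) hc).eq,
      ← mul_assoc, (e_commute_sub (by omega) hc).eq]
    simp only [mul_assoc]
  rw [h3]
  exact mul_eSub (by omega) hx (M.sub_mono (by omega) hc)

theorem e_e_y_X_e_mem {b : ℕ} (h1 : 1 ≤ b) (h2 : b + 1 ≤ M.N)
    (hE : ∀ p : ℤ, M.e b * ↑(M.y b ^ p) * M.e b ∈ M.eSub b) (p : ℤ) :
    M.e (b + 1) * M.e b * (↑(M.y b ^ p) * M.X b) * M.e (b + 1) ∈ M.eSub (b + 1) := by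
  have hy : ∀ p : ℤ, (↑(M.y b ^ p) : A) ∈ M.sub (b + 1 - 1) := fun p =>
    M.y_zpow_mem_sub h1 (by omega) p
  rw [← sub_add_cancel (↑(M.y b ^ p) * M.X b : A) (M.X b * ↑(M.y (b + 1) ^ p)), mul_add, add_mul]
  have hz : ∀ p : ℤ, M.e (b + 1) * M.e b * ↑(M.y (b + 1) ^ p) * M.e (b + 1) ∈ M.eSub (b + 1) :=
    fun p => by
      rw [e_e_y_succ_e h1 h2]
      exact eSub_mul (e_mem_eSub _) (hy _)
  refine add_mem (mul_mul_mem_of_mem_span _ _ (y_zpow_mul_sub_mem h1 (by omega) p) ?_) ?_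
  · rintro _ ⟨r, -, rfl | rfl⟩
    · rw [(y_zpow_commute h1 (by omega) (by omega) (by omega) _ _).eq, ← mul_assoc, mul_assoc _ _
        (M.e (b + 1)), ← (e_commute_y_zpow h1 _).eq, ← mul_assoc]
      exact eSub_mul (hz _) (hy _)
    · have := e_e_y_e_mul h1 (hE r) (x := ↑(M.y (b + 1) ^ (p - r)) * M.e (b + 1))
        (by simpa only [mul_assoc] using hz (p - r))
      simpa only [mul_assoc] using this
  · rw [← mul_assoc, mul_assoc (M.e (b + 1)), M.eX b h1 (by omega)]
    simp only [mul_smul_comm, smul_mul_assoc]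
    exact Submodule.smul_mem _ _ (hz p)

theorem e_X_y_e_e_mem {b : ℕ} (h1 : 1 ≤ b) (h2 : b + 1 ≤ M.N)
    (hE : ∀ p : ℤ, M.e b * ↑(M.y b ^ p) * M.e b ∈ M.eSub b) (p : ℤ) :
    M.e (b + 1) * M.X b * ↑(M.y b ^ p) * M.e b * M.e (b + 1) ∈ M.eSub (b + 1) := by
  have h3 : (M.e (b + 1) * M.X b * ↑(M.y b ^ p) * M.e b * M.e (b + 1) : A) =
      M.e (b + 1) * M.e b * (↑(M.y b ^ p) * M.X b) * M.e (b + 1) := by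
    have hadj := adj_pred h1 h2
    have h4 := (X_commute_y_zpow (M := M) h1 p).units_inv_left
    rw [M.e_X hadj, mul_assoc _ (↑(M.X (b + 1))⁻¹ : A), h4.eq]
    simp only [mul_assoc]
    rw [M.X_e hadj]
    simp only [mul_assoc]
  rw [h3]
  exact e_e_y_X_e_mem h1 h2 hE p

theorem e_X_y_X_e_mem {b : ℕ} (h1 : 1 ≤ b) (h2 : b + 1 ≤ M.N)
    (hE : ∀ p : ℤ, M.e b * ↑(M.y b ^ p) * M.e b ∈ M.eSub b) (p : ℤ) :
    M.e (b + 1) * M.X b * ↑(M.y b ^ p) * M.X b * M.e (b + 1) ∈ M.eSub (b + 1) := by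
  have hadj := adj_pred h1 h2
  have hy : ∀ p : ℤ, (↑(M.y b ^ p) : A) ∈ M.sub (b + 1 - 1) := fun p =>
    M.y_zpow_mem_sub h1 (by omega) p
  have hX : (M.X b : A) = ↑(M.X b)⁻¹ + M.δ • 1 - M.δ • M.e b := by
    rw [M.Xinv b h1 (by omega)]; abel
  have h3 : M.e (b + 1) * ↑(M.X b)⁻¹ * ↑(M.y b ^ p) * M.X b * M.e (b + 1) ∈ M.eSub (b + 1) := by
    have h4 : (M.e (b + 1) * ↑(M.X b)⁻¹ * ↑(M.y b ^ p) * M.X b * M.e (b + 1) : A) =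
        M.e (b + 1) * M.e b * ↑(M.y b ^ p) * M.e b * M.e (b + 1) := by
      have h5 := X_commute_y_zpow (M := M) h1 p
      rw [M.e_Xinv hadj, mul_assoc _ (M.X (b + 1) : A), h5.eq]
      simp only [mul_assoc]
      rw [M.X_e hadj]
      simp only [mul_assoc, Units.mul_inv_cancel_left]
    rw [h4]
    exact e_e_y_e_mul h1 (hE p) (by rw [M.e_e_e hadj]; exact e_mem_eSub _)
  have h6 : M.e (b + 1) * ↑(M.y b ^ p) * M.X b * M.e (b + 1) ∈ M.eSub (b + 1) := by
    rw [(e_commute_y_zpow h1 p).eq, mul_assoc, mul_assoc, ← mul_assoc (M.e (b + 1)), M.e_X_e hadj]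
    exact mul_eSub (by omega) (Submodule.smul_mem _ _ (e_mem_eSub _)) (hy p)
  have h7 := e_e_y_X_e_mem h1 h2 hE p
  have h8 : (M.e (b + 1) * M.X b * ↑(M.y b ^ p) * M.X b * M.e (b + 1) : A) =
      M.e (b + 1) * ↑(M.X b)⁻¹ * ↑(M.y b ^ p) * M.X b * M.e (b + 1) +
      M.δ • (M.e (b + 1) * ↑(M.y b ^ p) * M.X b * M.e (b + 1)) -
      M.δ • (M.e (b + 1) * M.e b * (↑(M.y b ^ p) * M.X b) * M.e (b + 1)) := by
    have h9 : ∀ w : A, M.e (b + 1) * M.X b * w = M.e (b + 1) * ↑(M.X b)⁻¹ * w +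
        M.δ • (M.e (b + 1) * w) - M.δ • (M.e (b + 1) * M.e b * w) := fun w => by
      conv_lhs => rw [hX]
      simp only [mul_add, mul_sub, add_mul, sub_mul, mul_smul_comm, smul_mul_assoc, mul_one]
    simpa only [mul_assoc] using h9 (↑(M.y b ^ p) * M.X b * M.e (b + 1))
  rw [h8]
  exact sub_mem (add_mem h3 (Submodule.smul_mem _ _ h6)) (Submodule.smul_mem _ _ h7)

theorem e_y_e_mem_succ {b : ℕ} (h1 : 1 ≤ b) (h2 : b + 1 ≤ M.N)
    (hE : ∀ p : ℤ, M.e b * ↑(M.y b ^ p) * M.e b ∈ M.eSub b) (n : ℕ) (p : ℤ) (hp : p.natAbs = n) :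
    M.e (b + 1) * (M.X b * ↑(M.y (b + 1) ^ p)) * M.e (b + 1) ∈ M.eSub (b + 1) ∧
    M.e (b + 1) * ↑(M.y (b + 1) ^ p) * M.e (b + 1) ∈ M.eSub (b + 1) := by
  induction n using Nat.strong_induction_on generalizing p with
  | _ n ih =>
  subst hp
  have hadj := adj_pred h1 h2
  have hy : ∀ p : ℤ, (↑(M.y b ^ p) : A) ∈ M.sub (b + 1 - 1) := fun p =>
    M.y_zpow_mem_sub h1 (by omega) p
  have hX : ∀ p : ℤ, (∀ r, Below p r →
      M.e (b + 1) * ↑(M.y (b + 1) ^ (p - r)) * M.e (b + 1) ∈ M.eSub (b + 1)) →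
      M.e (b + 1) * (M.X b * ↑(M.y (b + 1) ^ p)) * M.e (b + 1) ∈ M.eSub (b + 1) := by
    intro p hk
    rw [← sub_sub_cancel (↑(M.y b ^ p) * M.X b : A) (M.X b * ↑(M.y (b + 1) ^ p)), mul_sub, sub_mul]
    refine sub_mem ?_ (mul_mul_mem_of_mem_span _ _ (y_zpow_mul_sub_mem h1 (by omega) p) ?_)
    · rw [← mul_assoc, (e_commute_y_zpow h1 p).eq, mul_assoc, mul_assoc, ← mul_assoc (M.e (b + 1)),
        M.e_X_e hadj]
      exact mul_eSub (by omega) (Submodule.smul_mem _ _ (e_mem_eSub _)) (hy p)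
    · rintro _ ⟨r, hr, rfl | rfl⟩
      · rw [← mul_assoc, (e_commute_y_zpow h1 r).eq, mul_assoc, mul_assoc,
          ← mul_assoc (M.e (b + 1))]
        exact mul_eSub (by omega) (hk r hr) (hy r)
      · rw [← mul_assoc, ← mul_assoc, (e_commute_y_zpow h1 r).eq, mul_assoc, mul_assoc, mul_assoc,
          ← mul_assoc (M.e (b + 1)), ← mul_assoc (M.e (b + 1) * M.e b),
          e_e_y_succ_e h1 h2]
        exact mul_eSub (by omega) (eSub_mul (e_mem_eSub _) (hy _)) (hy r)
  have hk : ∀ p : ℤ, (∀ r, BelowInv p r →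
      M.e (b + 1) * (M.X b * ↑(M.y (b + 1) ^ (p - r))) * M.e (b + 1) ∈ M.eSub (b + 1)) →
      M.e (b + 1) * ↑(M.y (b + 1) ^ p) * M.e (b + 1) ∈ M.eSub (b + 1) := by
    intro p hh
    have h3 : (↑(M.y (b + 1) ^ p) : A) = M.X b * ↑(M.y b ^ p) * M.X b -
        M.X b * (↑(M.y b ^ p) * M.X b - ↑(M.X b)⁻¹ * ↑(M.y (b + 1) ^ p)) := by
      rw [mul_sub, Units.mul_inv_cancel_left, ← mul_assoc, sub_sub_cancel]
    rw [h3, mul_sub, sub_mul]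
    refine sub_mem ?_ ?_
    · simpa only [mul_assoc] using e_X_y_X_e_mem h1 h2 hE p
    · rw [← mul_assoc]
      refine mul_mul_mem_of_mem_span _ _ (y_zpow_mul_sub_inv_mem h1 (by omega) p) ?_
      rintro _ ⟨r, hr, rfl | rfl⟩
      · rw [(y_zpow_commute h1 (by omega) (by omega) (by omega) _ _).eq, ← mul_assoc, mul_assoc _ _
          (M.e (b + 1)), ← (e_commute_y_zpow h1 _).eq, ← mul_assoc, mul_assoc (M.e (b + 1))]
        exact eSub_mul (hh r hr) (hy _)
      · rw [mul_assoc _ (M.e b), M.e_y_succ_zpow h1 (by omega), mul_assoc _ _ (M.e (b + 1)),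
          mul_assoc _ _ (M.e (b + 1)), mul_assoc (M.e b), ← (e_commute_y_zpow h1 _).eq]
        have := eSub_mul (e_X_y_e_e_mem h1 h2 hE r) (hy (-(p - r)))
        simpa only [mul_assoc] using this
  rcases lt_or_ge 0 p with hp | hp
  · have h4 := hk p fun r hr => (ih _ (by unfold BelowInv at hr; omega) (p - r) rfl).1
    refine ⟨hX p fun r hr => ?_, h4⟩
    by_cases h0 : r = 0
    · rw [h0, sub_zero]; exact h4
    · exact (ih _ (by unfold Below at hr; omega) (p - r) rfl).2
  · have h4 := hX p fun r hr => (ih _ (by unfold Below at hr; omega) (p - r) rfl).2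
    refine ⟨h4, hk p fun r hr => ?_⟩
    by_cases h0 : r = 0
    · rw [h0, sub_zero]; exact h4
    · exact (ih _ (by unfold BelowInv at hr; omega) (p - r) rfl).1

theorem e_y_e_mem {i : ℕ} (h1 : 1 ≤ i) (h2 : i ≤ M.N) (p : ℤ) :
    M.e i * ↑(M.y i ^ p) * M.e i ∈ M.eSub i := by
  induction i, h1 using Nat.le_induction generalizing p with
  | base => rw [M.y_one]; exact e_Y_e_mem h2 p
  | succ b h1 ih => exact (e_y_e_mem_succ h1 h2 (ih (by omega)) _ p rfl).2

end Model

namespace Model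

variable {R A : Type*} [CommRing R] [Ring A] [Algebra R A] (M : Model R A)

/-- The word `X_i ⋯ X_{j-1} e_j ⋯ e_L`. -/
def w (L i j : ℕ) : A :=
  ((List.range' i (j - i)).map fun t => (M.X t : A)).prod *
    ((List.range' j (L + 1 - j)).map fun t => M.e t).prod

theorem w_of_lt {L i j : ℕ} (h : i < j) : M.w L i j = M.X i * M.w L (i + 1) j := by
  obtain ⟨n, rfl⟩ : ∃ n, j = i + 1 + n := ⟨j - (i + 1), by omega⟩
  rw [w, w, show i + 1 + n - i = n + 1 by omega, List.range'_succ,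
    show i + 1 + n - (i + 1) = n by omega]
  simp [mul_assoc]

theorem w_self {L j : ℕ} (h : j ≤ L) : M.w L j j = M.e j * M.w L (j + 1) (j + 1) := by
  rw [w, w, show L + 1 - j = (L + 1 - (j + 1)) + 1 by omega, List.range'_succ]
  simp

theorem w_end (L : ℕ) : M.w L (L + 1) (L + 1) = 1 := by simp [w]

theorem w_succ {L i j : ℕ} (h : j ≤ L + 1) : M.w (L + 1) i j = M.w L i j * M.e (L + 1) := by
  obtain ⟨n, hn⟩ : ∃ n, L + 1 = j + n := ⟨L + 1 - j, by omega⟩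
  rw [w, w, hn, show j + n + 1 - j = n + 1 by omega, show j + n - j = n by omega,
    List.range'_1_concat]
  simp [mul_assoc]

variable {M}

theorem commute_w {u : A} {L i j : ℕ} (hij : i ≤ j)
    (h : ∀ t x, i ≤ t → t < j ∨ t ≤ L → M.IsGen t x → Commute u x) : Commute u (M.w L i j) := by
  refine Commute.mul_right (Commute.list_prod_right _ _ ?_) (Commute.list_prod_right _ _ ?_)
  · intro x hx
    obtain ⟨t, ht, rfl⟩ := List.mem_map.1 hx
    rw [List.mem_range'_1] at ht
    exact h t _ ht.1 (by omega) (Or.inl rfl)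
  · intro x hx
    obtain ⟨t, ht, rfl⟩ := List.mem_map.1 hx
    rw [List.mem_range'_1] at ht
    exact h t _ (by omega) (by omega) (Or.inr rfl)

theorem IsGen.commute_w {a : ℕ} {x : A} (hx : M.IsGen a x) {L i j : ℕ} (hij : i ≤ j)
    (h : a + 2 ≤ i) : Commute x (M.w L i j) :=
  Model.commute_w hij fun t z ht _ hz => by
    rcases hz with rfl | rfl
    · exact hx.commute_X (by omega)
    · exact hx.commute_e (by omega)

theorem sub_commute_w {b : A} {l L i j : ℕ} (hb : b ∈ M.sub l) (hij : i ≤ j) (h : l + 1 ≤ i) :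
    Commute b (M.w L i j) :=
  Model.commute_w hij fun _ _ ht _ hz => (hz.commute_sub M (h.trans ht) hb).symm

theorem w_mem_sub {L i j : ℕ} (h1 : 1 ≤ i) (hij : i ≤ j) (hj : j ≤ L + 1) :
    M.w L i j ∈ M.sub (L + 1) := by
  refine mul_mem (Subalgebra.list_prod_mem _ ?_) (Subalgebra.list_prod_mem _ ?_)
  · intro x hx
    obtain ⟨t, ht, rfl⟩ := List.mem_map.1 hx
    rw [List.mem_range'_1] at ht
    exact M.X_mem_sub (by omega) (by omega)
  · intro x hx
    obtain ⟨t, ht, rfl⟩ := List.mem_map.1 hx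
    rw [List.mem_range'_1] at ht
    exact M.e_mem_sub (by omega) (by omega)

theorem e_w_succ {L i j : ℕ} (h1 : 1 ≤ i) (hij : i + 1 ≤ j) (hj : j ≤ L) (hL : L ≤ M.N) :
    ∃ b ∈ M.sub (L - 1), M.e i * M.w L (i + 1) j = M.w L i i * b := by
  obtain ⟨n, rfl⟩ := Nat.exists_eq_add_of_le hij
  induction n generalizing i with
  | zero => exact ⟨1, one_mem _, by rw [mul_one, M.w_self (j := i) (by omega), add_zero]⟩
  | succ n ih =>
    obtain ⟨b, hb, h⟩ := ih (i := i + 1) (by omega) (by omega) (by omega)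
    refine ⟨b * ↑(M.X i)⁻¹, mul_mem hb (M.Xinv_mem_sub h1 (by omega)), ?_⟩
    rw [show i + 1 + (n + 1) = i + 1 + 1 + n by omega, M.w_of_lt (by omega), ← mul_assoc,
      M.e_X (adj_succ h1 (by omega)), mul_assoc,
      ((IsGen.commute_w (Or.inl rfl) (by omega) le_rfl).units_inv_left).eq, ← mul_assoc,
      mul_assoc (M.e i), h, M.w_self (by omega : i ≤ L)]
    simp only [mul_assoc]

theorem e_w_self {L i j : ℕ} (h1 : 1 ≤ i) (hij : i < j) (hj : j ≤ L) (hL : L ≤ M.N) :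
    ∃ b ∈ M.sub (L - 1), M.e j * M.w L i j = M.w L j j * b := by
  obtain ⟨n, rfl⟩ := Nat.exists_eq_add_of_lt hij
  induction n generalizing i with
  | zero =>
    refine ⟨algebraMap R A ↑M.lam⁻¹, Subalgebra.algebraMap_mem _ _, ?_⟩
    rw [M.w_of_lt (by omega), add_zero, M.w_self (by omega), ← mul_assoc, ← mul_assoc,
      M.e_X_e (adj_pred h1 (by omega)), ← Algebra.commutes, Algebra.smul_def, mul_assoc]
  | succ n ih =>
    obtain ⟨b, hb, h⟩ := ih (i := i + 1) (by omega) (by omega) (by omega)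
    have hX : M.IsGen i (M.X i) := Or.inl rfl
    refine ⟨M.X i * b, mul_mem (M.X_mem_sub h1 (by omega)) hb, ?_⟩
    rw [show i + (n + 1) + 1 = i + 1 + n + 1 by omega, M.w_of_lt (by omega), ← mul_assoc,
      ← (hX.commute_e (by omega)).eq, mul_assoc, h, ← mul_assoc,
      (hX.commute_w le_rfl (by omega)).eq, mul_assoc]

theorem X_w_self {L i j : ℕ} (h1 : 1 ≤ i) (hij : i ≤ j) (hj : j + 1 ≤ L) (hL : L ≤ M.N) :
    M.X (j + 1) * M.w L i (j + 1) = M.w L i j := by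
  obtain ⟨n, rfl⟩ := Nat.exists_eq_add_of_le hij
  induction n generalizing i with
  | zero =>
    rw [M.w_of_lt (by omega), add_zero, M.w_self (j := i + 1) (by omega), ← mul_assoc,
      ← mul_assoc, M.XX_e (adj_pred h1 (by omega)), M.w_self (j := i) (by omega),
      M.w_self (j := i + 1) (by omega), mul_assoc]
  | succ n ih =>
    have hX : M.IsGen i (M.X i) := Or.inl rfl
    have := ih (i := i + 1) (by omega) (by omega) (by omega)
    rw [show i + (n + 1) = i + 1 + n by omega, M.w_of_lt (by omega), ← mul_assoc,
      ← (hX.commute_X (by omega)).eq, mul_assoc, this, ← M.w_of_lt (by omega)]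

theorem gen_w_between {L i j a : ℕ} (h1 : 1 ≤ i) (hia : i ≤ a) (haj : a + 1 < j) (hj : j ≤ L)
    (hL : L ≤ M.N) {x x' : A}
    (hx : (x = M.X (a + 1) ∧ x' = M.X a) ∨ (x = M.e (a + 1) ∧ x' = M.e a)) :
    x * M.w L i j = M.w L i j * x' := by
  obtain ⟨n, rfl⟩ := Nat.exists_eq_add_of_le hia
  have hx0 : M.IsGen (i + n + 1) x := hx.imp And.left And.left
  have hx1 : M.IsGen (i + n) x' := hx.imp And.right And.right
  induction n generalizing i with
  | zero =>
    rw [M.w_of_lt (by omega), M.w_of_lt (by omega), ← mul_assoc, ← mul_assoc,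
      mul_assoc x, slide_right (adj_pred h1 (by omega)) hx, mul_assoc _ x', mul_assoc _ _ x',
      (hx1.commute_w (by omega) (by omega)).eq]
    simp only [mul_assoc]
  | succ n ih =>
    rw [show i + (n + 1) = i + 1 + n by omega] at *
    have := ih (i := i + 1) (by omega) (by omega) (by omega) hx hx0 hx1
    rw [M.w_of_lt (by omega), ← mul_assoc, (hx0.commute_X (i := i) (by omega)).eq, mul_assoc, this,
      mul_assoc]

theorem e_w_next {L i j : ℕ} (h1 : 1 ≤ i) (hij : i ≤ j) (hj : j + 1 ≤ L) (hL : L ≤ M.N) :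
    ∃ b ∈ M.sub (L - 1), M.e (j + 1) * M.w L i j = M.w L (j + 1) (j + 1) * b := by
  obtain ⟨n, rfl⟩ := Nat.exists_eq_add_of_le hij
  induction n generalizing i with
  | zero =>
    refine ⟨1, one_mem _, ?_⟩
    rw [add_zero, M.w_self (by omega), M.w_self (by omega), ← mul_assoc, ← mul_assoc,
      M.e_e_e (adj_pred h1 (by omega)), mul_one]
  | succ n ih =>
    obtain ⟨b, hb, h⟩ := ih (i := i + 1) (by omega) (by omega) (by omega)
    have hX : M.IsGen i (M.X i) := Or.inl rfl
    refine ⟨M.X i * b, mul_mem (M.X_mem_sub h1 (by omega)) hb, ?_⟩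
    rw [show i + (n + 1) = i + 1 + n by omega, M.w_of_lt (by omega), ← mul_assoc,
      ← (hX.commute_e (by omega)).eq, mul_assoc, h, ← mul_assoc,
      (hX.commute_w le_rfl (by omega)).eq, mul_assoc]

theorem X_w_next {L i j : ℕ} (h1 : 1 ≤ i) (hij : i ≤ j) (hj : j + 1 ≤ L) (hL : L ≤ M.N) :
    M.X (j + 1) * M.w L i j = M.w L i (j + 1) + M.δ • M.w L i j -
      (M.δ * M.lam) • (M.e (j + 1) * M.w L i (j + 1)) := by
  have h := X_w_self h1 hij hj hL
  rw [← h, ← mul_assoc, M.X_mul_X (by omega) (by omega)]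
  simp only [add_mul, sub_mul, one_mul, smul_mul_assoc]

theorem gen_w_beyond {L i j a : ℕ} (h1 : 1 ≤ i) (hij : i ≤ j) (hja : j ≤ a) (ha : a + 2 ≤ L)
    (hL : L ≤ M.N) {x x' : A}
    (hx : (x = M.X (a + 2) ∧ x' = M.X a) ∨ (x = M.e (a + 2) ∧ x' = M.e a)) :
    x * M.w L i j = M.w L i j * x' := by
  have hx0 : M.IsGen (a + 2) x := hx.imp And.left And.left
  have hx1 : M.IsGen a x' := hx.imp And.right And.right
  obtain ⟨n, rfl⟩ := Nat.exists_eq_add_of_le hij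
  induction n generalizing i with
  | succ n ih =>
    have := ih (i := i + 1) (by omega) (by omega) (by omega)
    rw [show i + (n + 1) = i + 1 + n by omega, M.w_of_lt (by omega), ← mul_assoc,
      (hx0.commute_X (i := i) (by omega)).eq, mul_assoc, this, mul_assoc]
  | zero =>
    simp only [add_zero] at hja ⊢
    clear hij
    obtain ⟨n, rfl⟩ := Nat.exists_eq_add_of_le hja
    induction n generalizing i with
    | zero =>
      have h3 : M.e i * M.e (i + 1) * x' * M.e (i + 2) = M.e i * x * M.e (i + 1) * M.e (i + 2) := by
        rcases hx with ⟨rfl, rfl⟩ | ⟨rfl, rfl⟩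
        · rw [add_zero, ← M.e_Xinv (adj_succ h1 (by omega)), mul_assoc,
            M.Xinv_e (adj_pred (by omega) (by omega))]
          simp only [mul_assoc]
        · rw [add_zero, M.e_e_e (adj_succ h1 (by omega)), mul_assoc, mul_assoc,
            ← mul_assoc (M.e (i + 2)),
            M.e_e_e (adj_pred (by omega) (by omega))]
      have h4 : M.w L i i = M.e i * M.e (i + 1) * M.e (i + 2) * M.w L (i + 3) (i + 3) := by
        rw [M.w_self (by omega), M.w_self (by omega), M.w_self (by omega)]
        simp only [mul_assoc]
      rw [h4, mul_assoc _ _ x', ← (hx1.commute_w le_rfl (by omega)).eq, ← mul_assoc _ x',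
        mul_assoc _ _ x', ← (hx1.commute_e (by omega)).eq, ← mul_assoc _ x', h3,
        ← (hx0.commute_e (i := i) (by omega)).eq]
      simp only [mul_assoc]
    | succ n ih =>
      have := ih (i := i + 1) (by omega) (by omega)
        (by rwa [show i + 1 + n = i + (n + 1) by omega])
        (by rwa [show i + 1 + n = i + (n + 1) by omega])
        (by rwa [show i + 1 + n = i + (n + 1) by omega]) (by omega)
      rw [M.w_self (by omega), ← mul_assoc, (hx0.commute_e (i := i) (by omega)).eq, mul_assoc, this,
        mul_assoc]

theorem w_mul_y {L i j a : ℕ} (h1 : 1 ≤ i) (hij : i ≤ j) (hja : j ≤ a) (ha : a + 1 ≤ L)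
    (hL : L ≤ M.N) (p : ℤ) :
    M.w L i j * ↑(M.y a ^ p) = ↑(M.y (a + 2) ^ p) * M.w L i j := by
  have hg : ∀ t x, 1 ≤ t → t ≤ a → M.IsGen t x → Commute x (↑(M.y (a + 2) ^ p) : A) :=
    fun t x h1 h2 hx => (hx.commute_y_gt h1 (by omega) (by omega)).units_zpow_right p
  obtain ⟨n, rfl⟩ := Nat.exists_eq_add_of_le hij
  induction n generalizing i with
  | succ n ih =>
    have := ih (i := i + 1) (by omega) (by omega) (by omega)
    rw [show i + (n + 1) = i + 1 + n by omega, M.w_of_lt (by omega), mul_assoc, this,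
      ← mul_assoc, (hg i _ h1 (by omega) (Or.inl rfl)).eq, mul_assoc]
  | zero =>
    simp only [add_zero] at hja ⊢
    clear hij
    obtain ⟨n, rfl⟩ := Nat.exists_eq_add_of_le hja
    induction n generalizing i with
    | zero =>
      have h4 : M.w L i i = M.e i * M.e (i + 1) * M.w L (i + 2) (i + 2) := by
        rw [M.w_self (by omega), M.w_self (by omega), mul_assoc]
      have h5 : Commute (↑(M.y i ^ p) : A) (M.w L (i + 2) (i + 2)) :=
        sub_commute_w (M.y_zpow_mem_sub h1 le_rfl p) le_rfl (by omega)
      have h6 : (↑(M.y (i + 2) ^ p) * (M.e i * M.e (i + 1)) : A) =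
          M.e i * M.e (i + 1) * ↑(M.y i ^ p) := by
        rw [← mul_assoc, ← (hg i _ h1 le_rfl (Or.inr rfl)).eq, mul_assoc,
          M.y_succ_zpow_e (i := i + 1) (by omega) (by omega), ← mul_assoc,
          M.e_y_succ_zpow h1 (by omega), neg_neg, mul_assoc, mul_assoc,
          (e_commute_y_zpow h1 p).eq]
      rw [add_zero, h4, mul_assoc, ← h5.eq, ← mul_assoc, ← h6]
      simp only [mul_assoc]
    | succ n ih =>
      have := ih (i := i + 1) (by omega) (by omega)
        (by rwa [show i + 1 + n = i + (n + 1) by omega]) (by omega)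
      rw [show i + 1 + n = i + (n + 1) by omega] at this
      rw [M.w_self (by omega), mul_assoc, this, ← mul_assoc,
        (hg i _ h1 (by omega) (Or.inr rfl)).eq, mul_assoc]

theorem mul_list_prod_slide {u : A} {f g : ℕ → A} {a n : ℕ}
    (h : ∀ t, a ≤ t → t < a + n → g t * u = u * f t) :
    u * ((List.range' a n).map f).prod = ((List.range' a n).map g).prod * u := by
  induction n generalizing a with
  | zero => simp
  | succ n ih =>
    rw [List.range'_succ]
    simp only [List.map_cons, List.prod_cons]
    rw [← mul_assoc, ← h a le_rfl (by omega), mul_assoc,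
      ih (a := a + 1) fun t ht ht' => h t (by omega) (by omega), mul_assoc]

theorem w_mul_w {L i j a c : ℕ} (h1 : 1 ≤ i) (hij : i ≤ j) (hja : j ≤ a) (hac : a ≤ c)
    (hc : c ≤ L + 1) (hL : L + 2 ≤ M.N) :
    M.w (L + 2) i j * M.w L a c = M.w (L + 2) (a + 2) (c + 2) * M.w (L + 2) i j := by
  have hr : ∀ (f : ℕ → A) (a n : ℕ), ((List.range' (a + 2) n).map f).prod =
      ((List.range' a n).map fun t => f (t + 2)).prod := by
    intro f a n
    rw [add_comm a 2, ← List.map_add_range', List.map_map]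
    congr 2
    funext t
    simp [add_comm]
  conv_lhs => rw [w.eq_1 M L a c, ← mul_assoc]
  conv_rhs => rw [w.eq_1 M (L + 2) (a + 2), hr, hr, show c + 2 - (a + 2) = c - a by omega,
    show L + 2 + 1 - (c + 2) = L + 1 - c by omega]
  rw [mul_list_prod_slide (f := fun t => (M.X t : A)) (g := fun t => (M.X (t + 2) : A))
      (fun t ht ht' => gen_w_beyond h1 hij (by omega) (by omega) hL (Or.inl ⟨rfl, rfl⟩)),
    mul_assoc, mul_list_prod_slide (f := M.e) (g := fun t => M.e (t + 2))
      (fun t ht ht' => gen_w_beyond h1 hij (by omega) (by omega) hL (Or.inr ⟨rfl, rfl⟩)),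
    mul_assoc]

theorem e_mul_w {L i j : ℕ} (hij : i ≤ j) (hj : j ≤ L + 1) (hL : L + 2 ≤ M.N) :
    M.e (L + 2) * M.w (L + 2) i j = M.e (L + 2) * M.w L i j := by
  have hc : Commute (M.e (L + 2)) (M.w L i j) := Model.commute_w hij fun t z _ ht hz =>
    (hz.commute_e (by omega)).symm
  rw [M.w_succ (by omega), M.w_succ (by omega), ← mul_assoc, ← mul_assoc, hc.eq, mul_assoc,
    mul_assoc, ← mul_assoc (M.e (L + 2)), M.e_e_e (adj_pred (by omega) hL)]

theorem w_mul_w_drop {L i j a c : ℕ} (hij : i ≤ j) (hj : j ≤ L + 1) (hL : L + 2 ≤ M.N)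
    (hc : c ≤ L + 2) :
    M.w (L + 2) a c * M.w (L + 2) i j = M.w (L + 2) a c * M.w L i j := by
  rw [M.w_succ (by omega), mul_assoc, mul_assoc, e_mul_w hij hj hL]

end Model

/-- `C` is stable under left multiplication by `B`. -/
def LeftStable {R A : Type*} [CommRing R] [Ring A] [Algebra R A] (B : Subalgebra R A)
    (C : Submodule R A) : Prop :=
  ∀ b ∈ B, ∀ c ∈ C, b * c ∈ C

namespace Model

section

variable {R A : Type*} [CommRing R] [Ring A] [Algebra R A] (M : Model R A)

/-- The span of the elements `y_i ^ p w_{ij} c` with `1 ≤ i ≤ j ≤ L`, `D i p` and `c ∈ C`. -/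
def wSpan (L : ℕ) (D : ℕ → ℤ → Prop) (C : Submodule R A) : Submodule R A :=
  Submodule.span R {x | ∃ i j p c, 1 ≤ i ∧ i ≤ j ∧ j ≤ L ∧ D i p ∧ c ∈ C ∧
    x = ↑(M.y i ^ p) * (M.w L i j * c)}

variable {M}

variable {L : ℕ} {D D' : ℕ → ℤ → Prop} {C N : Submodule R A}

theorem mem_wSpan {i j : ℕ} {p : ℤ} {c : A} (h1 : 1 ≤ i) (hij : i ≤ j) (hj : j ≤ L) (hD : D i p)
    (hc : c ∈ C) : ↑(M.y i ^ p) * (M.w L i j * c) ∈ M.wSpan L D C :=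
  Submodule.subset_span ⟨i, j, p, c, h1, hij, hj, hD, hc, rfl⟩

theorem w_mem_wSpan {i j : ℕ} {c : A} (h1 : 1 ≤ i) (hij : i ≤ j) (hj : j ≤ L) (hD : D i 0)
    (hc : c ∈ C) : M.w L i j * c ∈ M.wSpan L D C := by
  simpa using mem_wSpan (M := M) (p := 0) h1 hij hj hD hc

theorem wSpan_mul_mem {x m : A} (hm : m ∈ M.wSpan L D C)
    (h : ∀ i j p c, 1 ≤ i → i ≤ j → j ≤ L → D i p → c ∈ C →
      x * (↑(M.y i ^ p) * (M.w L i j * c)) ∈ N) : x * m ∈ N := by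
  have := mul_mul_mem_of_mem_span (N := N) x 1 hm (by
    rintro s ⟨i, j, p, c, h1, h2, h3, h4, h5, rfl⟩
    simpa using h i j p c h1 h2 h3 h4 h5)
  simpa using this

theorem wSpan_le (h : ∀ i j p c, 1 ≤ i → i ≤ j → j ≤ L → D i p → c ∈ C →
      ↑(M.y i ^ p) * (M.w L i j * c) ∈ N) : M.wSpan L D C ≤ N := by
  intro m hm
  simpa using wSpan_mul_mem (x := 1) hm (by simpa using h)

theorem wSpan_mono (h : ∀ i p, D i p → D' i p) : M.wSpan L D C ≤ M.wSpan L D' C :=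
  wSpan_le fun _ _ _ _ h1 h2 h3 h4 h5 => mem_wSpan h1 h2 h3 (h _ _ h4) h5

theorem sub_mul_term {i j l : ℕ} {b : A} (p : ℤ) (c : A) (hb : b ∈ M.sub l) (hl : l + 1 ≤ i)
    (hij : i ≤ j) (hi : i ≤ M.N + 1) :
    b * (↑(M.y i ^ p) * (M.w L i j * c)) = ↑(M.y i ^ p) * (M.w L i j * (b * c)) := by
  rw [← mul_assoc, ← (M.y_zpow_commute_sub hi hl p hb).eq, mul_assoc, ← mul_assoc b,
    (sub_commute_w hb hij hl).eq, mul_assoc]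

theorem sub_mul_mem (hL : L ≤ M.N) (hC : LeftStable (M.sub (L - 1)) C) {a : ℕ}
    (hD : ∀ i p, D i p → a + 1 ≤ i) {b m : A} (hb : b ∈ M.sub a) (hm : m ∈ M.wSpan L D C) :
    b * m ∈ M.wSpan L D C :=
  wSpan_mul_mem hm fun i j p c h1 h2 h3 h4 h5 => by
    have := hD i p h4
    rw [sub_mul_term p c hb this h2 (by omega)]
    exact mem_wSpan h1 h2 h3 h4 (hC _ (M.sub_mono (by omega) hb) _ h5)

theorem y_e_y_w_mem (hL : L ≤ M.N) (hC : LeftStable (M.sub (L - 1)) C) {b j : ℕ} {r : ℤ} (s : ℤ)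
    {c : A} (h1 : 1 ≤ b) (hbj : b + 1 ≤ j) (hj : j ≤ L) (hD : D b r) (hc : c ∈ C) :
    ↑(M.y b ^ r) * (M.e b * (↑(M.y (b + 1) ^ s) * (M.w L (b + 1) j * c))) ∈ M.wSpan L D C := by
  obtain ⟨b', hb', h⟩ := e_w_succ h1 hbj hj hL
  rw [← mul_assoc (M.e b), M.e_y_succ_zpow h1 (by omega), mul_assoc, ← mul_assoc _ _ c,
    (sub_commute_w (M.y_zpow_mem_sub h1 le_rfl (-s)) hbj le_rfl).eq, mul_assoc,
    ← mul_assoc (M.e b), h, mul_assoc]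
  exact mem_wSpan h1 le_rfl (by omega) hD
    (hC _ hb' _ (hC _ (M.y_zpow_mem_sub h1 (by omega) _) _ hc))

theorem e_mul_mem_of_succ (hL : L ≤ M.N) (hC : LeftStable (M.sub (L - 1)) C) {b j : ℕ} (s : ℤ)
    {c : A} (h1 : 1 ≤ b) (hbj : b + 1 ≤ j) (hj : j ≤ L) (hD : D b 0) (hc : c ∈ C) :
    M.e b * (↑(M.y (b + 1) ^ s) * (M.w L (b + 1) j * c)) ∈ M.wSpan L D C := by
  simpa using y_e_y_w_mem (M := M) hL hC (r := 0) s h1 hbj hj hD hc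

theorem X_mul_mem_of_succ (hL : L ≤ M.N) (hC : LeftStable (M.sub (L - 1)) C) {b j : ℕ} {p : ℤ}
    {c : A} (h1 : 1 ≤ b) (hbj : b + 1 ≤ j) (hj : j ≤ L) (hD : D b p)
    (hD' : ∀ r, Below p r → D (b + 1) (p - r) ∧ D b r) (hc : c ∈ C) :
    M.X b * (↑(M.y (b + 1) ^ p) * (M.w L (b + 1) j * c)) ∈ M.wSpan L D C := by
  have h2 : b ≤ M.N := by omega
  have h := mul_mul_mem_of_mem_span (N := M.wSpan L D C) 1 (M.w L (b + 1) j * c)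
    (y_zpow_mul_sub_mem h1 h2 p) (by
      rintro s ⟨r, hr, rfl | rfl⟩
      · rw [one_mul, mul_assoc, sub_mul_term _ _ (M.y_zpow_mem_sub h1 le_rfl r) le_rfl hbj
          (by omega)]
        exact mem_wSpan (by omega) hbj hj (hD' r hr).1
          (hC _ (M.y_zpow_mem_sub h1 (by omega) _) _ hc)
      · rw [one_mul, mul_assoc, mul_assoc]
        exact y_e_y_w_mem hL hC _ h1 hbj hj (hD' r hr).2 hc)
  have h' : ↑(M.y b ^ p) * (M.w L b j * c) ∈ M.wSpan L D C := mem_wSpan h1 (by omega) hj hD hc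
  rw [M.w_of_lt (by omega)] at h'
  convert Submodule.sub_mem _ h' h using 1
  noncomm_ring

theorem term_self (i : ℕ) (h1 : 1 ≤ i) (hiL : i ≤ L) (hL : L ≤ M.N) (p : ℤ) (c : A) :
    ↑(M.y i ^ p) * (M.w L i i * c) =
      ↑(M.y (i + 1) ^ (-p)) * M.e i * (M.w L (i + 1) (i + 1) * c) := by
  rw [M.y_succ_zpow_e h1 (by omega), neg_neg, M.w_self hiL]
  simp only [mul_assoc]

theorem y_e_sub_mem (hC : LeftStable (M.sub (L - 1)) C) {i : ℕ} (h1 : 1 ≤ i) (hiL : i ≤ L)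
    {p : ℤ} (hD : D i p) {x c : A} (hx : x ∈ M.eSub i) (hc : c ∈ C) :
    ↑(M.y i ^ p) * (x * (M.w L (i + 1) (i + 1) * c)) ∈ M.wSpan L D C := by
  obtain ⟨b, hb, rfl⟩ := mem_eSub.1 hx
  rw [mul_assoc, ← mul_assoc b, (sub_commute_w hb le_rfl (by omega)).eq, mul_assoc, ← mul_assoc,
    ← mul_assoc, mul_assoc (↑(M.y i ^ p) : A), ← M.w_self hiL, mul_assoc]
  exact mem_wSpan h1 le_rfl hiL hD (hC _ (M.sub_mono (by omega) hb) _ hc)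

theorem e_mul_mem_of_self (hL : L ≤ M.N) (hC : LeftStable (M.sub (L - 1)) C) {i : ℕ} {p : ℤ}
    {c : A} (h1 : 1 ≤ i) (hiL : i ≤ L) (hD : D i 0) (hc : c ∈ C) :
    M.e i * (↑(M.y i ^ p) * (M.w L i i * c)) ∈ M.wSpan L D C := by
  have := y_e_sub_mem hC h1 hiL hD (e_y_e_mem h1 (hiL.trans hL) p) hc
  rw [M.w_self hiL]
  simpa [mul_assoc] using this

theorem X_mul_mem_of_self (hL : L ≤ M.N) (hC : LeftStable (M.sub (L - 1)) C) {i : ℕ} {p : ℤ}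
    {c : A} (h1 : 1 ≤ i) (hiL : i ≤ L) (hD : ∀ q, D i q) (hc : c ∈ C) :
    M.X i * (↑(M.y i ^ p) * (M.w L i i * c)) ∈ M.wSpan L D C := by
  have h2 : i ≤ M.N := by omega
  have h := mul_mul_mem_of_mem_span (N := M.wSpan L D C) 1
    (M.e i * (M.w L (i + 1) (i + 1) * c)) (y_zpow_mul_sub_mem h1 h2 (-p)) (by
      rintro s ⟨r, hr, rfl | rfl⟩
      · rw [one_mul, mul_assoc, ← mul_assoc _ (M.e i), M.y_succ_zpow_e h1 h2, mul_assoc,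
          ← mul_assoc, ← Units.val_mul, ← zpow_add]
        exact y_e_sub_mem hC h1 hiL (hD _) (M.e_mem_eSub i) hc
      · simp only [one_mul, mul_assoc]
        rw [← mul_assoc _ (M.e i) (_ * c), M.y_succ_zpow_e h1 h2, ← mul_assoc (M.e i),
          ← mul_assoc (M.e i)]
        exact y_e_sub_mem hC h1 hiL (hD _) (e_y_e_mem h1 h2 _) hc)
  have h' : ↑(M.y i ^ (-p)) * (M.e i * (M.w L (i + 1) (i + 1) * c)) ∈ M.wSpan L D C :=
    y_e_sub_mem hC h1 hiL (hD _) (M.e_mem_eSub i) hc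
  rw [term_self i h1 hiL hL]
  convert Submodule.sub_mem _ (Submodule.smul_mem _ (M.lam : R) h') h using 1
  have hXe := M.Xe i h1 h2
  rw [one_mul, sub_mul, mul_assoc _ (M.X i : A), ← mul_assoc (M.X i : A) (M.e i), hXe]
  simp only [smul_mul_assoc, mul_smul_comm, mul_assoc]
  abel

/-- The exponents between `0` (included) and `p` (excluded). -/
def Between (p s : ℤ) : Prop := (0 ≤ s ∧ s < p) ∨ (p < s ∧ s ≤ 0)

theorem X_mul_sub_mem (hL : L ≤ M.N) (hC : LeftStable (M.sub (L - 1)) C) {b j : ℕ} {p : ℤ}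
    {c : A} (h1 : 1 ≤ b) (hbj : b + 1 ≤ j) (hj : j ≤ L) (hD : ∀ q, D b q)
    (hD' : ∀ s, Between p s → D (b + 1) s) (hc : c ∈ C) :
    M.X b * (↑(M.y b ^ p) * (M.w L b j * c)) - ↑(M.y (b + 1) ^ p) * (M.w L (b + 1) j * c) ∈
      M.wSpan L D C := by
  have h2 : b ≤ M.N := by omega
  have h := mul_mul_mem_of_mem_span (N := M.wSpan L D C) (M.X b) (M.w L (b + 1) j * c)
    (y_zpow_mul_sub_inv_mem h1 h2 p) (by
      rintro s ⟨r, hr, rfl | rfl⟩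
      · rw [mul_assoc, mul_assoc, sub_mul_term _ _ (M.y_zpow_mem_sub h1 le_rfl r) le_rfl hbj
          (by omega)]
        refine X_mul_mem_of_succ hL hC h1 hbj hj (hD _) (fun r' hr' => ⟨hD' _ ?_, hD _⟩)
          (hC _ (M.y_zpow_mem_sub h1 (by omega) _) _ hc)
        unfold Below at hr'; unfold BelowInv at hr; unfold Between; omega
      · obtain ⟨b', hb', h⟩ := e_w_succ h1 hbj hj hL
        rw [mul_assoc, mul_assoc, mul_assoc, ← mul_assoc (M.e b), M.e_y_succ_zpow h1 (by omega),
          mul_assoc, ← mul_assoc _ _ c,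
          (sub_commute_w (M.y_zpow_mem_sub h1 le_rfl _) hbj le_rfl).eq, mul_assoc,
          ← mul_assoc (M.e b), h, mul_assoc]
        exact X_mul_mem_of_self hL hC h1 (by omega) hD
          (hC _ hb' _ (hC _ (M.y_zpow_mem_sub h1 (by omega) _) _ hc)))
  convert h using 1
  rw [M.w_of_lt (by omega), mul_sub, sub_mul, Units.mul_inv_cancel_left]
  simp only [mul_assoc]

theorem e_mul_mem_of_lt (hL : L ≤ M.N) (hC : LeftStable (M.sub (L - 1)) C) {b j : ℕ} {p : ℤ}
    {c : A} (h1 : 1 ≤ b) (hbj : b + 1 ≤ j) (hj : j ≤ L) (hD : D b 0) (hc : c ∈ C) :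
    M.e b * (↑(M.y b ^ p) * (M.w L b j * c)) ∈ M.wSpan L D C := by
  have h2 : b ≤ M.N := by omega
  have h := mul_mul_mem_of_mem_span (N := M.wSpan L D C) (M.e b) (M.w L (b + 1) j * c)
    (y_zpow_mul_sub_inv_mem h1 h2 p) (by
      rintro s ⟨r, hr, rfl | rfl⟩
      · rw [mul_assoc, mul_assoc, sub_mul_term _ _ (M.y_zpow_mem_sub h1 le_rfl r) le_rfl hbj
          (by omega)]
        exact e_mul_mem_of_succ hL hC _ h1 hbj hj hD (hC _ (M.y_zpow_mem_sub h1 (by omega) _) _ hc)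
      · obtain ⟨b', hb', h⟩ := mem_eSub.1 (e_y_e_mem h1 h2 r)
        rw [← mul_assoc, ← mul_assoc, ← mul_assoc, ← h, mul_assoc, mul_assoc, mul_assoc,
          sub_mul_term _ _ hb' (by omega) hbj (by omega)]
        exact e_mul_mem_of_succ hL hC _ h1 hbj hj hD (hC _ (M.sub_mono (by omega) hb') _ hc))
  have h' := Submodule.smul_mem _ (↑M.lam⁻¹ : R)
    (e_mul_mem_of_succ (D := D) hL hC p h1 hbj hj hD hc)
  convert Submodule.add_mem _ h h' using 1
  rw [M.w_of_lt (by omega), mul_sub, sub_mul, ← mul_assoc _ (↑(M.X b)⁻¹ : A),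
    M.e_Xinv_self h1 h2]
  simp only [mul_assoc, smul_mul_assoc]
  abel

theorem gen_mul_mem_of_gt (hL : L ≤ M.N) (hC : LeftStable (M.sub (L - 1)) C) {i j a : ℕ} {p : ℤ}
    {x c : A} (h1 : 1 ≤ i) (hij : i ≤ j) (hj : j ≤ L) (hia : i < a) (ha : a ≤ L)
    (hx : M.IsGen a x) (hD : D i p) (hD' : D a 0) (hc : c ∈ C) :
    x * (↑(M.y i ^ p) * (M.w L i j * c)) ∈ M.wSpan L D C := by
  have hy : ∀ {a : ℕ} (_ : i < a) (d : A), (↑(M.y i ^ p) * (M.w L a a * d) : A) =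
      M.w L a a * (↑(M.y i ^ p) * d) := by
    intro a ha d
    rw [← mul_assoc, (sub_commute_w (M.y_zpow_mem_sub h1 le_rfl p) le_rfl ha).eq, mul_assoc]
  have hw : ∀ {a : ℕ} (_ : i < a) (_ : a ≤ L) (_ : D a 0), ∀ b ∈ M.sub (L - 1),
      ↑(M.y i ^ p) * (M.w L a a * (b * c)) ∈ M.wSpan L D C := by
    intro a ha haL hDa b hb
    rw [hy ha]
    exact w_mem_wSpan (by omega) le_rfl haL hDa
      (hC _ (M.y_zpow_mem_sub h1 (by omega) _) _ (hC _ hb _ hc))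
  have hxy : x * (↑(M.y i ^ p) * (M.w L i j * c)) = ↑(M.y i ^ p) * (x * M.w L i j * c) := by
    rw [← mul_assoc, ((hx.commute_y_lt h1 hia).units_zpow_right p).eq]
    simp only [mul_assoc]
  rw [hxy]
  have hgen : ∀ {t : ℕ} {z : A}, M.IsGen t z → 1 ≤ t → t + 1 ≤ L - 1 → z ∈ M.sub (L - 1) := by
    rintro t z (rfl | rfl) h h'
    · exact M.X_mem_sub h h'
    · exact M.e_mem_sub h h'
  rcases lt_trichotomy a j with haj | rfl | haj
  · obtain ⟨a, rfl⟩ : ∃ a', a = a' + 1 := ⟨a - 1, by omega⟩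
    obtain ⟨x', hx', hxx⟩ : ∃ x', M.IsGen a x' ∧
        ((x = M.X (a + 1) ∧ x' = M.X a) ∨ (x = M.e (a + 1) ∧ x' = M.e a)) := by
      rcases hx with h | h
      · exact ⟨_, Or.inl rfl, Or.inl ⟨h, rfl⟩⟩
      · exact ⟨_, Or.inr rfl, Or.inr ⟨h, rfl⟩⟩
    rw [gen_w_between h1 (by omega) haj hj hL hxx, mul_assoc]
    exact mem_wSpan h1 hij hj hD (hC _ (hgen hx' (by omega) (by omega)) _ hc)
  · rcases hx with rfl | rfl
    · obtain ⟨j, rfl⟩ : ∃ j', a = j' + 1 := ⟨a - 1, by omega⟩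
      rw [X_w_self h1 (by omega) hj hL]
      exact mem_wSpan h1 (by omega) (by omega) hD hc
    · obtain ⟨b, hb, h⟩ := e_w_self h1 hia hj hL
      rw [h, mul_assoc]
      exact hw hia hj hD' b hb
  · obtain rfl | haj' : a = j + 1 ∨ j + 2 ≤ a := by omega
    · rcases hx with rfl | rfl
      · rw [X_w_next h1 hij ha hL]
        obtain ⟨b, hb, h⟩ := e_w_self h1 hia ha hL
        rw [h, sub_mul, add_mul, smul_mul_assoc, smul_mul_assoc, mul_sub, mul_add, mul_smul_comm,
          mul_smul_comm, mul_assoc (M.w L (j + 1) (j + 1))]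
        exact Submodule.sub_mem _ (Submodule.add_mem _ (mem_wSpan h1 (by omega) ha hD hc)
          (Submodule.smul_mem _ _ (mem_wSpan h1 hij hj hD hc)))
          (Submodule.smul_mem _ _ (hw hia ha hD' b hb))
      · obtain ⟨b, hb, h⟩ := e_w_next h1 hij ha hL
        rw [h, mul_assoc]
        exact hw hia ha hD' b hb
    · obtain ⟨a, rfl⟩ : ∃ a', a = a' + 2 := ⟨a - 2, by omega⟩
      obtain ⟨x', hx', hxx⟩ : ∃ x', M.IsGen a x' ∧
          ((x = M.X (a + 2) ∧ x' = M.X a) ∨ (x = M.e (a + 2) ∧ x' = M.e a)) := by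
        rcases hx with h | h
        · exact ⟨_, Or.inl rfl, Or.inl ⟨h, rfl⟩⟩
        · exact ⟨_, Or.inr rfl, Or.inr ⟨h, rfl⟩⟩
      rw [gen_w_beyond h1 hij (by omega) ha hL hxx, mul_assoc]
      exact mem_wSpan h1 hij hj hD (hC _ (hgen hx' (by omega) (by omega)) _ hc)

end

end Model

namespace Model

section

variable {R A : Type*} [CommRing R] [Ring A] [Algebra R A] {M : Model R A}
variable {L : ℕ} {C : Submodule R A}

theorem gen_mul_mem (hL : L ≤ M.N) (hC : LeftStable (M.sub (L - 1)) C) {a : ℕ} {x m : A}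
    (h1 : 1 ≤ a) (ha : a ≤ L) (hx : M.IsGen a x) (hm : m ∈ M.wSpan L (fun _ _ => True) C) :
    x * m ∈ M.wSpan L (fun _ _ => True) C := by
  refine wSpan_mul_mem hm fun i j p c hi hij hj _ hc => ?_
  obtain h | rfl | rfl | h : a + 2 ≤ i ∨ i = a + 1 ∨ i = a ∨ i < a := by omega
  · have hxs : x ∈ M.sub (a + 1) := by
      rcases hx with rfl | rfl
      · exact M.X_mem_sub h1 le_rfl
      · exact M.e_mem_sub h1 le_rfl
    rw [sub_mul_term p c hxs (by omega) hij (by omega)]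
    exact mem_wSpan hi hij hj trivial (hC _ (M.sub_mono (by omega) hxs) _ hc)
  · rcases hx with rfl | rfl
    · exact X_mul_mem_of_succ hL hC h1 hij hj trivial (fun _ _ => ⟨trivial, trivial⟩) hc
    · exact e_mul_mem_of_succ hL hC p h1 hij hj trivial hc
  · obtain rfl | hij := hij.eq_or_lt
    · rcases hx with rfl | rfl
      · exact X_mul_mem_of_self hL hC h1 hj (fun _ => trivial) hc
      · exact e_mul_mem_of_self hL hC h1 hj trivial hc
    · rcases hx with rfl | rfl
      · have h := X_mul_sub_mem (D := fun _ _ => True) hL hC h1 hij hj (p := p) (fun _ => trivial)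
          (fun _ _ => trivial) hc
        exact (Submodule.sub_mem_iff_left _ (mem_wSpan (by omega) hij hj trivial hc)).1 h
      · exact e_mul_mem_of_lt hL hC h1 hij hj trivial hc
  · exact gen_mul_mem_of_gt hL hC hi hij hj h ha hx trivial trivial hc

theorem Y_mul_mem (hL : L ≤ M.N) (hC : LeftStable (M.sub (L - 1)) C) (q : ℤ) {m : A}
    (hm : m ∈ M.wSpan L (fun _ _ => True) C) :
    ↑(M.Y ^ q) * m ∈ M.wSpan L (fun _ _ => True) C := by
  refine wSpan_mul_mem hm fun i j p c hi hij hj _ hc => ?_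
  obtain rfl | h : i = 1 ∨ 2 ≤ i := by omega
  · rw [← mul_assoc, M.y_one, ← Units.val_mul, ← zpow_add, ← M.y_one]
    exact mem_wSpan le_rfl hij hj trivial hc
  · have hY : (↑(M.Y ^ q) : A) ∈ M.sub 1 := by
      rw [← M.y_one]; exact M.y_zpow_mem_sub le_rfl le_rfl q
    rw [sub_mul_term p c hY h hij (by omega)]
    exact mem_wSpan hi hij hj trivial (hC _ (M.sub_mono (by omega) hY) _ hc)

theorem wSpan_true_leftStable (hL : L ≤ M.N) (hC : LeftStable (M.sub (L - 1)) C) :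
    LeftStable (M.sub (L + 1)) (M.wSpan L (fun _ _ => True) C) := by
  intro b hb
  have hX : ∀ i, 1 ≤ i → i + 1 ≤ L + 1 → ∀ m ∈ M.wSpan L (fun _ _ => True) C,
      ↑(M.X i) * m ∈ M.wSpan L (fun _ _ => True) C := fun i h1 h2 m hm =>
    gen_mul_mem hL hC h1 (by omega) (Or.inl rfl) hm
  have he : ∀ i, 1 ≤ i → i + 1 ≤ L + 1 → ∀ m ∈ M.wSpan L (fun _ _ => True) C,
      M.e i * m ∈ M.wSpan L (fun _ _ => True) C := fun i h1 h2 m hm =>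
    gen_mul_mem hL hC h1 (by omega) (Or.inr rfl) hm
  refine M.sub_induction (P := fun b => ∀ m ∈ M.wSpan L (fun _ _ => True) C,
    b * m ∈ M.wSpan L (fun _ _ => True) C) ?_ ?_ hX ?_ he ?_ ?_ ?_ hb
  · intro _ m hm; simpa using Y_mul_mem hL hC 1 hm
  · intro _ m hm; simpa using Y_mul_mem hL hC (-1) hm
  · intro i h1 h2 m hm
    rw [M.Xinv i h1 (by omega), add_mul, sub_mul, smul_mul_assoc, smul_mul_assoc, one_mul]
    exact Submodule.add_mem _ (Submodule.sub_mem _ (hX i h1 h2 m hm) (Submodule.smul_mem _ _ hm))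
      (Submodule.smul_mem _ _ (he i h1 h2 m hm))
  · intro r m hm
    rw [← Algebra.smul_def]
    exact Submodule.smul_mem _ _ hm
  · intro a b ha hb m hm
    rw [add_mul]
    exact Submodule.add_mem _ (ha m hm) (hb m hm)
  · intro a b ha hb m hm
    rw [mul_assoc]
    exact ha _ (hb m hm)

variable (M) in
/-- The conjugate `X_{i-1} ⋯ X_1 Y X_1⁻¹ ⋯ X_{i-1}⁻¹` of `Y`. -/
def yConj : ℕ → Aˣ
  | 0 => M.Y
  | 1 => M.Y
  | i + 2 => M.X (i + 1) * yConj (i + 1) * (M.X (i + 1))⁻¹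

theorem yConj_one : M.yConj 1 = M.Y := rfl

theorem yConj_succ_zpow {i : ℕ} (h1 : 1 ≤ i) (p : ℤ) :
    M.yConj (i + 1) ^ p = M.X i * M.yConj i ^ p * (M.X i)⁻¹ := by
  obtain ⟨i, rfl⟩ : ∃ i', i = i' + 1 := ⟨i - 1, by omega⟩
  exact conj_zpow

theorem yConj_zpow_mem_sub {i l : ℕ} (h1 : 1 ≤ i) (h2 : i ≤ l) (p : ℤ) :
    (↑(M.yConj i ^ p) : A) ∈ M.sub l := by
  induction i, h1 using Nat.le_induction with
  | base => rw [yConj_one, ← M.y_one]; exact M.y_zpow_mem_sub le_rfl h2 p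
  | succ i h1 ih =>
    rw [yConj_succ_zpow h1, Units.val_mul, Units.val_mul]
    exact mul_mem (mul_mem (M.X_mem_sub h1 h2) (ih (by omega))) (M.Xinv_mem_sub h1 h2)

theorem yConj_zpow_mem_span (i : ℕ) (a p : ℤ) :
    (↑(M.yConj i ^ p) : A) ∈
      Submodule.span R {x : A | ∃ r, a ≤ r ∧ r < a + M.k ∧ x = ↑(M.yConj i ^ r)} := by
  obtain rfl | h1 := Nat.eq_zero_or_pos i
  · exact zpow_mem_span_window M.one_le_k M.q_zero M.cyclo a p
  induction i, h1 using Nat.le_induction with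
  | base => exact zpow_mem_span_window M.one_le_k M.q_zero M.cyclo a p
  | succ i h1 ih =>
    rw [yConj_succ_zpow h1, Units.val_mul, Units.val_mul]
    refine mul_mul_mem_of_mem_span _ _ ih ?_
    rintro s ⟨r, h, h', rfl⟩
    exact Submodule.subset_span ⟨r, h, h', by
      rw [yConj_succ_zpow h1, Units.val_mul, Units.val_mul]⟩

/-- The index set of the correction terms when comparing `y_i ^ p` to its conjugate variant. -/
def Lower (i : ℕ) (p : ℤ) (i' : ℕ) (p' : ℤ) : Prop := i' < i ∨ (i' = i ∧ Between p p')

theorem X_mul_mem_lower_succ (hL : L ≤ M.N) (hC : LeftStable (M.sub (L - 1)) C) {b : ℕ}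
    (hb : 1 ≤ b) (hbL : b ≤ L) {p : ℤ} {m : A} (hm : m ∈ M.wSpan L (Lower b p) C) :
    M.X b * m ∈ M.wSpan L (Lower (b + 1) p) C := by
  refine wSpan_mul_mem hm fun i j q c hi hij hj hD hc => ?_
  obtain h | ⟨rfl, hq⟩ := hD
  · exact gen_mul_mem_of_gt hL hC hi hij hj h hbL (Or.inl rfl) (Or.inl (by omega))
      (Or.inl (by omega)) hc
  · have hD : ∀ q, Lower (i + 1) p i q := fun _ => Or.inl (by omega)
    obtain rfl | hij := hij.eq_or_lt
    · exact X_mul_mem_of_self hL hC hi hj hD hc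
    · have h := X_mul_sub_mem (p := q) hL hC hi hij hj hD (fun s hs => Or.inr ⟨rfl, by
        unfold Between at *; omega⟩) hc
      exact (Submodule.sub_mem_iff_left _
        (mem_wSpan (by omega) hij hj (Or.inr ⟨rfl, hq⟩) hc)).1 h

theorem yConj_sub_y_mem (hL : L ≤ M.N) (hC : LeftStable (M.sub (L - 1)) C) {i j : ℕ} (p : ℤ)
    {c : A} (h1 : 1 ≤ i) (hij : i ≤ j) (hj : j ≤ L) (hc : c ∈ C) :
    ↑(M.yConj i ^ p) * (M.w L i j * c) - ↑(M.y i ^ p) * (M.w L i j * c) ∈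
      M.wSpan L (Lower i p) C := by
  induction i, h1 using Nat.le_induction generalizing j c with
  | base => rw [yConj_one, M.y_one, sub_self]; exact Submodule.zero_mem _
  | succ b h1 ih =>
    have hb : b ≤ M.N := by omega
    have hD : ∀ q, Lower (b + 1) p b q := fun _ => Or.inl (by omega)
    have hXy : ∀ {j : ℕ} {c : A}, b ≤ j → j ≤ L → c ∈ C →
        M.X b * (↑(M.yConj b ^ p) * (M.w L b j * c)) -
          M.X b * (↑(M.y b ^ p) * (M.w L b j * c)) ∈ M.wSpan L (Lower (b + 1) p) C := by
      intro j c hbj hj hc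
      rw [← mul_sub]
      exact X_mul_mem_lower_succ hL hC h1 (by omega) (ih hbj hj hc)
    have t1 := Submodule.add_mem _ (hXy (by omega) hj hc)
      (X_mul_sub_mem (p := p) hL hC h1 hij hj hD (fun s hs => Or.inr ⟨rfl, hs⟩) hc)
    have t2 : M.X b * (↑(M.yConj b ^ p) * (M.w L (b + 1) j * c)) ∈
        M.wSpan L (Lower (b + 1) p) C := by
      have hs := M.yConj_zpow_mem_sub h1 le_rfl p
      rw [← mul_assoc _ _ c, (sub_commute_w hs hij le_rfl).eq, mul_assoc, ← mul_assoc,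
        ← M.w_of_lt (by omega)]
      exact w_mem_wSpan h1 (by omega) hj (hD 0) (hC _ (M.yConj_zpow_mem_sub h1 (by omega) p) _ hc)
    obtain ⟨b', hb', he⟩ := e_w_succ h1 hij hj hL
    have hb'c := hC _ hb' _ hc
    have t3 := Submodule.add_mem _ (hXy le_rfl (by omega) hb'c)
      (X_mul_mem_of_self (p := p) hL hC h1 (by omega) hD hb'c)
    have key : ↑(M.yConj (b + 1) ^ p) * (M.w L (b + 1) j * c) =
        M.X b * (↑(M.yConj b ^ p) * (M.w L b j * c)) -
        M.δ • (M.X b * (↑(M.yConj b ^ p) * (M.w L (b + 1) j * c))) +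
        M.δ • (M.X b * (↑(M.yConj b ^ p) * (M.w L b b * (b' * c)))) := by
      rw [yConj_succ_zpow h1, Units.val_mul, Units.val_mul, M.Xinv b h1 hb,
        M.w_of_lt (by omega : b < j), ← mul_assoc (M.w L b b), ← he]
      simp only [mul_add, add_mul, mul_sub, sub_mul, mul_smul_comm, smul_mul_assoc, mul_assoc,
        mul_one]
    rw [key]
    convert Submodule.add_mem _ (Submodule.sub_mem _ t1 (Submodule.smul_mem _ M.δ t2))
      (Submodule.smul_mem _ M.δ t3) using 1
    rw [sub_add_cancel, sub_add_sub_cancel]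
    abel

variable (M) in
/-- Membership in the window of `k` consecutive exponents around `0`. -/
def Window (p : ℤ) : Prop :=
  (↑(M.k / 2) : ℤ) - ((M.k : ℤ) - 1) ≤ p ∧ p ≤ (↑(M.k / 2) : ℤ)

theorem window_zero : M.Window 0 := by
  have := M.one_le_k
  unfold Window; omega

theorem Window.between {p s : ℤ} (h : M.Window p) (hs : Between p s) : M.Window s := by
  have := M.one_le_k
  unfold Window Between at *; omega

theorem mem_wSpan_window (hL : L ≤ M.N) (hC : LeftStable (M.sub (L - 1)) C) {i j : ℕ} (p : ℤ)
    {c : A} (h1 : 1 ≤ i) (hij : i ≤ j) (hj : j ≤ L) (hc : c ∈ C) :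
    ↑(M.y i ^ p) * (M.w L i j * c) ∈ M.wSpan L (fun _ => M.Window) C := by
  induction i using Nat.strong_induction_on generalizing j p c with
  | _ i ihi =>
  have hconj : ∀ {j : ℕ} {c : A}, i ≤ j → j ≤ L → c ∈ C → ∀ p : ℤ,
      ↑(M.yConj i ^ p) * (M.w L i j * c) ∈ M.wSpan L (fun _ => M.Window) C := by
    intro j c hij hj hc p
    have := mul_mul_mem_of_mem_span (N := M.wSpan L (fun _ => M.Window) C) 1 (M.w L i j * c)
      (M.yConj_zpow_mem_span (R := R) i ((↑(M.k / 2) : ℤ) - ((M.k : ℤ) - 1)) p) ?_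
    · rwa [one_mul] at this
    rintro s ⟨r, h, h', rfl⟩
    have hr : M.Window r := by unfold Window; omega
    rw [one_mul]
    refine (Submodule.sub_mem_iff_left _ (mem_wSpan (D := fun _ => M.Window) h1 hij hj hr hc)).1 ?_
    refine wSpan_le (fun i' j' p' c' h1' hij' hj' hD' hc' => ?_)
      (yConj_sub_y_mem hL hC r h1 hij hj hc)
    obtain hlt | ⟨rfl, hb⟩ := hD'
    · exact ihi i' hlt p' h1' hij' hj' hc'
    · exact mem_wSpan h1' hij' hj' (hr.between hb) hc'
  induction hn : p.natAbs using Nat.strong_induction_on generalizing j p c with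
  | _ n ihp =>
  refine (Submodule.sub_mem_iff_right _ (hconj hij hj hc p)).1 ?_
  refine wSpan_le (fun i' j' p' c' h1' hij' hj' hD' hc' => ?_)
    (yConj_sub_y_mem hL hC p h1 hij hj hc)
  obtain hlt | ⟨rfl, hb⟩ := hD'
  · exact ihi i' hlt p' h1' hij' hj' hc'
  · exact ihp p'.natAbs (by unfold Between at hb; omega) p' hij' hj' hc' rfl

theorem wSpan_true_eq (hL : L ≤ M.N) (hC : LeftStable (M.sub (L - 1)) C) :
    M.wSpan L (fun _ _ => True) C = M.wSpan L (fun _ => M.Window) C :=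
  le_antisymm (wSpan_le fun _ _ p _ h1 h2 h3 _ h5 => mem_wSpan_window hL hC p h1 h2 h3 h5)
    (wSpan_mono fun _ _ _ => trivial)

theorem wSpan_window_leftStable (hL : L ≤ M.N) (hC : LeftStable (M.sub (L - 1)) C) :
    LeftStable (M.sub (L + 1)) (M.wSpan L (fun _ => M.Window) C) := by
  rw [← wSpan_true_eq hL hC]
  exact wSpan_true_leftStable hL hC

end

end Model

namespace Model

section

variable {R A : Type*} [CommRing R] [Ring A] [Algebra R A] {M : Model R A}

theorem e_y_succ_e_e {i : ℕ} (h1 : 1 ≤ i) (h2 : i + 1 ≤ M.N) (d : ℤ) :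
    M.e i * (↑(M.y (i + 1) ^ d) * (M.e (i + 1) * M.e i)) = ↑(M.y (i + 2) ^ (-d)) * M.e i := by
  have hc : Commute (M.e i) (↑(M.y (i + 2) ^ (-d)) : A) :=
    (IsGen.commute_y_gt (Or.inr rfl) h1 le_rfl (by omega)).units_zpow_right _
  have h := M.y_succ_zpow_e (i := i + 1) (by omega) h2 (-d)
  rw [neg_neg] at h
  rw [← mul_assoc (↑(M.y (i + 1) ^ d) : A), ← h, mul_assoc, ← mul_assoc, hc.eq, mul_assoc,
    ← mul_assoc (M.e i), M.e_e_e (adj_succ h1 h2)]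

theorem e_y_y_succ_e_e {i : ℕ} (h1 : 1 ≤ i) (h2 : i + 1 ≤ M.N) (a d : ℤ) :
    M.e i * (↑(M.y i ^ a) * (↑(M.y (i + 1) ^ d) * (M.e (i + 1) * M.e i))) =
      ↑(M.y (i + 2) ^ (a - d)) * M.e i := by
  have h := M.e_y_succ_zpow (i := i) (by omega) (by omega) (-a)
  rw [neg_neg] at h
  rw [← mul_assoc, ← h, mul_assoc, ← mul_assoc (↑(M.y (i + 1) ^ (-a)) : A), ← Units.val_mul,
    ← zpow_add, e_y_succ_e_e h1 h2, neg_add, neg_neg, sub_eq_add_neg]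

theorem e_y_e_e {i : ℕ} (h1 : 1 ≤ i) (h2 : i + 1 ≤ M.N) (a : ℤ) :
    M.e i * (↑(M.y i ^ a) * (M.e (i + 1) * M.e i)) = ↑(M.y (i + 2) ^ a) * M.e i := by
  simpa using e_y_y_succ_e_e h1 h2 a 0

variable (M) in
/-- The span of the elements `y_{i+2} ^ d e_i b` with `|d| ≤ |r|` and `b` on `i - 1` strands. -/
def capSpan (i : ℕ) (r : ℤ) : Submodule R A :=
  Submodule.span R {x | ∃ (d : ℤ) (b : A), d.natAbs ≤ r.natAbs ∧ b ∈ M.sub (i - 1) ∧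
    x = ↑(M.y (i + 2) ^ d) * (M.e i * b)}

theorem mem_capSpan {i : ℕ} {r d : ℤ} {x : A} (hd : d.natAbs ≤ r.natAbs) (hx : x ∈ M.eSub i) :
    ↑(M.y (i + 2) ^ d) * x ∈ M.capSpan i r := by
  obtain ⟨b, hb, rfl⟩ := mem_eSub.1 hx
  exact Submodule.subset_span ⟨d, b, hd, hb, rfl⟩

theorem e_y_X_e_mem {i : ℕ} (h1 : 1 ≤ i) (h2 : i + 1 ≤ M.N) (r : ℤ) :
    M.e i * (↑(M.y i ^ r) * (M.X (i + 1) * M.e i)) ∈ M.capSpan i r := by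
  have hi : i ≤ M.N := by omega
  have hE := M.e_mem_eSub i
  have hcap : ∀ r' d : ℤ, d.natAbs ≤ r.natAbs →
      M.e i * ↑(M.y i ^ r') * M.e i * (↑(M.y (i + 1) ^ (-d)) * (M.e (i + 1) * M.e i)) ∈
        M.capSpan i r := by
    intro r' d hd
    obtain ⟨b, hb, h⟩ := mem_eSub.1 (e_y_e_mem h1 hi r')
    rw [← h, (e_commute_sub (by omega) hb).eq, mul_assoc, e_y_succ_e_e h1 h2, neg_neg, ← mul_assoc,
      ← (M.y_zpow_commute_sub (by omega) (by omega : i - 1 + 1 ≤ i + 2) d hb).eq, mul_assoc]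
    exact mem_capSpan hd (mul_eSub h1 hE hb)
  have h := mul_mul_mem_of_mem_span (N := M.capSpan i r) (M.e i) (M.e (i + 1) * M.e i)
    (y_zpow_mul_sub_mem h1 hi r) (by
      rintro s ⟨r', hr, rfl | rfl⟩
      · rw [mul_assoc, mul_assoc, e_y_y_succ_e_e h1 h2]
        exact mem_capSpan (by unfold Below at hr; omega) hE
      · have := hcap r' (r' - r) (by unfold Below at hr; omega)
        rw [neg_sub] at this
        simpa [mul_assoc] using this)
  have t1 : M.e i * (M.X i * ↑(M.y (i + 1) ^ r)) * (M.e (i + 1) * M.e i) ∈ M.capSpan i r := by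
    rw [← mul_assoc (M.e i) (M.X i : A), M.eX i h1 hi, smul_mul_assoc, smul_mul_assoc, mul_assoc,
      e_y_succ_e_e h1 h2]
    exact Submodule.smul_mem _ _ (mem_capSpan (by omega) hE)
  have t2 : M.e i * (↑(M.y i ^ r) * (M.e (i + 1) * M.e i)) ∈ M.capSpan i r := by
    rw [e_y_e_e h1 h2]
    exact mem_capSpan le_rfl hE
  have t3 : M.e i * ↑(M.y i ^ r) * M.e i * (M.e (i + 1) * M.e i) ∈ M.capSpan i r := by
    simpa using hcap r 0 (by simp)
  rw [M.X_e (adj_succ h1 h2), M.Xinv i h1 hi]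
  convert Submodule.add_mem _ (Submodule.sub_mem _ (Submodule.add_mem _ h t1)
    (Submodule.smul_mem _ M.δ t2)) (Submodule.smul_mem _ M.δ t3) using 1
  simp only [mul_add, add_mul, mul_sub, sub_mul, mul_smul_comm, smul_mul_assoc, mul_assoc, one_mul]
  abel

variable {L : ℕ} {C : Submodule R A}

variable (M) in
/-- The indices exceeding `i`, together with the exponents in the window. -/
def Above (i i' : ℕ) (p : ℤ) : Prop := i + 1 ≤ i' ∧ M.Window p

theorem wSpan_above_succ_le (i : ℕ) : M.wSpan L (M.Above (i + 1)) C ≤ M.wSpan L (M.Above i) C :=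
  wSpan_mono fun _ _ h => ⟨by have := h.1; omega, h.2⟩

theorem Window.below {p r : ℤ} (h : M.Window p) (hr : Below p r) :
    M.Window r ∧ M.Window (p - r) := by
  have := M.one_le_k
  unfold Window Below at *; omega

theorem Window.of_natAbs_le {p r d : ℤ} (h : M.Window p) (hr : Below p r)
    (hd : d.natAbs ≤ r.natAbs) :
    M.Window d := by
  have := M.one_le_k
  unfold Window Below at *; omega

theorem gen_mul_mem_above (hL : L ≤ M.N) (hC : LeftStable (M.sub (L - 1)) C) {b : ℕ} {x m : A}
    (h1 : 1 ≤ b) (hx : M.IsGen b x) (hm : m ∈ M.wSpan L (M.Above b) C) :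
    x * m ∈ M.wSpan L (M.Above (b - 1)) C := by
  refine wSpan_mul_mem hm fun i j p c hi hij hj hD hc => ?_
  obtain ⟨hbi, hp⟩ := hD
  have hle : b - 1 + 1 ≤ b := by omega
  obtain rfl | h := hbi.eq_or_lt
  · rcases hx with rfl | rfl
    · exact X_mul_mem_of_succ hL hC h1 hij hj ⟨hle, hp⟩ (fun r hr =>
        ⟨⟨by omega, (hp.below hr).2⟩, ⟨hle, (hp.below hr).1⟩⟩) hc
    · exact e_mul_mem_of_succ hL hC p h1 hij hj ⟨hle, window_zero⟩ hc
  · have hxs : x ∈ M.sub (b + 1) := by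
      rcases hx with rfl | rfl
      · exact M.X_mem_sub h1 le_rfl
      · exact M.e_mem_sub h1 le_rfl
    rw [sub_mul_term p c hxs (by omega) hij (by omega)]
    exact mem_wSpan hi hij hj ⟨by omega, hp⟩ (hC _ (M.sub_mono (by omega) hxs) _ hc)

theorem Xinv_mul_mem_above (hL : L ≤ M.N) (hC : LeftStable (M.sub (L - 1)) C) {b : ℕ} {m : A}
    (h1 : 1 ≤ b) (hb : b ≤ M.N) (hm : m ∈ M.wSpan L (M.Above b) C) :
    ↑(M.X b)⁻¹ * m ∈ M.wSpan L (M.Above (b - 1)) C := by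
  rw [M.Xinv b h1 hb, add_mul, sub_mul, smul_mul_assoc, smul_mul_assoc, one_mul]
  have hm' := gen_mul_mem_above hL hC h1 (Or.inr rfl) hm
  have hm'' := gen_mul_mem_above hL hC h1 (Or.inl rfl) hm
  have hmb : m ∈ M.wSpan L (M.Above (b - 1)) C :=
    wSpan_above_succ_le (b - 1) (by rwa [Nat.sub_add_cancel h1])
  exact Submodule.add_mem _ (Submodule.sub_mem _ hm'' (Submodule.smul_mem _ _ hmb))
    (Submodule.smul_mem _ _ hm')

theorem Xinv_mul_w {b : ℕ} (h1 : 1 ≤ b) (hb : b + 1 ≤ L) (hL : L ≤ M.N) :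
    ↑(M.X b)⁻¹ * M.w L (b + 1) (b + 1) =
      M.w L b (b + 1) - M.δ • M.w L (b + 1) (b + 1) + M.δ • M.w L b b := by
  rw [M.Xinv b h1 (by omega), M.w_of_lt (i := b) (by omega), M.w_self (j := b) (by omega)]
  simp only [add_mul, sub_mul, smul_mul_assoc, one_mul]

theorem X_y_w_e_mem (hL : L ≤ M.N) (hC : LeftStable (M.sub (L - 1)) C) {i j : ℕ} {t : ℤ} {c : A}
    (h1 : 1 ≤ i) (hij : i + 1 ≤ j) (hj : j ≤ L) (hiL : i + 2 ≤ L) (ht : M.Window t)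
    (hc : M.e i * c ∈ C) :
    M.X i * (↑(M.y i ^ t) * (M.w L (i + 1) j * (M.e i * c))) ∈ M.wSpan L (M.Above i) C := by
  have hi : i ≤ M.N := by omega
  have hei : M.e i ∈ M.sub (i + 1) := M.e_mem_sub h1 le_rfl
  have hw : ∀ {j}, i + 2 ≤ j → M.w L (i + 2) j * (M.e i * c) = M.e i * (M.w L (i + 2) j * c) :=
    fun h => by rw [← mul_assoc, ← (sub_commute_w hei h le_rfl).eq, mul_assoc]
  have hq3 : ∀ {x : A} {j : ℕ} {s r : ℤ}, i + 2 ≤ j → j ≤ L → Below t r →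
      M.e i * (↑(M.y i ^ r) * (x * M.e i)) ∈ M.capSpan i r →
      ↑(M.y (i + 1) ^ s) * (M.e i * (↑(M.y i ^ r) * (x * M.e i))) * (M.w L (i + 2) j * c) ∈
        M.wSpan L (M.Above i) C := by
    intro x j s r hij hj hr hx
    refine mul_mul_mem_of_mem_span _ _ hx ?_
    rintro _ ⟨d, b, hd, hb, rfl⟩
    have hb' : ↑(M.y (i + 1) ^ s) * (M.e i * b) ∈ M.sub (i + 1) :=
      mul_mem (M.y_zpow_mem_sub (by omega) le_rfl s) (mul_mem hei (M.sub_mono (by omega) hb))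
    have hcom := (M.y_zpow_commute_sub (i := i + 2) (by omega) le_rfl d
      (mul_mem hei (M.sub_mono (by omega : i - 1 ≤ i + 1) hb))).eq
    rw [hcom, ← mul_assoc (↑(M.y (i + 1) ^ s) : A), mul_assoc (_ * (M.e i * b)),
      sub_mul_term d c hb' le_rfl hij (by omega)]
    refine mem_wSpan (by omega) hij hj ⟨by omega, ht.of_natAbs_le hr hd⟩ ?_
    rw [(e_commute_sub (by omega) hb).eq, mul_assoc, mul_assoc]
    exact hC _ (M.y_zpow_mem_sub (by omega) (by omega) s) _
      (hC _ (M.sub_mono (by omega) hb) _ hc)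
  have h := mul_mul_mem_of_mem_span (N := M.wSpan L (M.Above i) C) 1
    (M.w L (i + 1) j * (M.e i * c)) (mul_zpow_sub_mem (M.coe_y_succ h1) (M.skein i h1 hi) t) (by
      rintro s ⟨r, hr, rfl | rfl⟩
      · rw [one_mul, mul_assoc, ← mul_assoc _ _ (M.e i * c),
          (sub_commute_w (M.y_zpow_mem_sub h1 le_rfl r) hij le_rfl).eq, mul_assoc]
        exact mem_wSpan (by omega) hij hj ⟨le_rfl, (ht.below hr).2⟩
          (hC _ (M.y_zpow_mem_sub h1 (by omega) r) _ hc)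
      · obtain rfl | hij := hij.eq_or_lt
        · have := hq3 (x := M.e (i + 1)) (s := t - r) le_rfl hiL hr (by
            rw [e_y_e_e h1 (by omega)]
            exact mem_capSpan le_rfl (M.e_mem_eSub i))
          rw [M.w_self (by omega), mul_assoc _ _ (M.e i * c), hw le_rfl]
          simpa only [one_mul, mul_assoc] using this
        · have := hq3 (x := M.X (i + 1)) (s := t - r) hij hj hr (e_y_X_e_mem h1 (by omega) r)
          rw [M.w_of_lt (by omega), mul_assoc _ _ (M.e i * c), hw hij]
          simpa only [one_mul, mul_assoc] using this)
  have h' : ↑(M.y (i + 1) ^ t) * (M.X i * (M.w L (i + 1) j * (M.e i * c))) ∈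
      M.wSpan L (M.Above i) C := by
    obtain rfl | hij := hij.eq_or_lt
    · rw [M.w_self (by omega), mul_assoc _ _ (M.e i * c), hw le_rfl, ← mul_assoc (M.e (i + 1)),
        ← mul_assoc (M.X i : A), ← mul_assoc (M.X i : A), ← M.Xinv_e (adj_succ h1 (by omega)),
        mul_assoc, ← hw le_rfl, ← mul_assoc (↑(M.X (i + 1))⁻¹ : A),
        Xinv_mul_w (by omega) hiL hL, add_mul, sub_mul, mul_add, mul_sub, smul_mul_assoc,
        smul_mul_assoc, mul_smul_comm, mul_smul_comm]
      refine Submodule.add_mem _ (Submodule.sub_mem _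
        (mem_wSpan (by omega) (by omega) hiL ⟨le_rfl, ht⟩ hc) (Submodule.smul_mem _ _ ?_))
        (Submodule.smul_mem _ _ (mem_wSpan (by omega) le_rfl (by omega) ⟨le_rfl, ht⟩ hc))
      rw [← mul_assoc, (sub_commute_w (M.y_zpow_mem_sub (by omega) le_rfl t) le_rfl le_rfl).eq,
        mul_assoc]
      exact w_mem_wSpan (by omega) le_rfl hiL ⟨by omega, window_zero⟩
        (hC _ (M.y_zpow_mem_sub (by omega) (by omega) t) _ hc)
    · obtain ⟨b, hb, he⟩ := e_w_succ (M := M) (L := L) (i := i + 1) (by omega) hij hj hL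
      rw [M.w_of_lt (by omega), mul_assoc _ _ (M.e i * c), hw hij, ← mul_assoc (M.X (i + 1) : A),
        ← mul_assoc (M.X i : A), ← mul_assoc (M.X i : A), M.XX_e (adj_succ h1 (by omega)),
        mul_assoc, ← hw hij, ← mul_assoc (M.e (i + 1)), he, mul_assoc]
      exact mem_wSpan (by omega) le_rfl (by omega) ⟨le_rfl, ht⟩ (hC _ hb _ hc)
  convert Submodule.add_mem _ h h' using 1
  simp only [one_mul, sub_mul, mul_assoc]
  abel

end

end Model

namespace Model

section

variable {R A : Type*} [CommRing R] [Ring A] [Algebra R A] {M : Model R A}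
variable {K : ℕ} {C : Submodule R A} {g : A}

theorem w_mul_mem_of_e_mul_mem (hC : LeftStable (M.sub (K + 1)) C) (hg : M.e K * g ∈ C) {i j : ℕ}
    (h1 : 1 ≤ i) (hij : i ≤ j) (hj : j ≤ K) : M.w K i j * g ∈ C := by
  obtain ⟨K, rfl⟩ : ∃ K', K = K' + 1 := ⟨K - 1, by omega⟩
  rw [M.w_succ hj, mul_assoc]
  exact hC _ (M.sub_mono (by omega) (M.w_mem_sub h1 hij hj)) _ hg

/-- Two successive chains whose first indices are not strictly decreasing can be reordered. -/
theorem w_y_w_mem_above (hK : K + 2 ≤ M.N) (hC : LeftStable (M.sub (K + 1)) C)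
    (hg : M.e K * g ∈ C) {i j a c : ℕ} {t : ℤ} (h1 : 1 ≤ i) (hij : i ≤ j) (hj : j ≤ K + 2)
    (hia : i ≤ a) (hac : a ≤ c) (hc : c ≤ K) (ht : M.Window t) :
    M.w (K + 2) i j * (↑(M.y a ^ t) * (M.w K a c * g)) ∈ M.wSpan (K + 2) (M.Above i) C := by
  obtain ⟨d, hd⟩ : ∃ d, i + d = K + 2 := ⟨K + 2 - i, by omega⟩
  induction d generalizing i j a c t with
  | zero => omega
  | succ d ih =>
    have hC' : LeftStable (M.sub (K + 2 - 1)) C := hC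
    rcases le_or_gt j a with hja | haj
    · rw [← mul_assoc, M.w_mul_y h1 hij hja (by omega) hK, mul_assoc, ← mul_assoc (M.w (K + 2) i j),
        M.w_mul_w h1 hij hja hac (by omega) hK, M.w_mul_w_drop hij (by omega) hK (by omega),
        mul_assoc]
      exact mem_wSpan (by omega) (by omega) (by omega) ⟨by omega, ht⟩
        (w_mul_mem_of_e_mul_mem hC hg h1 hij (by omega))
    have hXi : (M.X i : A) ∈ M.sub (i + 1) := M.X_mem_sub h1 le_rfl
    have hsub : ∀ {b m : A}, b ∈ M.sub (i + 1) → m ∈ M.wSpan (K + 2) (M.Above (i + 1)) C →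
        b * m ∈ M.wSpan (K + 2) (M.Above (i + 1)) C :=
      fun hb hm => sub_mul_mem hK hC' (fun _ _ h => h.1) hb hm
    have hij : i < j := by omega
    obtain rfl | hia := hia.eq_or_lt
    swap
    · rw [M.w_of_lt hij, mul_assoc]
      exact wSpan_above_succ_le i
        (hsub hXi (ih (by omega) (by omega) hj hia hac hc ht (by omega)))
    have hyw : ∀ (r : ℤ) x, M.w (K + 2) i j * (↑(M.y i ^ r) * x) =
        M.X i * (↑(M.y i ^ r) * (M.w (K + 2) (i + 1) j * x)) := fun r x => by
      rw [M.w_of_lt hij, mul_assoc, ← mul_assoc (M.w _ _ _),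
        ← (sub_commute_w (M.y_zpow_mem_sub h1 le_rfl r) hij le_rfl).eq, mul_assoc]
    obtain rfl | hic := hac.eq_or_lt
    · rw [hyw, M.w_self hc, mul_assoc]
      refine X_y_w_e_mem hK hC' h1 hij hj (by omega) ht ?_
      rw [← mul_assoc, ← M.w_self hc]
      exact w_mul_mem_of_e_mul_mem hC hg h1 le_rfl hc
    have hx : M.w K (i + 1) c * g ∈ C := w_mul_mem_of_e_mul_mem hC hg (by omega) hic hc
    have hz : ∀ s : ℤ, ↑(M.y (i + 1) ^ s) * (M.w K (i + 1) c * g) ∈ C := fun s =>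
      hC _ (M.y_zpow_mem_sub (by omega) (by omega) s) _ hx
    have ih' : ∀ {j s}, i + 1 ≤ j → j ≤ K + 2 → M.Window s →
        M.w (K + 2) (i + 1) j * (↑(M.y (i + 1) ^ s) * (M.w K (i + 1) c * g)) ∈
          M.wSpan (K + 2) (M.Above (i + 1)) C := fun hij hj hs =>
      ih (by omega) hij hj le_rfl hic hc hs (by omega)
    have h := mul_mul_mem_of_mem_span (N := M.wSpan (K + 2) (M.Above i) C) (M.w (K + 2) i j)
      (M.w K (i + 1) c * g) (y_zpow_mul_sub_mem (M := M) h1 (by omega) t) (by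
        rintro s ⟨r, hr, rfl | rfl⟩
        · rw [mul_assoc, mul_assoc, hyw, ← mul_assoc]
          exact wSpan_above_succ_le i
            (hsub (mul_mem hXi (M.y_zpow_mem_sub h1 (by omega) r)) (ih' hij hj (ht.below hr).2))
        · rw [mul_assoc, mul_assoc, mul_assoc, hyw]
          exact X_y_w_e_mem hK hC' h1 hij hj (by omega) (ht.below hr).1
            (hC _ (M.e_mem_sub h1 (by omega)) _ (hz _)))
    have h' : M.w (K + 2) i j * (M.X i * (↑(M.y (i + 1) ^ t) * (M.w K (i + 1) c * g))) ∈
        M.wSpan (K + 2) (M.Above i) C := by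
      have hXw : ∀ {j} u, i + 2 ≤ j →
          M.w (K + 2) (i + 2) j * (M.X i * u) = M.X i * (M.w (K + 2) (i + 2) j * u) := fun u h => by
        rw [← mul_assoc, ← (sub_commute_w hXi h le_rfl).eq, mul_assoc]
      obtain rfl | hij' : i + 1 = j ∨ i + 2 ≤ j := by omega
      · have hu : M.w (K + 2) (i + 2) (i + 2) *
            (↑(M.y (i + 1) ^ t) * (M.w K (i + 1) c * g)) ∈
              M.wSpan (K + 2) (M.Above (i + 1)) C :=
          w_mem_wSpan (by omega) le_rfl (by omega) ⟨le_rfl, window_zero⟩ (hz t)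
        rw [M.w_of_lt hij, M.w_self (j := i + 1) (by omega), mul_assoc, mul_assoc, hXw _ le_rfl,
          ← mul_assoc (M.e (i + 1)), ← mul_assoc (M.X i : A),
          ← mul_assoc (M.X i : A), M.X_e_X (adj_succ h1 (by omega)), mul_assoc, mul_assoc,
          ← mul_assoc _ (M.w _ _ _), Xinv_mul_w (by omega) (by omega) hK, add_mul,
          sub_mul, smul_mul_assoc, smul_mul_assoc]
        refine Xinv_mul_mem_above (b := i + 1) hK hC' (by omega) (by omega)
          (hsub (M.e_mem_sub h1 le_rfl) ?_)
        exact Submodule.add_mem _ (Submodule.sub_mem _ (ih' (by omega) (by omega) ht)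
          (Submodule.smul_mem _ _ hu)) (Submodule.smul_mem _ _ (ih' le_rfl hj ht))
      · have hb := M.braid i h1 (by omega)
        have hb' : (M.X i * (M.X (i + 1) * M.X i) : A) = M.X (i + 1) * (M.X i * M.X (i + 1)) := by
          simpa [mul_assoc] using congrArg Units.val hb
        rw [M.w_of_lt hij, M.w_of_lt (i := i + 1) (by omega), mul_assoc, mul_assoc, hXw _ hij',
          ← mul_assoc (M.X (i + 1) : A), ← mul_assoc (M.X i : A), hb',
          mul_assoc, mul_assoc, ← mul_assoc (M.X (i + 1) : A) (M.w _ _ _),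
          ← M.w_of_lt (i := i + 1) (by omega)]
        exact gen_mul_mem_above (b := i + 1) hK hC' (by omega) (Or.inl rfl)
          (hsub hXi (ih' hij hj ht))
    rw [M.w_of_lt hic]
    convert Submodule.add_mem _ h h' using 1
    simp only [mul_sub, sub_mul, mul_assoc]
    abel

end

end Model

namespace Model

section

variable {R A : Type*} [CommRing R] [Ring A] [Algebra R A]

section

variable (M : Model R A)

/-- The products of `m` chains `y_i ^ p * w (l - 1) i j`, `y_i' ^ p' * w (l - 3) i' j'`, … whose
first indices strictly decrease and stay below `a`, with all exponents in the window. -/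
def chain : ℕ → ℕ → ℕ → Set A
  | _, 0, _ => {1}
  | l, m + 1, a => {x | ∃ i j p v, 1 ≤ i ∧ i ≤ j ∧ j ≤ l - 1 ∧ i < a ∧ M.Window p ∧
      v ∈ chain (l - 2) m i ∧ x = ↑(M.y i ^ p) * (M.w (l - 1) i j * v)}

/-- The analogue of `Model.chain` for the chains lacking their last factors `e`. -/
def chainBar : ℕ → ℕ → ℕ → Set A
  | _, 0, _ => {1}
  | l, m + 1, a => {x | ∃ i j p v, 1 ≤ i ∧ i ≤ j ∧ j ≤ l - 1 ∧ i < a ∧ M.Window p ∧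
      v ∈ chainBar (l - 2) m i ∧ x = ↑(M.y i ^ p) * (M.w (l - 2) i j * v)}

/-- The product `e_{l-1} e_{l-3} ⋯ e_{l-2m+1}`. -/
def cups : ℕ → ℕ → A
  | _, 0 => 1
  | l, m + 1 => M.e (l - 1) * cups (l - 2) m

/-- The span of the products of an element of `chain l m l` with an element on the remaining
`l - 2 * m` strands. -/
def chainSpan (l m : ℕ) : Submodule R A :=
  Submodule.span R {x | ∃ v ∈ M.chain l m l, ∃ b ∈ M.sub (l - 2 * m), x = v * b}

end

variable {M : Model R A}

theorem chain_subset {l m a a' : ℕ} (h : a ≤ a' ∨ l ≤ a') : M.chain l m a ⊆ M.chain l m a' := by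
  cases m with
  | zero => exact subset_rfl
  | succ m =>
    rintro x ⟨i, j, p, v, h1, hij, hj, hia, hp, hv, rfl⟩
    exact ⟨i, j, p, v, h1, hij, hj, by omega, hp, hv, rfl⟩

theorem mem_chainSpan {l m a : ℕ} {v b : A} (hv : v ∈ M.chain l m a)
    (hb : b ∈ M.sub (l - 2 * m)) : v * b ∈ M.chainSpan l m :=
  Submodule.subset_span ⟨v, chain_subset (Or.inr le_rfl) hv, b, hb, rfl⟩

theorem chainSpan_mul_mem {l m : ℕ} {x z : A} {N : Submodule R A} (hz : z ∈ M.chainSpan l m)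
    (h : ∀ v ∈ M.chain l m l, ∀ b ∈ M.sub (l - 2 * m), x * (v * b) ∈ N) : x * z ∈ N := by
  have := mul_mul_mem_of_mem_span (N := N) x 1 hz (by
    rintro _ ⟨v, hv, b, hb, rfl⟩
    simpa using h v hv b hb)
  simpa using this

theorem chainSpan_zero_leftStable (l : ℕ) : LeftStable (M.sub l) (M.chainSpan l 0) := by
  refine fun x hx z hz => chainSpan_mul_mem hz ?_
  rintro v rfl b hb
  rw [one_mul, ← one_mul (x * b)]
  exact mem_chainSpan (a := l) rfl (mul_mem hx hb)

theorem wSpan_le_chainSpan_succ {l m : ℕ} (hl : 2 * (m + 1) ≤ l) (hN : l ≤ M.N + 1)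
    (hC : LeftStable (M.sub (l - 2)) (M.chainSpan (l - 2) m))
    (hm : ∀ m', m = m' + 1 → M.wSpan (l - 2 - 1) (fun _ => M.Window) (M.chainSpan (l - 2 - 2) m') ≤
      M.chainSpan (l - 2) m) :
    M.wSpan (l - 1) (fun _ => M.Window) (M.chainSpan (l - 2) m) ≤ M.chainSpan l (m + 1) := by
  obtain ⟨L, rfl⟩ : ∃ L, l = L + 2 := ⟨l - 2, by omega⟩
  have hN' : L + 1 ≤ M.N := by omega
  simp only [Nat.add_sub_cancel] at hC hm ⊢
  change M.wSpan (L + 1) _ _ ≤ _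
  have key : ∀ d i, i + d = L + 1 → M.wSpan (L + 1) (M.Above i) (M.chainSpan L m) ≤
      M.chainSpan (L + 2) (m + 1) := by
    intro d
    induction d with
    | zero =>
      intro i hi
      refine wSpan_le fun i' j p c h1 hij hj hD hc => ?_
      have := hD.1
      omega
    | succ d ih =>
      intro i hi
      refine wSpan_le fun i' j p c h1 hij hj hD hc => ?_
      rw [← mul_assoc]
      refine chainSpan_mul_mem hc fun v hv b hb => ?_
      have hdirect : ∀ {v}, v ∈ M.chain L m i' → ↑(M.y i' ^ p) * M.w (L + 1) i' j * (v * b) ∈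
          M.chainSpan (L + 2) (m + 1) := fun {v} hv => by
        have hv' : ↑(M.y i' ^ p) * (M.w (L + 1) i' j * v) ∈ M.chain (L + 2) (m + 1) (i' + 1) :=
          ⟨i', j, p, v, h1, hij, hj, by omega, hD.2, hv, rfl⟩
        have := mem_chainSpan hv' (b := b) (by convert hb using 2; omega)
        simpa only [mul_assoc] using this
      cases m with
      | zero => exact hdirect hv
      | succ m =>
        obtain ⟨a, c, t, v, ha, hac, hc, -, ht, hv, rfl⟩ := hv
        rcases lt_or_ge a i' with hai | hai
        · exact hdirect ⟨a, c, t, v, ha, hac, hc, hai, ht, hv, rfl⟩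
        obtain ⟨K, rfl⟩ : ∃ K, L = K + 1 := ⟨L - 1, by omega⟩
        have hg : M.e K * (v * b) ∈ M.chainSpan (K + 1) (m + 1) := by
          refine hm m rfl ?_
          have := w_mem_wSpan (M := M) (L := K) (D := fun _ => M.Window) (j := K) (by omega) le_rfl
            le_rfl window_zero (mem_chainSpan hv (b := b) (by convert hb using 2; omega))
          rwa [M.w_self le_rfl, M.w_end, mul_one] at this
        have h := w_y_w_mem_above (by omega) hC hg h1 hij hj hai hac hc ht
        have h' := sub_mul_mem (M := M) (L := K + 2) (a := i') (D := M.Above i') (by omega) hC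
          (fun _ _ h => h.1) (M.y_zpow_mem_sub h1 le_rfl p) h
        have hle : M.Above i' ≤ M.Above (i + 1) := fun _ _ h => by
          have := h.1; have := hD.1; exact ⟨by omega, h.2⟩
        have := ih (i + 1) (by omega) (wSpan_mono hle h')
        simpa only [mul_assoc, Nat.add_sub_cancel] using this
  refine le_trans ?_ (key (L + 1) 0 (by omega))
  exact wSpan_le fun i j p c h1 hij hj hD hc => mem_wSpan h1 hij hj ⟨h1, hD⟩ hc

theorem chainSpan_succ_le_wSpan {l m : ℕ} :
    M.chainSpan l (m + 1) ≤ M.wSpan (l - 1) (fun _ => M.Window) (M.chainSpan (l - 2) m) := by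
  refine Submodule.span_le.2 ?_
  rintro _ ⟨_, ⟨i, j, p, v, h1, hij, hj, -, hp, hv, rfl⟩, b, hb, rfl⟩
  rw [mul_assoc, mul_assoc]
  exact mem_wSpan h1 hij hj hp (mem_chainSpan hv (by convert hb using 2; omega))

theorem chainSpan_aux (m : ℕ) : ∀ l, 2 * m ≤ l → l ≤ M.N + 1 →
    LeftStable (M.sub l) (M.chainSpan l m) ∧
      ∀ m', m = m' + 1 → M.wSpan (l - 1) (fun _ => M.Window) (M.chainSpan (l - 2) m') ≤
        M.chainSpan l m := by
  induction m with
  | zero => exact fun l _ _ => ⟨chainSpan_zero_leftStable l, fun m' h => by omega⟩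
  | succ m ih =>
    intro l hl hN
    obtain ⟨hC, hm⟩ := ih (l - 2) (by omega) (by omega)
    have hle := wSpan_le_chainSpan_succ hl hN hC hm
    refine ⟨?_, fun m' h => by obtain rfl : m = m' := by omega
                               exact hle⟩
    rw [le_antisymm chainSpan_succ_le_wSpan hle]
    have := wSpan_window_leftStable (M := M) (L := l - 1) (by omega) hC
    rwa [Nat.sub_add_cancel (by omega)] at this

theorem chainSpan_leftStable {l m : ℕ} (hl : 2 * m ≤ l) (hN : l ≤ M.N + 1) :
    LeftStable (M.sub l) (M.chainSpan l m) :=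
  (chainSpan_aux m l hl hN).1

theorem cups_mem_sub {l m : ℕ} (hl : 2 * m ≤ l) : M.cups l m ∈ M.sub l := by
  induction m generalizing l with
  | zero => exact one_mem _
  | succ m ih =>
    exact mul_mem (M.e_mem_sub (by omega) (by omega)) (M.sub_mono (by omega) (ih (by omega)))

theorem e_commute_cups {l m : ℕ} (hl : 2 * (m + 1) ≤ l) :
    Commute (M.e (l - 1)) (M.cups (l - 2) m) :=
  e_commute_sub (by omega) (cups_mem_sub (by omega))

theorem cups_commute_sub {l m : ℕ} (hl : 2 * m ≤ l) {b : A} (hb : b ∈ M.sub (l - 2 * m)) :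
    Commute (M.cups l m) b := by
  induction m generalizing l with
  | zero => exact Commute.one_left _
  | succ m ih =>
    exact (e_commute_sub (by omega) hb).mul_left
      (ih (by omega) (by convert hb using 2; omega))

theorem cups_succ {l m : ℕ} (hl : 2 * (m + 1) ≤ l) :
    M.cups l (m + 1) = M.cups l m * M.e (l - 2 * m - 1) := by
  induction m generalizing l with
  | zero => simp [cups]
  | succ m ih =>
    rw [cups, ih (by omega), ← mul_assoc, cups]
    congr 2
    omega

theorem cups_mem_chain {l m a : ℕ} (hl : 2 * m ≤ l) (ha : l ≤ a) : M.cups l m ∈ M.chain l m a := by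
  induction m generalizing l a with
  | zero => rfl
  | succ m ih =>
    refine ⟨l - 1, l - 1, 0, M.cups (l - 2) m, by omega, le_rfl, le_rfl, by omega, window_zero,
      ih (by omega) (by omega), ?_⟩
    rw [M.w_self le_rfl, M.w_end]
    simp [cups]

theorem chainBar_subset_sub {l m a : ℕ} : M.chainBar l m a ⊆ M.sub (l - 1) := by
  induction m generalizing l a with
  | zero => rintro _ rfl; exact one_mem _
  | succ m ih =>
    rintro _ ⟨i, j, p, v, h1, hij, hj, hia, hp, hv, rfl⟩
    have hw := M.w_mem_sub (L := l - 2) h1 hij (by omega)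
    exact mul_mem (M.y_zpow_mem_sub h1 (by omega) p)
      (mul_mem (M.sub_mono (by omega) hw) (M.sub_mono (by omega) (ih hv)))

theorem exists_chainBar {l m a : ℕ} (hl : 2 * m ≤ l) {v : A} (hv : v ∈ M.chain l m a) :
    ∃ u ∈ M.chainBar l m a, v = u * M.cups l m := by
  induction m generalizing l a v with
  | zero => exact ⟨1, rfl, by rw [hv, cups, mul_one]⟩
  | succ m ih =>
    obtain ⟨i, j, p, v, h1, hij, hj, hia, hp, hv, rfl⟩ := hv
    obtain ⟨u, hu, rfl⟩ := ih (by omega) hv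
    refine ⟨_, ⟨i, j, p, u, h1, hij, hj, hia, hp, hu, rfl⟩, ?_⟩
    have hw : M.w (l - 1) i j = M.w (l - 2) i j * M.e (l - 1) := by
      have := M.w_succ (L := l - 2) (i := i) (j := j) (by omega)
      rwa [show l - 2 + 1 = l - 1 by omega] at this
    have hc : Commute (M.e (l - 1)) u := e_commute_sub (by omega) (chainBar_subset_sub hu)
    rw [hw, cups, mul_assoc (M.w _ _ _), ← mul_assoc (M.e _), hc.eq]
    simp only [mul_assoc]

section Star

variable {st : A →ₗ[R] A} {n : ℕ}

theorem star_mem_sub (h1 : st 1 = 1) (hmul : ∀ a b, st (a * b) = st b * st a)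
    (hY : st M.Y = M.Y) (hYi : st ↑M.Y⁻¹ = ↑M.Y⁻¹) (hX : ∀ i, st (M.X i) = M.X i)
    (hXi : ∀ i, st ↑(M.X i)⁻¹ = ↑(M.X i)⁻¹) (he : ∀ i, st (M.e i) = M.e i) {l : ℕ} {b : A}
    (hb : b ∈ M.sub l) : st b ∈ M.sub l ∧ st (st b) = b := by
  refine M.sub_induction (P := fun b => st b ∈ M.sub l ∧ st (st b) = b) ?_ ?_ ?_ ?_ ?_ ?_ ?_ ?_ hb
  · exact fun h => ⟨by rw [hY]; exact M.Y_mem_sub h, by rw [hY, hY]⟩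
  · exact fun h => ⟨by rw [hYi]; exact M.Yinv_mem_sub h, by rw [hYi, hYi]⟩
  · exact fun i h h' => ⟨by rw [hX]; exact M.X_mem_sub h h', by rw [hX, hX]⟩
  · exact fun i h h' => ⟨by rw [hXi]; exact M.Xinv_mem_sub h h', by rw [hXi, hXi]⟩
  · exact fun i h h' => ⟨by rw [he]; exact M.e_mem_sub h h', by rw [he, he]⟩
  · intro r
    rw [Algebra.algebraMap_eq_smul_one, map_smul, h1, map_smul, h1]
    exact ⟨Subalgebra.smul_mem _ (one_mem _) r, rfl⟩
  · rintro x y ⟨hx, hx'⟩ ⟨hy, hy'⟩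
    rw [map_add, map_add, hx', hy']
    exact ⟨add_mem hx hy, rfl⟩
  · rintro x y ⟨hx, hx'⟩ ⟨hy, hy'⟩
    rw [hmul, hmul, hx', hy']
    exact ⟨mul_mem hy hx, rfl⟩

theorem star_cups (h1 : st 1 = 1) (hmul : ∀ a b, st (a * b) = st b * st a)
    (he : ∀ i, st (M.e i) = M.e i) {l m : ℕ} (hl : 2 * m ≤ l) :
    st (M.cups l m) = M.cups l m := by
  induction m generalizing l with
  | zero => exact h1
  | succ m ih => rw [cups, hmul, he, ih (by omega), (e_commute_cups hl).eq]

variable (M st) in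
/-- The span of the products `v b w*` with `v` a product of `m` chains, `w` a product of `m`
chains lacking their last factors, and `b` on the remaining `n - 2 * m` strands. -/
def sandwichSpan (n m : ℕ) : Submodule R A :=
  Submodule.span R {x | ∃ v ∈ M.chain n m n, ∃ b ∈ M.sub (n - 2 * m), ∃ w ∈ M.chainBar n m n,
    x = v * b * st w}

theorem mul_cups_mul_mem_sandwichSpan (h1 : st 1 = 1) (hmul : ∀ a b, st (a * b) = st b * st a)
    (he : ∀ i, st (M.e i) = M.e i)
    (hst : ∀ {l b}, b ∈ M.sub l → st b ∈ M.sub l ∧ st (st b) = b) {m : ℕ} (hm : 2 * m ≤ n)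
    (hn : n ≤ M.N + 1) {a c : A} (ha : a ∈ M.sub n) (hc : c ∈ M.sub n) :
    a * M.cups n m * c ∈ M.sandwichSpan st n m := by
  have hcups : M.cups n m ∈ M.chainSpan n m := by
    simpa using mem_chainSpan (cups_mem_chain hm le_rfl) (one_mem (M.sub (n - 2 * m)))
  have hZ := chainSpan_leftStable hm hn
  have h := mul_mul_mem_of_mem_span (N := M.sandwichSpan st n m) 1 c (hZ a ha _ hcups) (by
    rintro _ ⟨v, hv, b, hb, rfl⟩
    obtain ⟨u, hu, rfl⟩ := exists_chainBar hm hv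
    have hs : M.cups n m * c = st (st c * M.cups n m) := by
      rw [hmul, star_cups h1 hmul he hm, (hst hc).2]
    rw [one_mul, mul_assoc u, (cups_commute_sub hm hb).eq, mul_assoc, mul_assoc, hs]
    have hx := hZ (st c) (hst hc).1 _ hcups
    have hle : M.chainSpan n m ≤
        (M.sandwichSpan st n m).comap ((LinearMap.mulLeft R (u * b)).comp st) := by
      refine Submodule.span_le.2 ?_
      rintro _ ⟨v, hv', d, hd, rfl⟩
      obtain ⟨u', hu', rfl⟩ := exists_chainBar hm hv'
      have hd' := (hst hd).1
      change u * b * st (u' * M.cups n m * d) ∈ M.sandwichSpan st n m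
      refine Submodule.subset_span ⟨_, hv, b * st d, mul_mem hb hd', u', hu', ?_⟩
      rw [hmul, hmul, star_cups h1 hmul he hm, mul_assoc u (M.cups n m),
        (cups_commute_sub hm (mul_mem hb hd')).eq]
      simp only [mul_assoc]
    rw [← mul_assoc]
    exact hle hx)
  simpa using h

end Star

end

end Model

namespace Model

section

variable {R A : Type*} [CommRing R] [Ring A] [Algebra R A] {M : Model R A}
variable {st : A →ₗ[R] A} {n : ℕ}

theorem eq_top_of_chain_mul_mem (h1 : st 1 = 1) (hmul : ∀ a b, st (a * b) = st b * st a)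
    (he : ∀ i, st (M.e i) = M.e i)
    (hst : ∀ {l b}, b ∈ M.sub l → st b ∈ M.sub l ∧ st (st b) = b)
    (hn : n ≤ M.N + 1) (htop : M.sub n = ⊤) (At : ℕ → Submodule R A)
    (hAt : ∀ l, l ≤ 1 → Subalgebra.toSubmodule (M.sub l) ≤ At l)
    (hsplit : ∀ l, 2 ≤ l → l ≤ n → Subalgebra.toSubmodule (M.sub l) ≤
      At l ⊔ Submodule.span R {z | ∃ b b', b ∈ M.sub l ∧ b' ∈ M.sub l ∧ z = b * M.e (l - 1) * b'})
    {T : Submodule R A}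
    (hT : ∀ m, 2 * m ≤ n → ∀ v ∈ M.chain n m n, ∀ χ ∈ At (n - 2 * m), ∀ w ∈ M.chainBar n m n,
      v * χ * st w ∈ T) : T = ⊤ := by
  have hmem : ∀ {x : A}, x ∈ M.sub n := fun {x} => htop ▸ Algebra.mem_top
  have key : ∀ d m, 2 * m ≤ n → n < 2 * (m + d) → M.sandwichSpan st n m ≤ T := by
    intro d
    induction d with
    | zero => intro m _ _; omega
    | succ d ih =>
      intro m hm hd
      refine Submodule.span_le.2 ?_
      rintro _ ⟨v, hv, b, hb, w, hw, rfl⟩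
      rcases le_or_gt (n - 2 * m) 1 with hl | hl
      · exact hT m hm v hv b (hAt _ hl hb) w hw
      obtain ⟨χ, hχ, y, hy, rfl⟩ := Submodule.mem_sup.1 (hsplit _ hl (by omega) hb)
      rw [mul_add, add_mul]
      refine T.add_mem (hT m hm v hv χ hχ w hw) (mul_mul_mem_of_mem_span _ _ hy ?_)
      rintro _ ⟨b, b', hb, -, rfl⟩
      obtain ⟨u, hu, rfl⟩ := exists_chainBar hm hv
      have h := mul_cups_mul_mem_sandwichSpan h1 hmul he hst (m := m + 1) (by omega) hn
        (a := u * b) (c := b' * st w) hmem hmem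
      refine ih (m + 1) (by omega) (by omega) ?_
      rw [cups_succ (by omega), mul_assoc u b, ← mul_assoc b,
        ← (cups_commute_sub hm hb).eq] at h
      simpa only [SetLike.mem_coe, mul_assoc] using h
  refine eq_top_iff.2 fun x _ => key (n + 1) 0 (by omega) (by omega) ?_
  exact Submodule.subset_span ⟨1, rfl, x, hmem, 1, rfl, by simp [h1]⟩

end

end Model

namespace CBMW

section

variable {R : Type} [CommRing R]

theorem pr_eq {P : Params R} {a b : F R} (h : Rel P a b) : pr P a = pr P b :=
  RingQuot.mkAlgHom_rel R h

@[simp]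
theorem pr_fY (P : Params R) : pr P fY = Yg P := rfl

@[simp]
theorem pr_fYi (P : Params R) : pr P fYi = Ygi P := rfl

@[simp]
theorem pr_fX (P : Params R) (i : ℕ) : pr P (fX i) = Xg P i := rfl

@[simp]
theorem pr_fXi (P : Params R) (i : ℕ) : pr P (fXi i) = Xgi P i := rfl

@[simp]
theorem pr_fE (P : Params R) (i : ℕ) : pr P (fE i) = Eg P i := rfl

theorem X_eq_one {P : Params R} {i : ℕ} (h : i = 0 ∨ P.n - 1 < i) : Xg P i = 1 := by
  simpa using pr_eq (Rel.X_invalid h)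

theorem Xi_eq_one {P : Params R} {i : ℕ} (h : i = 0 ∨ P.n - 1 < i) : Xgi P i = 1 := by
  simpa using pr_eq (Rel.Xi_invalid h)

theorem E_eq_zero {P : Params R} {i : ℕ} (h : i = 0 ∨ P.n - 1 < i) : Eg P i = 0 := by
  simpa using pr_eq (Rel.E_invalid h)

/-- The generator `Y` as a unit. -/
def Yu (P : Params R) : (Alg P)ˣ where
  val := Yg P
  inv := Ygi P
  val_inv := by simpa using pr_eq (Rel.Y_inv_right (P := P))
  inv_val := by simpa using pr_eq (Rel.Y_inv_left (P := P))

/-- The generator `X_i` as a unit. -/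
def Xu (P : Params R) (i : ℕ) : (Alg P)ˣ where
  val := Xg P i
  inv := Xgi P i
  val_inv := by
    by_cases h : i = 0 ∨ P.n - 1 < i
    · rw [X_eq_one h, Xi_eq_one h, one_mul]
    · simpa using pr_eq (Rel.X_inv_right (P := P) (i := i) (by omega) (by omega))
  inv_val := by
    by_cases h : i = 0 ∨ P.n - 1 < i
    · rw [X_eq_one h, Xi_eq_one h, one_mul]
    · simpa using pr_eq (Rel.X_inv_left (P := P) (i := i) (by omega) (by omega))

@[simp]
theorem coe_Yu (P : Params R) : (Yu P : Alg P) = Yg P := rfl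

@[simp]
theorem coe_Yu_inv (P : Params R) : (↑(Yu P)⁻¹ : Alg P) = Ygi P := rfl

@[simp]
theorem coe_Xu (P : Params R) (i : ℕ) : (Xu P i : Alg P) = Xg P i := rfl

@[simp]
theorem coe_Xu_inv (P : Params R) (i : ℕ) : (↑(Xu P i)⁻¹ : Alg P) = Xgi P i := rfl

/-- The cyclotomic BMW algebra is a model of its defining relations. -/
def toModel (P : Params R) (hk : 1 ≤ P.k) (hq0 : P.qc 0 = (P.q0 : R)) : Model R (Alg P) where
  N := P.n - 1
  k := P.k
  δ := P.delta
  lam := P.lam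
  X := Xu P
  e := Eg P
  Y := Yu P
  q0 := P.q0
  q := P.qc
  c := P.A
  one_le_k := hk
  q_zero := hq0
  skein i h1 h2 := by simpa using pr_eq (Rel.skein (P := P) h1 h2)
  XX_far i j h := by
    refine Units.ext ?_
    change Xg P i * Xg P j = Xg P j * Xg P i
    by_cases hi : i = 0 ∨ P.n - 1 < i
    · rw [X_eq_one hi, one_mul, mul_one]
    by_cases hj : j = 0 ∨ P.n - 1 < j
    · rw [X_eq_one hj, one_mul, mul_one]
    simpa using pr_eq (Rel.XX_far (P := P) (i := i) (j := j) (by omega) (by omega) (by omega)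
      (by omega) (by omega))
  Xe_far i j h := by
    change Xg P i * Eg P j = Eg P j * Xg P i
    by_cases hi : i = 0 ∨ P.n - 1 < i
    · rw [X_eq_one hi, one_mul, mul_one]
    by_cases hj : j = 0 ∨ P.n - 1 < j
    · rw [E_eq_zero hj, zero_mul, mul_zero]
    simpa using pr_eq (Rel.XE_far (P := P) (i := i) (j := j) (by omega) (by omega) (by omega)
      (by omega) (by omega))
  ee_far i j h := by
    change Eg P i * Eg P j = Eg P j * Eg P i
    by_cases hi : i = 0 ∨ P.n - 1 < i
    · rw [E_eq_zero hi, zero_mul, mul_zero]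
    by_cases hj : j = 0 ∨ P.n - 1 < j
    · rw [E_eq_zero hj, zero_mul, mul_zero]
    simpa using pr_eq (Rel.EE_far (P := P) (i := i) (j := j) (by omega) (by omega) (by omega)
      (by omega) (by omega))
  braid i h1 h2 := Units.ext (by simpa using pr_eq (Rel.braid (P := P) h1 h2))
  Xe i h1 h2 := by simpa using pr_eq (Rel.untwist_right (P := P) h1 h2)
  eX i h1 h2 := by simpa using pr_eq (Rel.untwist_left (P := P) h1 h2)
  XXe i j h1 h2 h3 h4 h := by simpa using pr_eq (Rel.XXE (P := P) h1 h2 h3 h4 h)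
  eXX i j h1 h2 h3 h4 h := by simpa using (pr_eq (Rel.EXX (P := P) h1 h2 h3 h4 h)).symm
  eee i j h1 h2 h3 h4 h := by
    rcases h with rfl | rfl
    · simpa using pr_eq (Rel.EEE_up (P := P) h1 h4)
    · simpa using pr_eq (Rel.EEE_down (P := P) h3 h2)
  cyclo := by simpa using pr_eq (Rel.cyclo (P := P))
  braidB h := Units.ext (by simpa using pr_eq (Rel.braidB (P := P) (by omega)))
  YX_comm i h := by
    refine Units.ext ?_
    change Yg P * Xg P i = Xg P i * Yg P
    by_cases hi : i = 0 ∨ P.n - 1 < i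
    · rw [X_eq_one hi, one_mul, mul_one]
    simpa using pr_eq (Rel.YX_comm (P := P) (i := i) h (by omega))
  Ye_comm i h := by
    change Yg P * Eg P i = Eg P i * Yg P
    by_cases hi : i = 0 ∨ P.n - 1 < i
    · rw [E_eq_zero hi, zero_mul, mul_zero]
    simpa using pr_eq (Rel.YE_comm (P := P) (i := i) h (by omega))
  YXYe h := by simpa [Params.laminv] using pr_eq (Rel.YXYE (P := P) (by omega))
  eYXY h := by simpa [Params.laminv, mul_assoc] using pr_eq (Rel.EYXY (P := P) (by omega))
  eYe m h hm := by simpa using pr_eq (Rel.EYE (P := P) (m := m) (by omega) (by omega))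

end

end CBMW

namespace CBMW

section

variable {R : Type} [CommRing R] {P : Params R} {hk : 1 ≤ P.k} {hq0 : P.qc 0 = (P.q0 : R)}

theorem coe_y_toModel (i : ℕ) : ((toModel P hk hq0).y (i + 1) : Alg P) = Yp P (i + 1) := by
  induction i with
  | zero => simp [Model.y_one, Yp, downX, upX, toModel]
  | succ i ih =>
    rw [(toModel P hk hq0).coe_y_succ (Nat.le_add_left 1 i), ih]
    simp [Yp, downX, upX, toModel, mul_assoc]

theorem coe_y_inv_toModel (i : ℕ) :
    (↑((toModel P hk hq0).y (i + 1))⁻¹ : Alg P) = YpInv P (i + 1) := by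
  induction i with
  | zero => simp [Model.y_one, YpInv, downXi, upXi, toModel]
  | succ i ih =>
    rw [(toModel P hk hq0).y_succ (Nat.le_add_left 1 i), mul_inv_rev, mul_inv_rev,
      Units.val_mul, Units.val_mul, ih]
    simp [YpInv, downXi, upXi, toModel, mul_assoc]

theorem coe_y_zpow_toModel {i : ℕ} (hi : 1 ≤ i) (p : ℤ) :
    (↑((toModel P hk hq0).y i ^ p) : Alg P) = Ypow P i p := by
  obtain ⟨i, rfl⟩ := Nat.exists_eq_add_of_le' hi
  unfold Ypow
  split_ifs with h
  · lift p to ℕ using h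
    rw [zpow_natCast, Units.val_pow_eq_pow_val, coe_y_toModel, Int.toNat_natCast]
  · obtain ⟨p, rfl⟩ : ∃ d : ℕ, p = -d := ⟨(-p).toNat, by omega⟩
    rw [zpow_neg, ← inv_zpow, zpow_natCast, Units.val_pow_eq_pow_val, coe_y_inv_toModel, neg_neg,
      Int.toNat_natCast]

theorem coe_y_zpow_mul_w_toModel {i : ℕ} (hi : 1 ≤ i) (j l : ℕ) (p : ℤ) :
    ↑((toModel P hk hq0).y i ^ p) * (toModel P hk hq0).w l i j = alpha P i j l p := by
  rw [coe_y_zpow_toModel hi, alpha, mul_assoc]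
  rfl

theorem alphaChain_succ_eq_mul {l : ℕ} (hl : 2 ≤ l) {ii jj ii' jj' : ℕ → ℕ} {ss ss' : ℕ → ℤ}
    (hi : ∀ t, ii (t + 2) = ii' (t + 1)) (hj : ∀ t, jj (t + 2) = jj' (t + 1))
    (hs : ∀ t, ss (t + 2) = ss' (t + 1)) (m : ℕ) :
    alphaChain P l ii jj ss (m + 1) =
      alpha P (ii 1) (jj 1) (l - 1) (ss 1) * alphaChain P (l - 2) ii' jj' ss' m := by
  induction m with
  | zero => simp [alphaChain]
  | succ m ih =>
    rw [alphaChain, ih, alphaChain, hi, hj, hs, mul_assoc,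
      show l + 1 - 2 * (m + 1 + 1) = l - 2 + 1 - 2 * (m + 1) by omega]

theorem alphaChainBar_succ_eq_mul {l : ℕ} {ii jj ii' jj' : ℕ → ℕ} {ss ss' : ℕ → ℤ}
    (hi : ∀ t, ii (t + 2) = ii' (t + 1)) (hj : ∀ t, jj (t + 2) = jj' (t + 1))
    (hs : ∀ t, ss (t + 2) = ss' (t + 1)) (m : ℕ) :
    alphaChainBar P l ii jj ss (m + 1) =
      alpha P (ii 1) (jj 1) (l - 2) (ss 1) * alphaChainBar P (l - 2) ii' jj' ss' m := by
  induction m with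
  | zero => simp [alphaChainBar]
  | succ m ih =>
    rw [alphaChainBar, ih, alphaChainBar, hi, hj, hs, mul_assoc,
      show l - 2 * (m + 1 + 1) = l - 2 - 2 * (m + 1) by omega]

/-- The sequence `s` delayed by one step, with `x` in position one. -/
def delay {α : Type*} (x : α) (s : ℕ → α) : ℕ → α
  | 0 | 1 => x
  | t + 2 => s (t + 1)

/-- The conditions on the indices and exponents of the products in `V P l m`, together with a bound
on the first index. -/
def Admissible (k l m a : ℕ) (ii jj : ℕ → ℕ) (ss : ℕ → ℤ) : Prop :=
  (∀ t, 1 ≤ t → t ≤ m → 1 ≤ ii t ∧ ii t ≤ jj t ∧ jj t ≤ l + 1 - 2 * t ∧ ss t ∈ Pset k) ∧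
    (∀ t, 1 ≤ t → t + 1 ≤ m → ii (t + 1) < ii t) ∧ (1 ≤ m → ii 1 < a)

theorem Admissible.delay {k l m a i j : ℕ} {p : ℤ} {ii jj : ℕ → ℕ} {ss : ℕ → ℤ} (hl : 2 ≤ l)
    (h : Admissible k (l - 2) m i ii jj ss) (hi : 1 ≤ i) (hij : i ≤ j) (hj : j ≤ l - 1)
    (hia : i < a) (hp : p ∈ Pset k) :
    Admissible k l (m + 1) a (CBMW.delay i ii) (CBMW.delay j jj) (CBMW.delay p ss) := by
  obtain ⟨h1, h2, h3⟩ := h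
  refine ⟨?_, ?_, fun _ => hia⟩
  · rintro (_ | _ | t) ht1 ht2
    · omega
    · exact ⟨hi, hij, hj, hp⟩
    · obtain ⟨h4, h5, h6, h7⟩ := h1 (t + 1) (by omega) (by omega)
      exact ⟨h4, h5, h6.trans (by omega), h7⟩
  · rintro (_ | _ | t) ht1 ht2
    · omega
    · exact h3 (by omega)
    · exact h2 (t + 1) (by omega) (by omega)

theorem exists_eq_alphaChain {l m a : ℕ} (hl : 2 * m ≤ l) {x : Alg P}
    (hx : x ∈ (toModel P hk hq0).chain l m a) :
    ∃ ii jj ss, Admissible P.k l m a ii jj ss ∧ x = alphaChain P l ii jj ss m := by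
  induction m generalizing l a x with
  | zero =>
    exact ⟨0, 0, 0, ⟨by omega, by omega, by omega⟩, hx⟩
  | succ m ih =>
    obtain ⟨i, j, p, v, h1, hij, hj, hia, hp, hv, rfl⟩ := hx
    obtain ⟨ii, jj, ss, h, rfl⟩ := ih (by omega) hv
    refine ⟨delay i ii, delay j jj, delay p ss, h.delay (by omega) h1 hij hj hia hp, ?_⟩
    rw [alphaChain_succ_eq_mul (by omega) (fun _ => rfl) (fun _ => rfl) (fun _ => rfl),
      ← mul_assoc, coe_y_zpow_mul_w_toModel h1]
    rfl

theorem exists_eq_alphaChainBar {l m a : ℕ} (hl : 2 * m ≤ l) {x : Alg P}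
    (hx : x ∈ (toModel P hk hq0).chainBar l m a) :
    ∃ ii jj ss, Admissible P.k l m a ii jj ss ∧ x = alphaChainBar P l ii jj ss m := by
  induction m generalizing l a x with
  | zero =>
    exact ⟨0, 0, 0, ⟨by omega, by omega, by omega⟩, hx⟩
  | succ m ih =>
    obtain ⟨i, j, p, v, h1, hij, hj, hia, hp, hv, rfl⟩ := hx
    obtain ⟨ii, jj, ss, h, rfl⟩ := ih (by omega) hv
    refine ⟨delay i ii, delay j jj, delay p ss, h.delay (by omega) h1 hij hj hia hp, ?_⟩
    rw [alphaChainBar_succ_eq_mul (fun _ => rfl) (fun _ => rfl) (fun _ => rfl),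
      ← mul_assoc, coe_y_zpow_mul_w_toModel h1]
    rfl

theorem chain_subset_V {l m a : ℕ} (hl : 2 * m ≤ l) :
    (toModel P hk hq0).chain l m a ⊆ V P l m := fun _ hx =>
  let ⟨ii, jj, ss, h, hx⟩ := exists_eq_alphaChain hl hx
  ⟨ii, jj, ss, h.1, h.2.1, hx⟩

theorem chainBar_subset_Vbar {l m a : ℕ} (hl : 2 * m ≤ l) :
    (toModel P hk hq0).chainBar l m a ⊆ Vbar P l m := fun _ hx =>
  let ⟨ii, jj, ss, h, hx⟩ := exists_eq_alphaChainBar hl hx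
  ⟨ii, jj, ss, h.1, h.2.1, hx⟩

theorem sub_toModel_le (l : ℕ) : (toModel P hk hq0).sub l ≤ Bsub P l :=
  Algebra.adjoin_mono (Set.union_subset_union (fun _ hx => hx.2) subset_rfl)

theorem sub_toModel {l : ℕ} (hl : 1 ≤ l) : (toModel P hk hq0).sub l = Bsub P l :=
  (sub_toModel_le l).antisymm
    (Algebra.adjoin_mono (Set.union_subset_union (fun _ hx => ⟨hl, hx⟩) subset_rfl))

theorem Bsub_self : Bsub P P.n = ⊤ := by
  refine eq_top_iff.2 fun a _ => ?_
  obtain ⟨f, rfl⟩ := RingQuot.mkAlgHom_surjective R (Rel P) a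
  change pr P f ∈ _
  induction f using FreeAlgebra.induction with
  | grade0 r => rw [AlgHom.commutes]; exact Subalgebra.algebraMap_mem _ r
  | mul a b ha hb => rw [map_mul]; exact mul_mem (ha trivial) (hb trivial)
  | add a b ha hb => rw [map_add]; exact add_mem (ha trivial) (hb trivial)
  | grade1 x =>
    cases x with
    | Y => exact Algebra.subset_adjoin (Or.inl (Or.inl rfl))
    | Yinv => exact Algebra.subset_adjoin (Or.inl (Or.inr rfl))
    | X i =>
      change Xg P i ∈ _
      by_cases h : i = 0 ∨ P.n - 1 < i
      · exact X_eq_one h ▸ one_mem _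
      · exact Algebra.subset_adjoin (Or.inr ⟨i, by omega, by omega, by simp⟩)
    | Xinv i =>
      change Xgi P i ∈ _
      by_cases h : i = 0 ∨ P.n - 1 < i
      · exact Xi_eq_one h ▸ one_mem _
      · exact Algebra.subset_adjoin (Or.inr ⟨i, by omega, by omega, by simp⟩)
    | E i =>
      change Eg P i ∈ _
      by_cases h : i = 0 ∨ P.n - 1 < i
      · exact E_eq_zero h ▸ zero_mem _
      · exact Algebra.subset_adjoin (Or.inr ⟨i, by omega, by omega, by simp⟩)

end

end CBMW

open CBMW

/-- Theorem 5 of the paper. The cyclotomic BMW algebra `B_n^k(R)` is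
spanned by the elements
`α_{i₁,j₁,n-1}^{s₁}⋯α_{i_m,j_m,n-2m+1}^{s_m} χ (α_{g_m,h_m,n-2m}^{t_m})*⋯(α_{g₁,h₁,n-2}^{t₁})*`,
i.e. `B_n^k(R) = Σ_{m=0}^{⌊n/2⌋} V_{n,m} Ã_{n-2m} V̄_{n,m}*`. -/
theorem statement13 {R : Type} [CommRing R] (P : Params R)
    (hn : 1 ≤ P.n) (hk : 1 ≤ P.k) (hq0 : P.qc 0 = (P.q0 : R))
    (hcomp : (P.lam : R) - P.laminv = P.delta * (1 - P.A 0))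
    (st : Alg P →ₗ[R] Alg P) (hst1 : st 1 = 1)
    (hstmul : ∀ a b : Alg P, st (a * b) = st b * st a)
    (hstY : st (Yg P) = Yg P) (hstYi : st (Ygi P) = Ygi P)
    (hstX : ∀ i, st (Xg P i) = Xg P i) (hstXi : ∀ i, st (Xgi P i) = Xgi P i)
    (hstE : ∀ i, st (Eg P i) = Eg P i)
    (At : ℕ → Submodule R (Alg P))
    (hAt0 : At 0 = Subalgebra.toSubmodule (Bsub P 0))
    (hAt1 : At 1 = Subalgebra.toSubmodule (Bsub P 1))
    (hAtle : ∀ l, l ≤ P.n → At l ≤ Subalgebra.toSubmodule (Bsub P l))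
    (hAtsplit : ∀ l, 2 ≤ l → l ≤ P.n →
      Subalgebra.toSubmodule (Bsub P l)
        = At l ⊔ Submodule.span R
            {z : Alg P | ∃ b b', b ∈ Bsub P l ∧ b' ∈ Bsub P l ∧ z = b * Eg P (l - 1) * b'}) :
    (⊤ : Submodule R (Alg P))
      = ∑ m ∈ Finset.range (P.n / 2 + 1),
          Submodule.span R
            {z : Alg P | ∃ v χ w, v ∈ V P P.n m ∧ χ ∈ At (P.n - 2 * m) ∧
              w ∈ Vbar P P.n m ∧ z = v * χ * st w} := by
  refine Eq.symm ?_
  refine Model.eq_top_of_chain_mul_mem (M := toModel P hk hq0) (st := st) (n := P.n) hst1 hstmul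
    hstE (fun hb => Model.star_mem_sub hst1 hstmul hstY hstYi hstX hstXi hstE hb)
    (Nat.le_succ_of_pred_le le_rfl) ((sub_toModel hn).trans Bsub_self) At ?_ ?_ ?_
  · intro l hl
    interval_cases l
    · exact hAt0 ▸ sub_toModel_le 0
    · exact hAt1 ▸ sub_toModel_le 1
  · intro l hl hln
    rw [sub_toModel (by omega)]
    exact (hAtsplit l hl hln).le
  · intro m hm v hv χ hχ w hw
    refine Finset.single_le_sum (f := fun m => Submodule.span R
      {z : Alg P | ∃ v χ w, v ∈ V P P.n m ∧ χ ∈ At (P.n - 2 * m) ∧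
        w ∈ Vbar P P.n m ∧ z = v * χ * st w}) (fun _ _ => zero_le) (a := m) ?_ ?_
    · exact Finset.mem_range.2 (by omega)
    · exact Submodule.subset_span
        ⟨v, χ, w, chain_subset_V hm hv, hχ, chainBar_subset_Vbar hm hw, rfl⟩
end

section
/- Suppose a commutative ring S contains elements a and b such that a is not a zero divisor in S and the image of b in the quotient ring S/aS is not a zero divisor. Then the image of a in the quotient ring S/bS is not a zero divisor. -/
/-- Lemma `zerodiv` of the paper. If `a` is not a zero divisor in a
commutative ring `S` and the image of `b` is not a zero divisor in `S/aS`, then the image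
of `a` is not a zero divisor in `S/bS`. -/
theorem statement14 (S : Type) [CommRing S] (a b : S)
    (ha : ∀ y : S, a * y = 0 → y = 0)
    (hb : ∀ y : S ⧸ Ideal.span ({a} : Set S),
      Ideal.Quotient.mk (Ideal.span ({a} : Set S)) b * y = 0 → y = 0) :
    ∀ y : S ⧸ Ideal.span ({b} : Set S),
      Ideal.Quotient.mk (Ideal.span ({b} : Set S)) a * y = 0 → y = 0 := by
  intro y hy
  obtain ⟨x, rfl⟩ := Ideal.Quotient.mk_surjective y
  rw [← map_mul, Ideal.Quotient.eq_zero_iff_mem, Ideal.mem_span_singleton] at hy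
  obtain ⟨c, hc⟩ := hy
  have hac := hb (Ideal.Quotient.mk _ c) (by
    rw [← map_mul, Ideal.Quotient.eq_zero_iff_mem, Ideal.mem_span_singleton]
    exact ⟨x, hc.symm⟩)
  rw [Ideal.Quotient.eq_zero_iff_mem, Ideal.mem_span_singleton] at hac
  obtain ⟨z, rfl⟩ := hac
  rw [Ideal.Quotient.eq_zero_iff_mem, Ideal.mem_span_singleton]
  exact ⟨z, sub_eq_zero.mp (ha _ (by linear_combination hc))⟩
end

section
/- In the ring Ω, for every l with 1 ≤ l ≤ z − ε, the following identity holds: q₀⁻¹h_{k−l} − h_l + βq₀⁻¹q_l − h₀q_l = δh_l'. -/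
noncomputable section

/-!
The ring `Ω = ℤ[q^{±1}, λ^{±1}, q₀^{±1}, q₁, …, q_{k-1}, A₀, …, A_{k-1}]`, presented as a
polynomial ring (with explicit inverse variables) modulo the invertibility relations, and
the elements `β, h_l, h_l'` of the admissibility theory of cyclotomic BMW algebras.
-/

namespace CycloAdm

/-- The variables of `Ω`: `q, q⁻¹, λ, λ⁻¹, q₀, q₀⁻¹`, the `q_j` (`1 ≤ j ≤ k-1`, encoded by
`Fin (k-1)` with `qc t = q_{t+1}`) and the `A_j` (`0 ≤ j ≤ k-1`). -/
inductive OVar (k : ℕ) : Type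
  | q : OVar k
  | qi : OVar k
  | lam : OVar k
  | lami : OVar k
  | q0 : OVar k
  | q0i : OVar k
  | qc : Fin (k - 1) → OVar k
  | A : Fin k → OVar k

abbrev OmegaP (k : ℕ) := MvPolynomial (OVar k) ℤ

/-- The invertibility relations `q q⁻¹ = 1`, `λ λ⁻¹ = 1`, `q₀ q₀⁻¹ = 1`. -/
def OmegaI (k : ℕ) : Ideal (OmegaP k) :=
  Ideal.span ({MvPolynomial.X OVar.q * MvPolynomial.X OVar.qi - 1,
    MvPolynomial.X OVar.lam * MvPolynomial.X OVar.lami - 1,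
    MvPolynomial.X OVar.q0 * MvPolynomial.X OVar.q0i - 1} : Set (OmegaP k))

/-- The ring `Ω`. -/
abbrev Omega (k : ℕ) := OmegaP k ⧸ OmegaI k

def mkO (k : ℕ) : OmegaP k →+* Omega k := Ideal.Quotient.mk (OmegaI k)

def vq (k : ℕ) : Omega k := mkO k (MvPolynomial.X OVar.q)
def vqi (k : ℕ) : Omega k := mkO k (MvPolynomial.X OVar.qi)
def vlam (k : ℕ) : Omega k := mkO k (MvPolynomial.X OVar.lam)
def vlami (k : ℕ) : Omega k := mkO k (MvPolynomial.X OVar.lami)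
def vq0 (k : ℕ) : Omega k := mkO k (MvPolynomial.X OVar.q0)
def vq0i (k : ℕ) : Omega k := mkO k (MvPolynomial.X OVar.q0i)

/-- The variable `q_j` for `1 ≤ j ≤ k-1` (and `0` out of range). -/
def vqc (k : ℕ) (j : ℕ) : Omega k :=
  if h : 1 ≤ j ∧ j ≤ k - 1 then
    mkO k (MvPolynomial.X (OVar.qc ⟨j - 1, by omega⟩)) else 0

/-- The variable `A_j` for `0 ≤ j ≤ k-1` (and `0` out of range). -/
def vA (k : ℕ) (j : ℕ) : Omega k :=
  if h : j < k then mkO k (MvPolynomial.X (OVar.A ⟨j, h⟩)) else 0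

/-- `q_j ∈ Ω` for `0 ≤ j ≤ k`, with the conventions `q_0 := q₀` and `q_k := -1`. -/
def Qcv (k : ℕ) (j : ℕ) : Omega k :=
  if j = 0 then vq0 k else if j = k then -1 else vqc k j

/-- `β = q₀λ - q₀⁻¹λ⁻¹ + (1-ε)δ` where `k = 2z - ε`, `z = ⌈k/2⌉`, `δ = q - q⁻¹`. -/
def betaElt {T : Type} [CommRing T] (k : ℕ) (q qi lam lami q0 q0i : T) : T :=
  q0 * lam - q0i * lami + ((1 - (2 * ((k + 1) / 2) - k) : ℕ) : T) * (q - qi)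

/-- `h_l` for `0 ≤ l ≤ k-1` (with `h₀ = λ - λ⁻¹ + δ(A₀ - 1)`). -/
def hElt {T : Type} [CommRing T] (k : ℕ) (q qi lam lami q0i : T) (Qc Av : ℕ → T)
    (l : ℕ) : T :=
  if l = 0 then lam - lami + (q - qi) * (Av 0 - 1)
  else
    lami * (Qc l + q0i * Qc (k - l)) +
      (q - qi) * ((∑ r ∈ Finset.Icc 1 (k - l), Qc (r + l) * Av r)
        - (∑ i ∈ Finset.Icc (max (l + 1) ((k + 1) / 2)) ((l + k) / 2), Qc (2 * i - l))
        + (∑ i ∈ Finset.Icc ((l + 1) / 2) (min l ((k + 1) / 2 - 1)), Qc (2 * i - l)))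

/-- `h_l'` for `1 ≤ l ≤ k-1`. -/
def h'Elt {T : Type} [CommRing T] (k : ℕ) (q0i : T) (Qc Av : ℕ → T) (l : ℕ) : T :=
  (∑ r ∈ Finset.Icc 1 l, q0i * Qc (r + (k - l)) * Av r)
    - (∑ r ∈ Finset.Icc 0 (k - l), Qc (r + l) * Av r)
    - (∑ i ∈ Finset.Icc ((l + 1) / 2) (l - 1), (q0i * Qc (k + l - 2 * i) + Qc (2 * i - l)))
    + (∑ i ∈ Finset.Icc ((k + 1) / 2) ((l + k) / 2), (q0i * Qc (k + l - 2 * i) + Qc (2 * i - l)))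

/-- `β ∈ Ω`. -/
def betaO (k : ℕ) : Omega k :=
  betaElt k (vq k) (vqi k) (vlam k) (vlami k) (vq0 k) (vq0i k)

/-- `h_l ∈ Ω`. -/
def hO (k : ℕ) (l : ℕ) : Omega k :=
  hElt k (vq k) (vqi k) (vlam k) (vlami k) (vq0i k) (Qcv k) (vA k) l

/-- `h_l' ∈ Ω`. -/
def h'O (k : ℕ) (l : ℕ) : Omega k := h'Elt k (vq0i k) (Qcv k) (vA k) l

/-- `β₊`. -/
def betaPl (k : ℕ) : Omega k :=
  if k % 2 = 1 then vq0 k * vlam k - 1 else vq0 k * vlam k - vqi k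

/-- `β₋`. -/
def betaMi (k : ℕ) : Omega k :=
  if k % 2 = 1 then vq0i k * vlami k + 1 else vq k * vq0i k * vlami k + 1

/-- The ideal `I_σ = ⟨β_σ, h₀, h₁, …, h_{z-ε}, h₁', …, h_{z-ε}'⟩` of `Ω`
(note `z - ε = ⌊k/2⌋`). -/
def Isig (k : ℕ) (bs : Omega k) : Ideal (Omega k) :=
  Ideal.span ({bs, hO k 0} ∪
    {x | ∃ l, 1 ≤ l ∧ l ≤ k / 2 ∧ (x = hO k l ∨ x = h'O k l)})

end CycloAdm

end

open CycloAdm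

namespace CycloAdm

theorem vq0_mul_vq0i (k : ℕ) : vq0 k * vq0i k = 1 := by
  rw [vq0, vq0i, ← map_mul, ← sub_eq_zero, ← map_one (mkO k), ← map_sub, mkO,
    Ideal.Quotient.eq_zero_iff_mem]
  exact Ideal.subset_span (by simp)

section Sums

variable {T : Type*} [AddCommMonoid T]

theorem sum_Icc_eq_sum_Icc_reflect {k a b c d : ℕ} (f g : ℕ → T) (had : a + d = k)
    (hbc : b + c = k) (hfg : ∀ i ∈ Finset.Icc a b, f i = g (k - i)) :
    ∑ i ∈ Finset.Icc a b, f i = ∑ i ∈ Finset.Icc c d, g i := by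
  refine Finset.sum_nbij' (k - ·) (k - ·) ?_ ?_ ?_ ?_ hfg <;>
    simp only [Finset.mem_Icc] <;> omega

theorem sum_Icc_eq_add_sum_Icc_succ {a b : ℕ} (hab : a ≤ b) (f : ℕ → T) :
    ∑ i ∈ Finset.Icc a b, f i = f a + ∑ i ∈ Finset.Icc (a + 1) b, f i := by
  rw [← Finset.insert_Icc_add_one_left_eq_Icc hab, Finset.sum_insert (by simp)]

theorem sum_Icc_eq_sum_Icc_pred_add {a b : ℕ} (hb : 1 ≤ b) (hab : a ≤ b) (f : ℕ → T) :
    ∑ i ∈ Finset.Icc a b, f i = ∑ i ∈ Finset.Icc a (b - 1), f i + f b := by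
  obtain ⟨b, rfl⟩ := Nat.exists_eq_add_of_le' hb
  exact Finset.sum_Icc_succ_top hab f

end Sums

section Coefficients

variable {T : Type*} [CommRing T] (Q : ℕ → T) {k l : ℕ}

theorem hElt_upper_sum_sub_lower_sum (h1 : 1 ≤ l) (hl : l ≤ k / 2) :
    (∑ i ∈ Finset.Icc (max (l + 1) ((k + 1) / 2)) ((l + k) / 2), Q (2 * i - l))
        - (∑ i ∈ Finset.Icc ((l + 1) / 2) (min l ((k + 1) / 2 - 1)), Q (2 * i - l)) + Q l
      = (∑ i ∈ Finset.Icc ((k + 1) / 2) ((l + k) / 2), Q (2 * i - l))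
        - ∑ i ∈ Finset.Icc ((l + 1) / 2) (l - 1), Q (2 * i - l) := by
  have hQ : Q (2 * l - l) = Q l := by congr 1; omega
  rcases lt_or_ge l ((k + 1) / 2) with h | h
  · rw [max_eq_right (by omega), min_eq_left (by omega),
      sum_Icc_eq_sum_Icc_pred_add (b := l) h1 (by omega), hQ]
    ring
  · obtain hz : (k + 1) / 2 = l := by omega
    rw [hz, max_eq_left (by omega), min_eq_right (by omega),
      sum_Icc_eq_add_sum_Icc_succ (a := l) (by omega), hQ]
    ring

theorem hElt_complement_upper_sum (h1 : 1 ≤ l) (hl : l ≤ k / 2) :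
    ∑ i ∈ Finset.Icc (max (k - l + 1) ((k + 1) / 2)) ((k - l + k) / 2), Q (2 * i - (k - l))
      = ∑ i ∈ Finset.Icc ((l + 1) / 2) (l - 1), Q (k + l - 2 * i) := by
  rw [max_eq_left (by omega)]
  refine sum_Icc_eq_sum_Icc_reflect (k := k) _ _ (by omega) (by omega) fun i hi => ?_
  rw [Finset.mem_Icc] at hi
  congr 1
  omega

theorem hElt_complement_lower_sum (h1 : 1 ≤ l) (hl : l ≤ k / 2) :
    (∑ i ∈ Finset.Icc ((k - l + 1) / 2) (min (k - l) ((k + 1) / 2 - 1)), Q (2 * i - (k - l)))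
        + ((1 - (2 * ((k + 1) / 2) - k) : ℕ) : T) * Q l
      = ∑ i ∈ Finset.Icc ((k + 1) / 2) ((l + k) / 2), Q (k + l - 2 * i) := by
  have hsum : ∑ i ∈ Finset.Icc ((k - l + 1) / 2) (min (k - l) ((k + 1) / 2 - 1)),
        Q (2 * i - (k - l))
      = ∑ i ∈ Finset.Icc (k - ((k + 1) / 2 - 1)) ((l + k) / 2), Q (k + l - 2 * i) := by
    rw [min_eq_right (by omega)]
    refine sum_Icc_eq_sum_Icc_reflect (k := k) _ _ (by omega) (by omega) fun i hi => ?_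
    rw [Finset.mem_Icc] at hi
    congr 1
    omega
  rw [hsum]
  rcases Nat.mod_two_eq_zero_or_one k with h | h
  · rw [sum_Icc_eq_add_sum_Icc_succ (a := (k + 1) / 2) (by omega),
      show k - ((k + 1) / 2 - 1) = (k + 1) / 2 + 1 by omega,
      show 1 - (2 * ((k + 1) / 2) - k) = 1 by omega,
      show k + l - 2 * ((k + 1) / 2) = l by omega]
    push_cast
    ring
  · rw [show k - ((k + 1) / 2 - 1) = (k + 1) / 2 by omega,
      show 1 - (2 * ((k + 1) / 2) - k) = 0 by omega]
    push_cast
    ring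

end Coefficients

theorem hElt_admissibility_relation {T : Type} [CommRing T] {k l : ℕ}
    (q qi lam lami q0 q0i : T) (Q A : ℕ → T) (h0 : q0 * q0i = 1)
    (h1 : 1 ≤ l) (hl : l ≤ k / 2) :
    q0i * hElt k q qi lam lami q0i Q A (k - l) - hElt k q qi lam lami q0i Q A l
        + betaElt k q qi lam lami q0 q0i * q0i * Q l - hElt k q qi lam lami q0i Q A 0 * Q l
      = (q - qi) * h'Elt k q0i Q A l := by
  have e1 := hElt_upper_sum_sub_lower_sum Q h1 hl
  have e2 := hElt_complement_upper_sum Q h1 hl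
  have e3 := hElt_complement_lower_sum Q h1 hl
  have e4 : ∑ r ∈ Finset.Icc 1 l, q0i * Q (r + (k - l)) * A r
      = q0i * ∑ r ∈ Finset.Icc 1 l, Q (r + (k - l)) * A r := by
    simp only [Finset.mul_sum, mul_assoc]
  have e5 := sum_Icc_eq_add_sum_Icc_succ (Nat.zero_le (k - l)) fun r => Q (r + l) * A r
  simp only [zero_add] at e5
  simp only [hElt, h'Elt, betaElt, if_neg (show k - l ≠ 0 by omega),
    if_neg (show l ≠ 0 by omega), if_true, show k - (k - l) = l by omega,
    Finset.sum_add_distrib, ← Finset.mul_sum, e4, e5, e2]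
  linear_combination (q - qi) * e1 + (q - qi) * q0i * e3 + lam * Q l * h0

end CycloAdm

/-- equation (32) of the paper. In `Ω`, for `1 ≤ l ≤ z - ε = ⌊k/2⌋`:
`q₀⁻¹ h_{k-l} - h_l + β q₀⁻¹ q_l - h₀ q_l = δ h_l'`. -/
theorem statement15 (k : ℕ) (hk : 2 ≤ k) :
    ∀ l, 1 ≤ l → l ≤ k / 2 →
      vq0i k * hO k (k - l) - hO k l + betaO k * vq0i k * Qcv k l - hO k 0 * Qcv k l
        = (vq k - vqi k) * h'O k l := by
  intro l h1 hl
  exact hElt_admissibility_relation _ _ _ _ _ _ _ _ (vq0_mul_vq0i k) h1 hl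
end
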